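/- Fix a > 1/2 and α > 0. Then as T → +∞, ∫_T^{T+T^a} ( ∫_t^{t+(ln T)^α} X(u) du )² dt = (1 + o(1)) · √(2π³) · T^a · (ln T)^α; that is, the quotient of the left-hand side by √(2π³)·T^a·(ln T)^α tends to 1. -/

import Mathlib

open Filter Topology

noncomputable def XiF (t : ℝ) : ℝ :=
  (((1/2 + Complex.I * t) * ((1/2 + Complex.I * t) - 1) / 2) *
    (Real.pi : ℂ) ^ (-(1/2 + Complex.I * t) / 2) *
    Complex.Gamma ((1/2 + Complex.I * t) / 2) *
    riemannZeta (1/2 + Complex.I * t)).re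

noncomputable def XHL (t : ℝ) : ℝ :=
  -(t ^ ((1:ℝ)/4) * Real.exp (Real.pi * t / 4) / (1/4 + t ^ 2)) * XiF t

namespace HardyLittlewood

lemma norm_log_add_sub_log_sub_div_le {w b : ℂ} (hw : 0 < w.re) (hwb : 0 < (w + b).re)
    (hb : ‖b‖ ≤ ‖w‖ / 2) :
    ‖Complex.log (w + b) - Complex.log w - b / w‖ ≤ 2 * ‖b‖ ^ 2 / ‖w‖ ^ 2 := by
  have hw0 : 0 < ‖w‖ := norm_pos_iff.2 (fun h => by simp [h] at hw)
  have hwne : w ≠ 0 := norm_pos_iff.1 hw0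
  have hre : ∀ θ ∈ Set.Icc (0:ℝ) 1, 0 < (w + θ * b).re := by
    intro θ hθ
    have h1 : (w + θ * b).re = (1 - θ) * w.re + θ * (w + b).re := by
      simp; ring
    rw [h1]
    rcases eq_or_lt_of_le hθ.1 with h | h
    · rw [← h]; simpa using hw
    · have := mul_nonneg (sub_nonneg.2 hθ.2) hw.le
      have := mul_pos h hwb
      linarith
  have hd : ∀ θ ∈ Set.Icc (0:ℝ) 1, HasDerivWithinAt
      (fun θ : ℝ => Complex.log (w + θ * b) - θ * (b / w)) (b / (w + θ * b) - b / w)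
        (Set.Icc 0 1) θ := by
    intro θ hθ
    have h1 : HasDerivAt (fun θ : ℝ => w + (θ:ℂ) * b) b θ := by
      simpa using ((Complex.ofRealCLM.hasDerivAt (x := θ)).mul_const b).const_add w
    have h2 := h1.clog_real (Or.inl (hre θ hθ))
    have h3 : HasDerivAt (fun θ : ℝ => (θ:ℂ) * (b / w)) (b / w) θ := by
      simpa using ((Complex.ofRealCLM.hasDerivAt (x := θ)).mul_const (b / w))
    exact (h2.sub h3).hasDerivWithinAt
  have hbd : ∀ θ ∈ Set.Ico (0:ℝ) 1, ‖b / (w + θ * b) - b / w‖ ≤ 2 * ‖b‖ ^ 2 / ‖w‖ ^ 2 := by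
    intro θ hθ
    have hθb : ‖(θ:ℂ) * b‖ ≤ ‖b‖ := by
      rw [norm_mul, Complex.norm_real, Real.norm_of_nonneg hθ.1]
      exact mul_le_of_le_one_left (norm_nonneg _) hθ.2.le
    have h1 : ‖w‖ / 2 ≤ ‖w + θ * b‖ := by
      have := norm_sub_le (w + θ * b) (θ * b)
      rw [add_sub_cancel_right] at this
      linarith
    have hne : w + θ * b ≠ 0 := norm_pos_iff.1 (by linarith [half_pos hw0])
    have h2 : b / (w + θ * b) - b / w = -(b * (θ * b)) / ((w + θ * b) * w) := by
      rw [div_sub_div _ _ hne hwne]; congr 1; ring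
    rw [h2, norm_div, norm_neg, norm_mul, norm_mul (w + θ * b)]
    rw [div_le_div_iff₀ (mul_pos (norm_pos_iff.2 hne) hw0) (by positivity)]
    have h3 : ‖b‖ * ‖(θ:ℂ) * b‖ ≤ ‖b‖ ^ 2 := by
      rw [pow_two]; exact mul_le_mul_of_nonneg_left hθb (norm_nonneg _)
    calc ‖b‖ * ‖(θ:ℂ) * b‖ * ‖w‖ ^ 2 ≤ ‖b‖ ^ 2 * ‖w‖ ^ 2 := by gcongr
      _ = 2 * ‖b‖ ^ 2 * (‖w‖ / 2 * ‖w‖) := by ring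
      _ ≤ 2 * ‖b‖ ^ 2 * (‖w + θ * b‖ * ‖w‖) := by gcongr
  have := norm_image_sub_le_of_norm_deriv_le_segment_01' hd hbd
  simpa [sub_right_comm] using this

lemma summable_one_div_norm_add_nat_sq {z : ℂ} (hre : 0 ≤ z.re) (him : 2 ≤ z.im) :
    Summable (fun k : ℕ => 1 / ‖z + k‖ ^ 2) ∧ ∑' k : ℕ, 1 / ‖z + k‖ ^ 2 ≤ 4 / z.im := by
  have hbd : ∀ k : ℕ, 1 / ‖z + k‖ ^ 2 ≤ 2 / (z.im - 1 + k) - 2 / (z.im - 1 + (k + 1 : ℕ)) := by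
    intro k
    have h1 : ‖z + k‖ ^ 2 = (z.re + k) ^ 2 + z.im ^ 2 := by
      rw [Complex.sq_norm, Complex.normSq_apply]; simp; ring
    have hk : (0:ℝ) ≤ k := Nat.cast_nonneg k
    have h2 : (k:ℝ) ^ 2 + z.im ^ 2 ≤ ‖z + k‖ ^ 2 := by rw [h1]; nlinarith
    have h3 : 0 < z.im - 1 + k := by linarith
    have h4 : 2 / (z.im - 1 + k) - 2 / (z.im - 1 + (k + 1 : ℕ)) =
        2 / ((z.im - 1 + k) * (z.im + k)) := by
      push_cast
      have : z.im - 1 + (k + 1) ≠ 0 := by linarith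
      have : z.im + k ≠ 0 := by linarith
      field_simp; ring
    rw [h4, div_le_div_iff₀ (by nlinarith) (by nlinarith)]
    nlinarith [sq_nonneg (z.im - k)]
  have hpart : ∀ n : ℕ, ∑ k ∈ Finset.range n, 1 / ‖z + k‖ ^ 2 ≤ 4 / z.im := by
    intro n
    calc _ ≤ ∑ k ∈ Finset.range n,
          (2 / (z.im - 1 + k) - 2 / (z.im - 1 + (k + 1 : ℕ))) := Finset.sum_le_sum fun k _ => hbd k
      _ = 2 / (z.im - 1 + (0:ℕ)) - 2 / (z.im - 1 + n) :=
          Finset.sum_range_sub' (fun k : ℕ => 2 / (z.im - 1 + (k:ℝ))) n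
      _ ≤ 2 / (z.im - 1) := by
          have : 0 ≤ 2 / (z.im - 1 + n) := by
            have : (0:ℝ) ≤ n := Nat.cast_nonneg n
            apply div_nonneg <;> linarith
          simp; linarith
      _ ≤ 4 / z.im := by
          rw [div_le_div_iff₀ (by linarith) (by linarith)]; linarith
  exact ⟨summable_of_sum_range_le (fun k => by positivity) hpart,
    Real.tsum_le_of_sum_range_le (fun k => by positivity) hpart⟩

/-- Ratio form of Stirling's formula, uniform in the right half-plane. -/
lemma exists_Gamma_add_eq {z b : ℂ} (hz : 0 < z.re) (hzb : 0 < (z + b).re) (him : 2 ≤ z.im)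
    (hb : ‖b‖ ≤ z.im / 2) :
    ∃ E : ℂ, ‖E‖ ≤ 8 * ‖b‖ * (1 + ‖b‖) / z.im ∧
      Complex.Gamma (z + b) = Complex.Gamma z * Complex.exp (b * Complex.log z) * Complex.exp E := by
  set e : ℕ → ℂ := fun k => b * (Complex.log (z + (k + 1 : ℕ)) - Complex.log (z + k)) -
    (Complex.log (z + b + k) - Complex.log (z + k)) with he
  have hkre : ∀ k : ℕ, 0 < (z + k).re := fun k => by
    have : (0:ℝ) ≤ k := Nat.cast_nonneg k
    simp; linarith
  have hkbre : ∀ k : ℕ, 0 < (z + b + k).re := fun k => by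
    have : (0:ℝ) ≤ k := Nat.cast_nonneg k
    simp at hzb ⊢; linarith
  have hne : ∀ k : ℕ, z + k ≠ 0 := fun k h => by have := hkre k; rw [h] at this; simp at this
  have hbne : ∀ k : ℕ, z + b + k ≠ 0 := fun k h => by
    have := hkbre k; rw [h] at this; simp at this
  have hknorm : ∀ k : ℕ, z.im ≤ ‖z + k‖ := fun k => by
    have := Complex.abs_im_le_norm (z + k)
    simp at this
    exact (le_abs_self _).trans this
  have hebd : ∀ k : ℕ, ‖e k‖ ≤ 2 * ‖b‖ * (1 + ‖b‖) * (1 / ‖z + k‖ ^ 2) := by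
    intro k
    have hn := hknorm k
    have h1 := norm_log_add_sub_log_sub_div_le (w := z + k) (b := b) (hkre k)
      (by have := hkbre k; convert this using 2; ring) (by linarith)
    have h2 := norm_log_add_sub_log_sub_div_le (w := z + k) (b := 1) (hkre k)
      (by have := hkre k; simp at this ⊢; linarith) (by simp; linarith)
    have h3 : e k = b * (Complex.log (z + k + 1) - Complex.log (z + k) - 1 / (z + k)) -
        (Complex.log (z + k + b) - Complex.log (z + k) - b / (z + k)) := by
      simp only [he]
      rw [show z + b + k = z + k + b by ring, show z + ((k + 1 : ℕ) : ℂ) = z + k + 1 by push_cast; ring]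
      ring
    rw [h3]
    refine (norm_sub_le _ _).trans ?_
    rw [norm_mul]
    have h4 := mul_le_mul_of_nonneg_left h2 (norm_nonneg b)
    refine (add_le_add h4 h1).trans (le_of_eq ?_)
    simp; ring
  obtain ⟨hs, hle⟩ := summable_one_div_norm_add_nat_sq hz.le him
  have hsum' := hs.mul_left (2 * ‖b‖ * (1 + ‖b‖))
  have hesum : Summable e := Summable.of_norm_bounded hsum' hebd
  refine ⟨∑' k, e k, ?_, ?_⟩
  · refine (tsum_of_norm_bounded (hsum'.hasSum) hebd).trans ?_
    rw [tsum_mul_left]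
    calc _ ≤ 2 * ‖b‖ * (1 + ‖b‖) * (4 / z.im) := by gcongr
      _ = _ := by ring
  · have hlim1 : Tendsto (fun n : ℕ => Complex.exp (∑ k ∈ Finset.range (n + 1), e k)) atTop
        (𝓝 (Complex.exp (∑' k, e k))) :=
      (Complex.continuous_exp.tendsto _).comp
        (hesum.hasSum.tendsto_sum_nat.comp (tendsto_add_atTop_nat 1))
    have hlog : Tendsto (fun n : ℕ => Complex.log n - Complex.log (z + (n + 1 : ℕ))) atTop (𝓝 0) := by
      have hb1 : Tendsto (fun n : ℕ => ‖(z + 1) / n‖ + 2 * ‖z + 1‖ ^ 2 / ‖(n:ℂ)‖ ^ 2) atTop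
          (𝓝 0) := by
        have h1 : Tendsto (fun n : ℕ => (n:ℝ)⁻¹) atTop (𝓝 0) := tendsto_inv_atTop_nhds_zero_nat
        have := (h1.const_mul ‖z + 1‖).add ((h1.pow 2).const_mul (2 * ‖z + 1‖ ^ 2))
        simp only [mul_zero, ne_eq, OfNat.ofNat_ne_zero, not_false_eq_true, zero_pow, add_zero] at this
        refine this.congr fun n => ?_
        rw [norm_div, Complex.norm_natCast]
        simp [div_eq_mul_inv]
      refine squeeze_zero_norm' ?_ hb1
      filter_upwards [eventually_ge_atTop ⌈2 * ‖z + 1‖⌉₊, eventually_gt_atTop 0] with n hn hn0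
      have hn1 : 2 * ‖z + 1‖ ≤ n := (Nat.le_ceil _).trans (by exact_mod_cast hn)
      have hn0' : (0:ℝ) < n := by exact_mod_cast hn0
      have h := norm_log_add_sub_log_sub_div_le (w := (n:ℂ)) (b := z + 1) (by simpa using hn0)
        (by simp; linarith) (by rw [Complex.norm_natCast]; linarith)
      rw [show z + ((n + 1 : ℕ) : ℂ) = n + (z + 1) by push_cast; ring]
      have h2 := norm_add_le (Complex.log (n + (z + 1)) - Complex.log n - (z + 1) / n) ((z + 1) / n)
      rw [sub_add_cancel] at h2
      rw [norm_sub_rev]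
      linarith
    have hlim2 : Tendsto (fun n : ℕ => Complex.exp (b *
        (Complex.log n - Complex.log (z + (n + 1 : ℕ)) + Complex.log z))) atTop
        (𝓝 (Complex.exp (b * Complex.log z))) := by
      have := ((hlog.add_const (Complex.log z)).const_mul b)
      rw [zero_add] at this
      exact (Complex.continuous_exp.tendsto _).comp this
    have hlim3 := ((Complex.GammaSeq_tendsto_Gamma z).mul hlim2).mul hlim1
    refine tendsto_nhds_unique (Complex.GammaSeq_tendsto_Gamma (z + b)) (hlim3.congr' ?_)
    filter_upwards [eventually_gt_atTop 0] with n hn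
    have hn0 : (n:ℂ) ≠ 0 := by exact_mod_cast hn.ne'
    have hprod : ∏ j ∈ Finset.range (n + 1), (z + b + j) =
        (∏ j ∈ Finset.range (n + 1), (z + j)) *
        Complex.exp (∑ j ∈ Finset.range (n + 1), (Complex.log (z + b + j) - Complex.log (z + j))) := by
      rw [Complex.exp_sum, ← Finset.prod_mul_distrib]
      refine Finset.prod_congr rfl fun j _ => ?_
      rw [Complex.exp_sub, Complex.exp_log (hbne j), Complex.exp_log (hne j),
        mul_div_cancel₀ _ (hne j)]
    have hsum : ∑ k ∈ Finset.range (n + 1), e k = b * (Complex.log (z + (n + 1 : ℕ)) - Complex.log z) -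
        ∑ j ∈ Finset.range (n + 1), (Complex.log (z + b + j) - Complex.log (z + j)) := by
      simp only [he]
      rw [Finset.sum_sub_distrib, ← Finset.mul_sum,
        Finset.sum_range_sub (fun k : ℕ => Complex.log (z + k))]
      simp
    have hpne : ∏ j ∈ Finset.range (n + 1), (z + j) ≠ 0 := Finset.prod_ne_zero_iff.2 fun j _ => hne j
    rw [Complex.GammaSeq, Complex.GammaSeq, hprod, hsum, Complex.exp_sub, Complex.cpow_def_of_ne_zero hn0,
      Complex.cpow_def_of_ne_zero hn0]
    have h1 : Complex.exp (Complex.log n * (z + b)) = Complex.exp (Complex.log n * z) *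
        Complex.exp (b * (Complex.log n - Complex.log (z + (n + 1 : ℕ)) + Complex.log z)) *
        Complex.exp (b * (Complex.log (z + (n + 1 : ℕ)) - Complex.log z)) := by
      rw [← Complex.exp_add, ← Complex.exp_add]; congr 1; ring
    rw [h1]
    have := Complex.exp_ne_zero
      (∑ j ∈ Finset.range (n + 1), (Complex.log (z + b + j) - Complex.log (z + j)))
    field_simp

lemma norm_sin_pi_mul_bounds (x y : ℝ) :
    (Real.exp (Real.pi * y) - Real.exp (-(Real.pi * y))) / 2 ≤
        ‖Complex.sin (Real.pi * (x + y * Complex.I))‖ ∧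
      ‖Complex.sin (Real.pi * (x + y * Complex.I))‖ ≤
        (Real.exp (Real.pi * y) + Real.exp (-(Real.pi * y))) / 2 := by
  have h1 : ‖Complex.exp (-(Real.pi * (x + y * Complex.I)) * Complex.I)‖ = Real.exp (Real.pi * y) := by
    rw [Complex.norm_exp]; congr 1; simp
  have h2 : ‖Complex.exp ((Real.pi * (x + y * Complex.I)) * Complex.I)‖ =
      Real.exp (-(Real.pi * y)) := by
    rw [Complex.norm_exp]; congr 1; simp
  rw [Complex.sin, norm_div, norm_mul, Complex.norm_I, mul_one, Complex.norm_ofNat]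
  constructor
  · have := norm_sub_norm_le (Complex.exp (-(Real.pi * (x + y * Complex.I)) * Complex.I))
      (Complex.exp ((Real.pi * (x + y * Complex.I)) * Complex.I))
    rw [h1, h2] at this
    linarith
  · have := norm_sub_le (Complex.exp (-(Real.pi * (x + y * Complex.I)) * Complex.I))
      (Complex.exp ((Real.pi * (x + y * Complex.I)) * Complex.I))
    rw [h1, h2] at this
    linarith

lemma exp_neg_mul_norm_sin_tendsto (x : ℝ) :
    Tendsto (fun y : ℝ => Real.exp (-(Real.pi * y)) * ‖Complex.sin (Real.pi * (x + y * Complex.I))‖)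
      atTop (𝓝 (1 / 2)) := by
  have h0 : Tendsto (fun y : ℝ => Real.exp (-(Real.pi * y)) ^ 2) atTop (𝓝 0) := by
    have : Tendsto (fun y : ℝ => Real.exp (-(Real.pi * y))) atTop (𝓝 0) :=
      Real.tendsto_exp_neg_atTop_nhds_zero.comp (tendsto_id.const_mul_atTop Real.pi_pos)
    simpa using this.pow 2
  have hl : Tendsto (fun y : ℝ => (1 - Real.exp (-(Real.pi * y)) ^ 2) / 2) atTop (𝓝 (1 / 2)) := by
    simpa using (h0.const_sub 1).div_const 2
  have hu : Tendsto (fun y : ℝ => (1 + Real.exp (-(Real.pi * y)) ^ 2) / 2) atTop (𝓝 (1 / 2)) := by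
    simpa using (h0.const_add 1).div_const 2
  refine tendsto_of_tendsto_of_tendsto_of_le_of_le' hl hu ?_ ?_
  all_goals
    filter_upwards [eventually_ge_atTop 0] with y hy
    have hb := norm_sin_pi_mul_bounds x y
    have he : Real.exp (-(Real.pi * y)) * Real.exp (Real.pi * y) = 1 := by
      rw [← Real.exp_add]; simp
    have hp := Real.exp_pos (-(Real.pi * y))
  · nlinarith [mul_le_mul_of_nonneg_left hb.1 hp.le]
  · nlinarith [mul_le_mul_of_nonneg_left hb.2 hp.le]

/-- Stirling's formula for `|Γ(1/4 + iy)|²`. -/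
lemma norm_Gamma_quarter_tendsto :
    Tendsto (fun y : ℝ => Real.exp (Real.pi * y) * Real.sqrt y *
      ‖Complex.Gamma (1 / 4 + y * Complex.I)‖ ^ 2) atTop (𝓝 (2 * Real.pi)) := by
  have key : ∀ y : ℝ, 2 ≤ y → ∃ e : ℝ, |e| ≤ 6 / y ∧
      Real.exp (Real.pi * y) * Real.sqrt y * ‖Complex.Gamma (1 / 4 + y * Complex.I)‖ ^ 2 =
      Real.pi / (Real.exp (-(Real.pi * y)) *
          ‖Complex.sin (Real.pi * ((1 / 4 : ℝ) + y * Complex.I))‖ *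
        (‖(1 / 4 : ℂ) + y * Complex.I‖ / y) ^ (1 / 2 : ℝ) * Real.exp e) := by
    intro y hy
    set z : ℂ := 1 / 4 + y * Complex.I with hz
    have hzre : z.re = 1 / 4 := by simp [hz]
    have hzim : z.im = y := by simp [hz]
    have hz0 : z ≠ 0 := fun h => by rw [h] at hzre; norm_num at hzre
    obtain ⟨E, hE, hG⟩ := exists_Gamma_add_eq (z := z) (b := 1 / 2) (by rw [hzre]; norm_num)
      (by rw [Complex.add_re, hzre]; norm_num) (by rw [hzim]; exact hy)
      (by rw [hzim]; norm_num; linarith)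
    refine ⟨E.re, (Complex.abs_re_le_norm E).trans (hE.trans (le_of_eq ?_)), ?_⟩
    · rw [hzim]; norm_num
    have hconj : (1 - z) = (starRingEnd ℂ) (z + 1 / 2) := by
      apply Complex.ext <;> simp [hzre, hzim]; norm_num
    have hrefl := congrArg norm (Complex.Gamma_mul_Gamma_one_sub z)
    rw [hconj, Complex.Gamma_conj, norm_mul, Complex.norm_conj, hG, norm_mul, norm_mul,
      Complex.norm_exp, Complex.norm_exp, norm_div, Complex.norm_real,
      Real.norm_of_nonneg Real.pi_pos.le] at hrefl
    have hlog : (1 / 2 * Complex.log z).re = Real.log ‖z‖ * (1 / 2 : ℝ) := by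
      have : (1 / 2 : ℂ) = ((1 / 2 : ℝ) : ℂ) := by norm_num
      rw [this, Complex.re_ofReal_mul, Complex.log_re]; ring
    rw [hlog, ← Real.rpow_def_of_pos (norm_pos_iff.2 hz0)] at hrefl
    have hs : Complex.sin (Real.pi * ((1 / 4 : ℝ) + y * Complex.I)) = Complex.sin (Real.pi * z) := by
      rw [hz]; norm_num
    rw [hs]
    have hy0 : 0 < y := by linarith
    have hb := (norm_sin_pi_mul_bounds (1 / 4) y).1
    rw [hs] at hb
    have hsin : 0 < ‖Complex.sin (Real.pi * z)‖ := by
      refine lt_of_lt_of_le ?_ hb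
      have : Real.exp (-(Real.pi * y)) < Real.exp (Real.pi * y) := by
        apply Real.exp_lt_exp.2; nlinarith [Real.pi_pos]
      linarith
    rw [Real.div_rpow (norm_nonneg _) hy0.le, ← Real.sqrt_eq_rpow, ← Real.sqrt_eq_rpow]
    rw [← Real.sqrt_eq_rpow] at hrefl
    have hsy : 0 < Real.sqrt y := Real.sqrt_pos.2 hy0
    have hsz : 0 < Real.sqrt ‖z‖ := Real.sqrt_pos.2 (norm_pos_iff.2 hz0)
    have hee : Real.exp (-(Real.pi * y)) = (Real.exp (Real.pi * y))⁻¹ := Real.exp_neg _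
    rw [hee]
    have he1 := Real.exp_pos (Real.pi * y)
    have he2 := Real.exp_pos E.re
    rw [eq_div_iff hsin.ne'] at hrefl
    rw [eq_div_iff (by positivity)]
    field_simp
    linear_combination hrefl
  choose! e he1 he2 using key
  have hlim_e : Tendsto e atTop (𝓝 0) := by
    refine squeeze_zero_norm' (a := fun y => 6 / y) ?_ (tendsto_const_nhds.div_atTop tendsto_id)
    filter_upwards [eventually_ge_atTop 2] with y hy using he1 y hy
  have hlim_z : Tendsto (fun y : ℝ => ‖(1 / 4 : ℂ) + y * Complex.I‖ / y) atTop (𝓝 1) := by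
    have h1 : Tendsto (fun y : ℝ => 1 / 4 / y) atTop (𝓝 0) := tendsto_const_nhds.div_atTop tendsto_id
    have hl : Tendsto (fun _ : ℝ => (1 : ℝ)) atTop (𝓝 1) := tendsto_const_nhds
    have hu : Tendsto (fun y : ℝ => 1 + 1 / 4 / y) atTop (𝓝 1) := by simpa using h1.const_add 1
    refine tendsto_of_tendsto_of_tendsto_of_le_of_le' hl hu ?_ ?_
    all_goals filter_upwards [eventually_gt_atTop 0] with y hy
    · rw [le_div_iff₀ hy, one_mul]
      have := Complex.abs_im_le_norm ((1 / 4 : ℂ) + y * Complex.I)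
      simp at this
      exact (le_abs_self y).trans (by simpa using this)
    · rw [div_le_iff₀ hy]
      refine (norm_add_le _ _).trans ?_
      rw [norm_mul, Complex.norm_I, Complex.norm_real, Real.norm_of_nonneg hy.le]
      have : (1 + 1 / 4 / y) * y = y + 1 / 4 := by field_simp
      rw [this]; norm_num; linarith
  have hden := ((exp_neg_mul_norm_sin_tendsto (1 / 4)).mul
    (hlim_z.rpow_const (p := 1 / 2) (Or.inl one_ne_zero))).mul
      ((Real.continuous_exp.tendsto 0).comp hlim_e)
  have hfin := (tendsto_const_nhds (x := Real.pi)).div hden (by simp)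
  have : Real.pi / (1 / 2 * 1 ^ (1 / 2 : ℝ) * Real.exp 0) = 2 * Real.pi := by simp; ring
  rw [this] at hfin
  refine hfin.congr' ?_
  filter_upwards [eventually_ge_atTop 2] with y hy
  rw [he2 y hy]; rfl

/-- The point `1/2 + σ + iu`. -/
noncomputable def line (σ u : ℝ) : ℂ := ⟨1 / 2 + σ, u⟩

@[simp] lemma line_re (σ u : ℝ) : (line σ u).re = 1 / 2 + σ := rfl
@[simp] lemma line_im (σ u : ℝ) : (line σ u).im = u := rfl

lemma line_eq (σ u : ℝ) : line σ u = (1 / 2 + σ : ℝ) + u * Complex.I := by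
  apply Complex.ext <;> simp

/-- The Archimedean factor of `ξ`, normalised by `exp (π u / 4)` at height `u`. -/
noncomputable def gammaWeight (s : ℂ) : ℂ :=
  -Complex.exp (-Complex.I * Real.pi * (s - 1 / 2) / 4) *
    ((s - 1) * (Real.pi : ℂ) ^ (-s / 2) * Complex.Gamma (s / 2 + 1))

lemma norm_gammaWeight (σ u : ℝ) (hσ : 0 ≤ σ) :
    ‖gammaWeight (line σ u)‖ = Real.exp (Real.pi * u / 4) * (‖line σ u - 1‖ *
      (Real.pi ^ (-(1 / 2 + σ) / 2) * (‖line σ u‖ / 2 * ‖Complex.Gamma (line σ u / 2)‖))) := by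
  have h0 : line σ u / 2 ≠ 0 := fun h => by
    have := congrArg Complex.re h
    simp at this; linarith
  rw [gammaWeight, norm_mul, norm_neg, Complex.norm_exp, Complex.Gamma_add_one _ h0, norm_mul,
    norm_mul, Complex.norm_cpow_eq_rpow_re_of_pos Real.pi_pos, norm_mul, norm_div]
  have h1 : (-Complex.I * Real.pi * (line σ u - 1 / 2) / 4).re = Real.pi * u / 4 := by
    simp
  have h2 : (-line σ u / 2).re = -(1 / 2 + σ) / 2 := by
    simp
  rw [h1, h2, Complex.norm_ofNat]
  ring

lemma norm_Gamma_quarter_le : ∃ C : ℝ, 0 < C ∧ ∀ y : ℝ, 0 ≤ y →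
    ‖Complex.Gamma (1 / 4 + y * Complex.I)‖ ≤
      C * Real.exp (-(Real.pi * y / 2)) * (1 + y) ^ (-(1 / 4) : ℝ) := by
  set F : ℝ → ℝ := fun y => Real.exp (Real.pi * y) * Real.sqrt (1 + y) *
    ‖Complex.Gamma (1 / 4 + y * Complex.I)‖ ^ 2 with hF
  have hG : Continuous fun y : ℝ => Complex.Gamma (1 / 4 + y * Complex.I) := by
    refine continuous_iff_continuousAt.2 fun y => ?_
    refine ContinuousAt.comp (f := fun y : ℝ => (1 / 4 : ℂ) + y * Complex.I)
      (Complex.differentiableAt_Gamma _ fun m h => ?_).continuousAt (by fun_prop)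
    have := congrArg Complex.re h
    simp at this
    have hm : (0:ℝ) ≤ m := Nat.cast_nonneg m
    linarith
  have hFc : Continuous F := by fun_prop
  have hlim : Tendsto F atTop (𝓝 (2 * Real.pi * 1)) := by
    have h1 : Tendsto (fun y : ℝ => Real.sqrt (1 + 1 / y)) atTop (𝓝 1) := by
      have : Tendsto (fun y : ℝ => 1 + 1 / y) atTop (𝓝 (1 + 0)) :=
        (tendsto_const_nhds.div_atTop tendsto_id).const_add 1
      simpa using this.sqrt
    refine (norm_Gamma_quarter_tendsto.mul h1).congr' ?_
    filter_upwards [eventually_gt_atTop 0] with y hy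
    have : Real.sqrt (1 + y) = Real.sqrt y * Real.sqrt (1 + 1 / y) := by
      rw [← Real.sqrt_mul hy.le]; congr 1; field_simp; ring
    simp only [hF, this]; ring
  obtain ⟨Y, hY⟩ := (eventually_atTop.1 (hlim.eventually (eventually_le_nhds (b := 7 + 2 * Real.pi) (by linarith))))
  obtain ⟨B, hB⟩ := (isCompact_Icc (a := (0:ℝ)) (b := Y)).bddAbove_image hFc.continuousOn
  set M : ℝ := max 1 (max B (7 + 2 * Real.pi)) with hM
  have hFM : ∀ y : ℝ, 0 ≤ y → F y ≤ M := by
    intro y hy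
    rcases le_total y Y with h | h
    · exact (hB ⟨y, ⟨hy, h⟩, rfl⟩).trans ((le_max_left _ _).trans (le_max_right _ _))
    · exact (hY y h).trans ((le_max_right _ _).trans (le_max_right _ _))
  have hM1 : 1 ≤ M := le_max_left _ _
  refine ⟨M, by linarith, fun y hy => ?_⟩
  have h1 := hFM y hy
  have hy1 : 0 < 1 + y := by linarith
  refine le_of_sq_le_sq ?_ (by positivity)
  have h2 : (M * Real.exp (-(Real.pi * y / 2)) * (1 + y) ^ (-(1 / 4) : ℝ)) ^ 2 =
      M ^ 2 * ((Real.exp (Real.pi * y))⁻¹ * (Real.sqrt (1 + y))⁻¹) := by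
    rw [mul_pow, mul_pow, ← Real.exp_nat_mul, ← Real.rpow_natCast ((1 + y) ^ _), ← Real.rpow_mul hy1.le,
      ← Real.exp_neg, Real.sqrt_eq_rpow, ← Real.rpow_neg hy1.le]
    rw [mul_assoc]; congr 3
    · push_cast; ring
    · norm_num
  rw [h2]
  have he := Real.exp_pos (Real.pi * y)
  have hs := Real.sqrt_pos.2 hy1
  rw [← mul_inv, ← div_eq_mul_inv, le_div_iff₀ (by positivity)]
  calc _ = F y := by simp only [hF]; ring
    _ ≤ M := h1
    _ ≤ M ^ 2 := by nlinarith

lemma norm_line_le (σ u : ℝ) (hσ : 0 ≤ σ) : ‖line σ u‖ ≤ (1 + σ) * (1 + |u|) := by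
  have := Complex.norm_le_abs_re_add_abs_im (line σ u)
  rw [line_re, line_im, abs_of_nonneg (by linarith)] at this
  nlinarith [abs_nonneg u]

lemma norm_line_sub_one_le (σ u : ℝ) (hσ : 0 ≤ σ) : ‖line σ u - 1‖ ≤ (1 + σ) * (1 + |u|) := by
  have := Complex.norm_le_abs_re_add_abs_im (line σ u - 1)
  have h2 : |(line σ u - 1).re| ≤ 1 / 2 + σ := by
    rw [Complex.sub_re, line_re, Complex.one_re]; exact abs_le.2 ⟨by linarith, by linarith⟩
  have h3 : (line σ u - 1).im = u := by simp
  rw [h3] at this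
  nlinarith [abs_nonneg u]

lemma conj_line_half (σ u : ℝ) : (starRingEnd ℂ) (line σ u / 2) = line σ (-u) / 2 := by
  rw [map_div₀, Complex.conj_ofNat]
  exact congrArg (· / 2) (by apply Complex.ext <;> simp)

lemma norm_Gamma_line_neg (σ u : ℝ) :
    ‖Complex.Gamma (line σ (-u) / 2)‖ = ‖Complex.Gamma (line σ u / 2)‖ := by
  rw [← conj_line_half, Complex.Gamma_conj, Complex.norm_conj]

lemma norm_Gamma_line_le : ∃ C : ℝ, 0 < C ∧ ∀ σ ∈ Set.Icc (0:ℝ) 1, ∀ u : ℝ,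
    ‖Complex.Gamma (line σ u / 2)‖ ≤
      C * Real.exp (-(Real.pi * |u| / 4)) * (1 + |u|) ^ (σ / 2 - 1 / 4 : ℝ) := by
  obtain ⟨C, hC, hCb⟩ := norm_Gamma_quarter_le
  have hcont : ContinuousOn (fun x : ℝ × ℝ => ‖Complex.Gamma (line x.1 x.2 / 2)‖)
      (Set.Icc (0:ℝ) 1 ×ˢ Set.Icc (0:ℝ) 4) := by
    intro x hx
    refine ContinuousAt.continuousWithinAt ?_
    have h1 : ContinuousAt Complex.Gamma (line x.1 x.2 / 2) := by
      refine (Complex.differentiableAt_Gamma _ fun m h => ?_).continuousAt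
      have := congrArg Complex.re h
      simp at this
      have hm : (0:ℝ) ≤ m := Nat.cast_nonneg m
      have := hx.1.1
      linarith
    have h2 : Continuous (fun x : ℝ × ℝ => line x.1 x.2 / 2) := by
      simp only [line_eq]; fun_prop
    exact (ContinuousAt.comp (f := fun x : ℝ × ℝ => line x.1 x.2 / 2) h1 h2.continuousAt).norm
  obtain ⟨B, hB⟩ := (isCompact_Icc.prod isCompact_Icc).bddAbove_image hcont
  set D : ℝ := max 1 B * Real.exp (Real.pi) * 5 + C * Real.exp 3 * 4 with hD
  have hB1 : 1 ≤ max 1 B := le_max_left _ _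
  have hDpos : 0 < D := by positivity
  have hpos : ∀ σ ∈ Set.Icc (0:ℝ) 1, ∀ u : ℝ, 0 ≤ u → ‖Complex.Gamma (line σ u / 2)‖ ≤
      D * Real.exp (-(Real.pi * u / 4)) * (1 + u) ^ (σ / 2 - 1 / 4 : ℝ) := by
    intro σ hσ u hu
    have hu1 : 0 < 1 + u := by linarith
    rcases le_total u 4 with h | h
    · have h1 : ‖Complex.Gamma (line σ u / 2)‖ ≤ max 1 B :=
        (hB ⟨(σ, u), ⟨hσ, hu, h⟩, rfl⟩).trans (le_max_right _ _)
      have h2 : Real.exp (-Real.pi) ≤ Real.exp (-(Real.pi * u / 4)) :=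
        Real.exp_le_exp.2 (by nlinarith [Real.pi_pos])
      have h3 : (5:ℝ)⁻¹ ≤ (1 + u) ^ (σ / 2 - 1 / 4 : ℝ) := by
        calc (5:ℝ)⁻¹ ≤ (1 + u)⁻¹ := by
              apply inv_anti₀ hu1; linarith
          _ = (1 + u) ^ (-1 : ℝ) := by rw [Real.rpow_neg_one]
          _ ≤ _ := Real.rpow_le_rpow_of_exponent_le (by linarith) (by linarith [hσ.1])
      have h4 : max 1 B * Real.exp Real.pi * 5 ≤ D := by
        rw [hD]; have := Real.exp_pos 3; nlinarith
      calc _ ≤ max 1 B := h1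
        _ = max 1 B * Real.exp Real.pi * 5 * Real.exp (-Real.pi) * 5⁻¹ := by
            rw [Real.exp_neg]; field_simp
        _ ≤ _ := by gcongr
    · set z : ℂ := 1 / 4 + (u / 2 : ℝ) * Complex.I with hz
      have hzre : z.re = 1 / 4 := by simp [hz]
      have hzim : z.im = u / 2 := by simp [hz]
      have hz0 : z ≠ 0 := fun h => by rw [h] at hzre; norm_num at hzre
      have hn : ‖((σ / 2 : ℝ) : ℂ)‖ = σ / 2 := by
        rw [Complex.norm_real, Real.norm_of_nonneg (by linarith [hσ.1])]
      obtain ⟨E, hE, hG⟩ := exists_Gamma_add_eq (z := z) (b := (σ / 2 : ℝ)) (by rw [hzre]; norm_num)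
        (by rw [Complex.add_re, hzre, Complex.ofReal_re]; linarith [hσ.1])
        (by rw [hzim]; linarith) (by rw [hzim, hn]; linarith [hσ.2])
      have hzl : z + (σ / 2 : ℝ) = line σ u / 2 := by
        apply Complex.ext
        · simp [hzre]; ring
        · simp [hzim]
      rw [← hzl, hG, norm_mul, norm_mul, Complex.norm_exp, Complex.norm_exp, Complex.re_ofReal_mul,
        Complex.log_re, mul_comm (σ / 2), ← Real.rpow_def_of_pos (norm_pos_iff.2 hz0)]
      have hE3 : Real.exp E.re ≤ Real.exp 3 := by
        apply Real.exp_le_exp.2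
        refine (Complex.re_le_norm E).trans (hE.trans ?_)
        rw [hn, hzim, div_le_iff₀ (by linarith)]
        nlinarith [hσ.1, hσ.2]
      have hzn : ‖z‖ ≤ 1 + u := by
        refine (Complex.norm_le_abs_re_add_abs_im z).trans ?_
        rw [hzre, hzim, abs_of_nonneg (by norm_num), abs_of_nonneg (by linarith)]; linarith
      have h1 := hCb (u / 2) (by linarith)
      have h2 : (1 + u / 2) ^ (-(1 / 4) : ℝ) ≤ 4 * (1 + u) ^ (-(1 / 4) : ℝ) := by
        have : (1 + u) / 2 ≤ 1 + u / 2 := by linarith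
        calc (1 + u / 2) ^ (-(1 / 4) : ℝ) ≤ ((1 + u) / 2) ^ (-(1 / 4) : ℝ) :=
              Real.rpow_le_rpow_of_nonpos (by linarith) this (by norm_num)
          _ = 2 ^ (1 / 4 : ℝ) * (1 + u) ^ (-(1 / 4) : ℝ) := by
              rw [Real.div_rpow hu1.le (by norm_num), Real.rpow_neg (by norm_num : (0:ℝ) ≤ 2)]
              field_simp
          _ ≤ 2 ^ (2 : ℝ) * (1 + u) ^ (-(1 / 4) : ℝ) := by
              gcongr
              · norm_num
              · norm_num
          _ = _ := by norm_num
      have h3 : ‖z‖ ^ (σ / 2) ≤ (1 + u) ^ (σ / 2) :=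
        Real.rpow_le_rpow (norm_nonneg _) hzn (by linarith [hσ.1])
      have h4 : C * Real.exp 3 * 4 ≤ D := by
        rw [hD]; have := Real.exp_pos Real.pi; nlinarith
      have h5 : (1 + u) ^ (σ / 2 - 1 / 4 : ℝ) = (1 + u) ^ (-(1 / 4) : ℝ) * (1 + u) ^ (σ / 2) := by
        rw [← Real.rpow_add hu1]; congr 1; ring
      rw [h5]
      have h6 : Real.pi * (u / 2) / 2 = Real.pi * u / 4 := by ring
      rw [h6] at h1
      calc _ ≤ C * Real.exp (-(Real.pi * u / 4)) * (4 * (1 + u) ^ (-(1 / 4) : ℝ)) *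
            (1 + u) ^ (σ / 2) * Real.exp 3 := by
            gcongr
            exact h1.trans (by gcongr)
        _ = (C * Real.exp 3 * 4) * Real.exp (-(Real.pi * u / 4)) *
            ((1 + u) ^ (-(1 / 4) : ℝ) * (1 + u) ^ (σ / 2)) := by ring
        _ ≤ _ := by gcongr
  refine ⟨D, hDpos, fun σ hσ u => ?_⟩
  rcases le_total 0 u with h | h
  · rw [abs_of_nonneg h]; exact hpos σ hσ u h
  · rw [abs_of_nonpos h, ← norm_Gamma_line_neg]; exact hpos σ hσ (-u) (by linarith)

lemma norm_gammaWeight_le : ∃ C : ℝ, 0 < C ∧ ∀ σ ∈ Set.Icc (0:ℝ) 1, ∀ u : ℝ,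
    ‖gammaWeight (line σ u)‖ ≤ C * (1 + |u|) ^ (7 / 4 + σ / 2 : ℝ) := by
  obtain ⟨C, hC, hCb⟩ := norm_Gamma_line_le
  refine ⟨2 * C, by positivity, fun σ hσ u => ?_⟩
  have hu1 : 0 < 1 + |u| := by positivity
  rw [norm_gammaWeight σ u hσ.1]
  have h1 := norm_line_le σ u hσ.1
  have h2 := norm_line_sub_one_le σ u hσ.1
  have h3 := hCb σ hσ u
  have hp : Real.pi ^ (-(1 / 2 + σ) / 2) ≤ 1 :=
    Real.rpow_le_one_of_one_le_of_nonpos (by linarith [Real.pi_gt_three]) (by linarith [hσ.1])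
  have hσ2 : (1 + σ) * (1 + |u|) ≤ 2 * (1 + |u|) := by
    have := hσ.2; gcongr; linarith
  have he : Real.exp (Real.pi * u / 4) * Real.exp (-(Real.pi * |u| / 4)) ≤ 1 := by
    rw [← Real.exp_add]; apply Real.exp_le_one_iff.2
    nlinarith [le_abs_self u, Real.pi_pos]
  have h5 : (1 + |u|) ^ (7 / 4 + σ / 2 : ℝ) = (1 + |u|) * (1 + |u|) * (1 + |u|) ^ (σ / 2 - 1 / 4 : ℝ) := by
    rw [show (7 / 4 + σ / 2 : ℝ) = 1 + 1 + (σ / 2 - 1 / 4) by ring, Real.rpow_add hu1,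
      Real.rpow_add hu1, Real.rpow_one]
  rw [h5]
  calc _ ≤ Real.exp (Real.pi * u / 4) * ((2 * (1 + |u|)) * (1 * ((2 * (1 + |u|)) / 2 *
        (C * Real.exp (-(Real.pi * |u| / 4)) * (1 + |u|) ^ (σ / 2 - 1 / 4 : ℝ))))) := by
        gcongr
        · exact h2.trans hσ2
        · exact h1.trans hσ2
    _ = (Real.exp (Real.pi * u / 4) * Real.exp (-(Real.pi * |u| / 4))) * (2 * C *
        ((1 + |u|) * (1 + |u|) * (1 + |u|) ^ (σ / 2 - 1 / 4 : ℝ))) := by ring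
    _ ≤ 1 * (2 * C *
        ((1 + |u|) * (1 + |u|) * (1 + |u|) ^ (σ / 2 - 1 / 4 : ℝ))) := by gcongr
    _ = _ := by ring

lemma norm_Gamma_line_even_le (k : ℕ) : ∃ C : ℝ, 0 < C ∧ ∀ u : ℝ,
    ‖Complex.Gamma (line (2 * k) u / 2)‖ ≤ C * Real.exp (-(Real.pi * |u| / 4)) * (1 + |u|) ^ k := by
  induction k with
  | zero =>
    obtain ⟨C, hC, hCb⟩ := norm_Gamma_line_le
    refine ⟨C, hC, fun u => (by simpa using hCb 0 ⟨le_rfl, zero_le_one⟩ u : _ ≤ _).trans ?_⟩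
    gcongr
    simp only [pow_zero]
    exact Real.rpow_le_one_of_one_le_of_nonpos (by linarith [abs_nonneg u]) (by norm_num)
  | succ k ih =>
    obtain ⟨C, hC, hCb⟩ := ih
    refine ⟨C * (1 + 2 * k), by positivity, fun u => ?_⟩
    have h0 : line (2 * k) u / 2 ≠ 0 := fun h => by
      have := congrArg Complex.re h
      have hk : (0:ℝ) ≤ k := Nat.cast_nonneg k
      simp at this; linarith
    have h1 : line (2 * (k + 1 : ℕ)) u / 2 = line (2 * k) u / 2 + 1 := by
      apply Complex.ext
      · simp; ring
      · simp
    rw [h1, Complex.Gamma_add_one _ h0, norm_mul, norm_div, Complex.norm_ofNat]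
    have h2 := norm_line_le (2 * k) u (by positivity)
    have h3 := hCb u
    calc _ ≤ ((1 + 2 * k) * (1 + |u|)) * (C * Real.exp (-(Real.pi * |u| / 4)) * (1 + |u|) ^ k) := by
          gcongr
          exact (half_le_self (norm_nonneg _)).trans h2
      _ = _ := by ring

lemma norm_gammaWeight_even_le (k : ℕ) : ∃ C : ℝ, 0 < C ∧ ∀ u : ℝ,
    ‖gammaWeight (line (2 * k) u)‖ ≤ C * (1 + |u|) ^ (k + 2) := by
  obtain ⟨C, hC, hCb⟩ := norm_Gamma_line_even_le k
  refine ⟨(1 + 2 * k) ^ 2 * C, by positivity, fun u => ?_⟩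
  have hk : (0:ℝ) ≤ 2 * k := by positivity
  rw [norm_gammaWeight _ u hk]
  have h1 := norm_line_le _ u hk
  have h2 := norm_line_sub_one_le _ u hk
  have hp : Real.pi ^ (-(1 / 2 + 2 * k : ℝ) / 2) ≤ 1 :=
    Real.rpow_le_one_of_one_le_of_nonpos (by linarith [Real.pi_gt_three]) (by linarith)
  have he : Real.exp (Real.pi * u / 4) * Real.exp (-(Real.pi * |u| / 4)) ≤ 1 := by
    rw [← Real.exp_add]; apply Real.exp_le_one_iff.2
    nlinarith [le_abs_self u, Real.pi_pos]
  calc _ ≤ Real.exp (Real.pi * u / 4) * (((1 + 2 * k) * (1 + |u|)) * (1 * (((1 + 2 * k) * (1 + |u|)) *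
        (C * Real.exp (-(Real.pi * |u| / 4)) * (1 + |u|) ^ k)))) := by
        gcongr
        · exact (half_le_self (norm_nonneg _)).trans h1
        · exact hCb u
    _ = (Real.exp (Real.pi * u / 4) * Real.exp (-(Real.pi * |u| / 4))) *
        ((1 + 2 * k) ^ 2 * C * (1 + |u|) ^ (k + 2)) := by ring
    _ ≤ 1 * ((1 + 2 * k) ^ 2 * C * (1 + |u|) ^ (k + 2)) := by gcongr
    _ = _ := one_mul _

/-- The power weight in the Hardy–Littlewood function. -/
noncomputable def powWeight (t : ℝ) : ℝ := t ^ (1 / 4 : ℝ) / (1 / 4 + t ^ 2)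

/-- Half the logarithm of `t / 2π`, the local frequency of the Archimedean factor. -/
noncomputable def freq (t : ℝ) : ℝ := Real.log (t / (2 * Real.pi)) / 2

lemma powWeight_pos {t : ℝ} (ht : 0 < t) : 0 < powWeight t := by
  unfold powWeight; positivity

lemma powWeight_nonneg {t : ℝ} (ht : 0 ≤ t) : 0 ≤ powWeight t := by
  unfold powWeight; positivity

lemma line_mul_sub_one (u : ℝ) : (line 0 u - 1) * line 0 u = -((1 / 4 + u ^ 2 : ℝ) : ℂ) := by
  rw [line_eq]
  push_cast
  linear_combination (u : ℂ) ^ 2 * Complex.I_sq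

lemma norm_line_zero_mul (u : ℝ) : ‖line 0 u - 1‖ * ‖line 0 u‖ = 1 / 4 + u ^ 2 := by
  rw [← norm_mul, line_mul_sub_one, norm_neg, Complex.norm_real, Real.norm_of_nonneg (by positivity)]

lemma powWeight_mul_norm_gammaWeight_tendsto :
    Tendsto (fun t => (powWeight t * ‖gammaWeight (line 0 t)‖) ^ 2) atTop
      (𝓝 (Real.sqrt (Real.pi / 2))) := by
  have h2 : Tendsto (fun t : ℝ => t / 2) atTop atTop := tendsto_id.atTop_div_const (by norm_num)
  have h := (norm_Gamma_quarter_tendsto.comp h2).const_mul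
    (Real.pi ^ (-(1 / 2) : ℝ) * Real.sqrt 2 / 4)
  have hc : Real.pi ^ (-(1 / 2) : ℝ) * Real.sqrt 2 / 4 * (2 * Real.pi) = Real.sqrt (Real.pi / 2) := by
    rw [Real.rpow_neg Real.pi_pos.le, ← Real.sqrt_eq_rpow, Real.sqrt_div Real.pi_pos.le]
    have h3 := Real.sqrt_pos.2 Real.pi_pos
    have h4 : (0:ℝ) < Real.sqrt 2 := by positivity
    have h5 := Real.mul_self_sqrt Real.pi_pos.le
    have h6 := Real.mul_self_sqrt (show (0:ℝ) ≤ 2 by norm_num)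
    field_simp
    nlinarith
  rw [hc] at h
  refine h.congr' ?_
  filter_upwards [eventually_gt_atTop 0] with t ht
  have hl : line 0 t / 2 = 1 / 4 + ((t / 2 : ℝ) : ℂ) * Complex.I := by
    rw [line_eq]; push_cast; ring
  have he : Real.exp (Real.pi * (t / 2)) = Real.exp (Real.pi * t / 4) ^ 2 := by
    rw [← Real.exp_nat_mul]; congr 1; push_cast; ring
  have hs : Real.sqrt 2 * Real.sqrt (t / 2) = (t ^ (1 / 4 : ℝ)) ^ 2 := by
    rw [← Real.sqrt_mul (by norm_num), ← Real.rpow_natCast, ← Real.rpow_mul ht.le, Real.sqrt_eq_rpow]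
    congr 1
    · ring
    · norm_num
  have hp : Real.pi ^ (-(1 / 2) : ℝ) = (Real.pi ^ (-(1 / 2 + 0) / 2 : ℝ)) ^ 2 := by
    rw [← Real.rpow_natCast, ← Real.rpow_mul Real.pi_pos.le]; congr 1; norm_num
  simp only [Function.comp]
  rw [norm_gammaWeight 0 t le_rfl, ← hl, powWeight, he, hp]
  have hpos : (0:ℝ) < 1 / 4 + t ^ 2 := by positivity
  have hw : t ^ (1 / 4 : ℝ) / (1 / 4 + t ^ 2) * (Real.exp (Real.pi * t / 4) * (‖line 0 t - 1‖ *
      (Real.pi ^ (-(1 / 2 + 0) / 2 : ℝ) * (‖line 0 t‖ / 2 * ‖Complex.Gamma (line 0 t / 2)‖)))) =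
      t ^ (1 / 4 : ℝ) * Real.exp (Real.pi * t / 4) * Real.pi ^ (-(1 / 2 + 0) / 2 : ℝ) *
        ‖Complex.Gamma (line 0 t / 2)‖ / 2 := by
    have := norm_line_zero_mul t
    field_simp
    linear_combination 4 * ‖Complex.Gamma (line 0 t / 2)‖ * this
  rw [hw]
  linear_combination (Real.pi ^ (-(1 / 2 + 0) / 2 : ℝ)) ^ 2 / 4 * Real.exp (Real.pi * t / 4) ^ 2 *
    ‖Complex.Gamma (line 0 t / 2)‖ ^ 2 * hs

lemma powWeight_mul_norm_gammaWeight_le : ∃ C : ℝ, 0 < C ∧ ∀ t : ℝ, 1 ≤ t → ∀ σ ∈ Set.Icc (0:ℝ) 1,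
    ∀ v : ℝ, powWeight t * ‖gammaWeight (line σ (t + v))‖ ≤ C * t ^ (σ / 2) * (1 + |v| / t) ^ 3 := by
  obtain ⟨C, hC, hCb⟩ := norm_gammaWeight_le
  refine ⟨C * 8, by positivity, fun t ht σ hσ v => ?_⟩
  have ht0 : 0 < t := by linarith
  set y := 1 + |v| / t with hy
  have hy1 : 1 ≤ y := by have : 0 ≤ |v| / t := by positivity
                         linarith
  have h1 : 1 + |t + v| ≤ 2 * t * y := by
    have : 2 * t * y = 2 * t + 2 * |v| := by rw [hy]; field_simp
    rw [this]
    have := abs_add_le t v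
    rw [abs_of_pos ht0] at this
    linarith [abs_nonneg v]
  have hp0 : 0 ≤ 7 / 4 + σ / 2 := by linarith [hσ.1]
  have h2 : (1 + |t + v|) ^ (7 / 4 + σ / 2 : ℝ) ≤ 8 * t ^ (7 / 4 + σ / 2 : ℝ) * y ^ 3 := by
    calc _ ≤ (2 * t * y) ^ (7 / 4 + σ / 2 : ℝ) := Real.rpow_le_rpow (by positivity) h1 hp0
      _ = 2 ^ (7 / 4 + σ / 2 : ℝ) * t ^ (7 / 4 + σ / 2 : ℝ) * y ^ (7 / 4 + σ / 2 : ℝ) := by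
          rw [Real.mul_rpow (by positivity) (by linarith), Real.mul_rpow (by norm_num) ht0.le]
      _ ≤ 2 ^ (3 : ℝ) * t ^ (7 / 4 + σ / 2 : ℝ) * y ^ (3 : ℝ) := by
          have : 7 / 4 + σ / 2 ≤ 3 := by linarith [hσ.2]
          gcongr
          norm_num
      _ = _ := by norm_num
  have h3 : powWeight t ≤ t ^ (-(7 / 4) : ℝ) := by
    have : t ^ (-(7 / 4) : ℝ) = t ^ (1 / 4 : ℝ) / t ^ 2 := by
      rw [← Real.rpow_natCast t 2, ← Real.rpow_sub ht0]; norm_num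
    rw [this, powWeight]
    gcongr; linarith
  calc _ ≤ t ^ (-(7 / 4) : ℝ) * (C * (8 * t ^ (7 / 4 + σ / 2 : ℝ) * y ^ 3)) := by
        gcongr
        exact (hCb σ hσ _).trans (by gcongr)
    _ = C * 8 * (t ^ (-(7 / 4) : ℝ) * t ^ (7 / 4 + σ / 2 : ℝ)) * y ^ 3 := by ring
    _ = _ := by rw [← Real.rpow_add ht0]; congr 3; ring

lemma gammaWeight_line_zero (u : ℝ) : gammaWeight (line 0 u) = ((1 / 4 + u ^ 2 : ℝ) : ℂ) / 2 *
    Complex.exp (Real.pi * u / 4 - Real.log Real.pi * (1 / 4 + u / 2 * Complex.I)) *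
      Complex.Gamma (line 0 u / 2) := by
  have h0 : line 0 u / 2 ≠ 0 := fun h => by
    have := congrArg Complex.re h
    simp at this
  rw [gammaWeight, Complex.Gamma_add_one _ h0,
    Complex.cpow_def_of_ne_zero (by exact_mod_cast Real.pi_ne_zero), ← Complex.ofReal_log Real.pi_pos.le]
  have h1 : -Complex.I * Real.pi * (line 0 u - 1 / 2) / 4 = Real.pi * u / 4 := by
    rw [line_eq]; push_cast; linear_combination -(Real.pi * u / 4 : ℂ) * Complex.I_sq
  have h2 : (Real.log Real.pi : ℂ) * (-line 0 u / 2) =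
      -(Real.log Real.pi * (1 / 4 + u / 2 * Complex.I)) := by
    rw [line_eq]; push_cast; ring
  rw [h1, h2, sub_eq_add_neg (Real.pi * u / 4 : ℂ), Complex.exp_add]
  linear_combination (-Complex.exp (Real.pi * u / 4) *
    Complex.exp (-(Real.log Real.pi * (1 / 4 + u / 2 * Complex.I))) *
      Complex.Gamma (line 0 u / 2) / 2) * line_mul_sub_one u

/-- Local behaviour of the Archimedean factor: a pure oscillation of frequency `freq t`. -/
lemma exists_gammaWeight_add_eq {t v : ℝ} (ht : 4 ≤ t) (hv : |v| ≤ t / 2) :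
    ∃ E : ℂ, ‖E‖ ≤ 10 * (1 + |v|) ^ 2 / t ∧ gammaWeight (line 0 (t + v)) =
      gammaWeight (line 0 t) * Complex.exp (Complex.I * v * freq t) *
        (((1 / 4 + (t + v) ^ 2) / (1 / 4 + t ^ 2) : ℝ) * Complex.exp E) := by
  have ht0 : 0 < t := by linarith
  have htc : (t : ℂ) ≠ 0 := by exact_mod_cast ht0.ne'
  set z : ℂ := line 0 t / 2 with hz
  set b : ℂ := (v / 2 : ℝ) * Complex.I with hb
  have hbn : ‖b‖ = |v| / 2 := by
    rw [hb, norm_mul, Complex.norm_I, mul_one, Complex.norm_real, Real.norm_eq_abs, abs_div]; norm_num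
  have hzre : z.re = 1 / 4 := by simp [hz]; norm_num
  have hzim : z.im = t / 2 := by simp [hz]
  have hbre : b.re = 0 := by simp [hb]
  have hzb : z + b = line 0 (t + v) / 2 := by
    rw [hz, hb, line_eq, line_eq]; push_cast; ring
  obtain ⟨E, hE, hG⟩ := exists_Gamma_add_eq (z := z) (b := b) (by rw [hzre]; norm_num)
    (by rw [Complex.add_re, hzre, hbre]; norm_num) (by rw [hzim]; linarith)
    (by rw [hbn, hzim]; linarith)
  set q : ℂ := -Complex.I / (2 * t) with hq
  have hqn : ‖q‖ = 1 / (2 * t) := by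
    rw [hq, norm_div, norm_neg, Complex.norm_I, norm_mul, Complex.norm_real, Real.norm_of_nonneg ht0.le]
    norm_num
  have hq8 : ‖q‖ ≤ 1 / 8 := by
    rw [hqn]; apply one_div_le_one_div_of_le <;> linarith
  set d : ℂ := Complex.log (1 + q) with hd
  have hdn : ‖d‖ ≤ 3 / 2 * ‖q‖ := Complex.norm_log_one_add_half_le_self (by linarith)
  have hlogz : Complex.log z = Real.log (t / 2) + Real.pi / 2 * Complex.I + d := by
    have h1q : 1 + q ≠ 0 := fun h => by
      have : q = -1 := by linear_combination h
      rw [this] at hq8; norm_num at hq8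
    have hexp : Complex.exp (Real.log (t / 2) + Real.pi / 2 * Complex.I + d) = z := by
      rw [Complex.exp_add, Complex.exp_add, hd, Complex.exp_log h1q, Complex.exp_pi_div_two_mul_I,
        ← Complex.ofReal_exp, Real.exp_log (by positivity), hq, hz, line_eq]
      push_cast
      field_simp
      linear_combination (-1 : ℂ) * Complex.I_sq
    rw [← hexp, Complex.log_exp]
    · have := (abs_le.1 ((Complex.abs_im_le_norm d).trans hdn)).1
      simp
      linarith [Real.pi_gt_three]
    · have := (abs_le.1 ((Complex.abs_im_le_norm d).trans hdn)).2
      simp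
      linarith [Real.pi_gt_three]
  refine ⟨E + b * d, ?_, ?_⟩
  · refine (norm_add_le _ _).trans ?_
    rw [norm_mul, hbn]
    rw [hbn, hzim] at hE
    have h1 : 8 * (|v| / 2) * (1 + |v| / 2) / (t / 2) = (8 * |v| + 4 * |v| ^ 2) / t := by
      field_simp; ring
    rw [h1] at hE
    rw [hqn] at hdn
    have h2 : |v| / 2 * ‖d‖ ≤ |v| / t := by
      calc |v| / 2 * ‖d‖ ≤ |v| / 2 * (3 / 2 * (1 / (2 * t))) := by gcongr
        _ = (3 / 8) * (|v| / t) := by field_simp; ring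
        _ ≤ _ := by
          have : 0 ≤ |v| / t := by positivity
          linarith
    calc _ ≤ (8 * |v| + 4 * |v| ^ 2) / t + |v| / t := add_le_add hE h2
      _ = (9 * |v| + 4 * |v| ^ 2) / t := by ring
      _ ≤ _ := by
        gcongr
        nlinarith [abs_nonneg v]
  · have hne : ((1 / 4 + t ^ 2 : ℝ) : ℂ) ≠ 0 := by
      have : (0:ℝ) < 1 / 4 + t ^ 2 := by positivity
      exact_mod_cast this.ne'
    rw [gammaWeight_line_zero, gammaWeight_line_zero, ← hzb, ← hz, hG, hlogz, Complex.ofReal_div]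
    have hfr : freq t = (Real.log (t / 2) - Real.log Real.pi) / 2 := by
      rw [freq, ← Real.log_div (by positivity) Real.pi_ne_zero]; congr 2; field_simp
    have hex : Complex.exp (Real.pi * (t + v : ℝ) / 4 - Real.log Real.pi *
          (1 / 4 + (t + v : ℝ) / 2 * Complex.I)) *
        (Complex.exp (b * (Real.log (t / 2) + Real.pi / 2 * Complex.I + d)) * Complex.exp E) =
        Complex.exp (Real.pi * t / 4 - Real.log Real.pi * (1 / 4 + t / 2 * Complex.I)) *
          (Complex.exp (Complex.I * v * freq t) * Complex.exp (E + b * d)) := by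
      simp only [← Complex.exp_add]
      congr 1
      rw [hfr, hb]
      push_cast
      linear_combination (Real.pi * v / 4 : ℂ) * Complex.I_sq
    generalize ((1 / 4 + t ^ 2 : ℝ) : ℂ) = A at hne ⊢
    have hA : A * A⁻¹ = 1 := mul_inv_cancel₀ hne
    rw [div_eq_mul_inv _ A]
    linear_combination ((1 / 4 + (t + v) ^ 2 : ℝ) : ℂ) / 2 * Complex.Gamma z * hex -
      ((1 / 4 + (t + v) ^ 2 : ℝ) : ℂ) / 2 * Complex.Gamma z *
        Complex.exp (Real.pi * t / 4 - Real.log Real.pi * (1 / 4 + t / 2 * Complex.I)) *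
        Complex.exp (Complex.I * v * freq t) * Complex.exp (E + b * d) * hA

lemma gammaWeight_approx : ∃ C : ℝ, 0 < C ∧ ∀ t : ℝ, 4 ≤ t → ∀ v : ℝ,
    powWeight t * ‖gammaWeight (line 0 (t + v)) -
      gammaWeight (line 0 t) * Complex.exp (Complex.I * v * freq t)‖ ≤ C * (1 + |v|) ^ 6 / t := by
  obtain ⟨C, hC, hCb⟩ := powWeight_mul_norm_gammaWeight_le
  refine ⟨C * (10 * Real.exp 40 * 4 + 3), by positivity, fun t ht v => ?_⟩
  have ht0 : 0 < t := by linarith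
  have hr := (powWeight_pos ht0).le
  have hosc : ‖Complex.exp (Complex.I * v * freq t)‖ = 1 := by
    rw [Complex.norm_exp]; simp
  have h0 : powWeight t * ‖gammaWeight (line 0 t)‖ ≤ C := by
    simpa using hCb t (by linarith) 0 ⟨le_rfl, zero_le_one⟩ 0
  set y := 1 + |v| with hy
  have hy1 : 1 ≤ y := by have := abs_nonneg v; linarith
  rcases le_total (y ^ 2) (2 * t) with h | h
  · have hv : |v| ≤ t / 2 := by
      by_contra! hcon
      nlinarith [abs_nonneg v]
    obtain ⟨E, hE, hG⟩ := exists_gammaWeight_add_eq ht hv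
    set Q : ℝ := (1 / 4 + (t + v) ^ 2) / (1 / 4 + t ^ 2) with hQ
    have hQ1 : |Q - 1| ≤ 3 * y ^ 2 / t := by
      have hpos : (0:ℝ) < 1 / 4 + t ^ 2 := by positivity
      have : Q - 1 = v * (2 * t + v) / (1 / 4 + t ^ 2) := by rw [hQ]; field_simp; ring
      rw [this, abs_div, abs_of_pos hpos, abs_mul, div_le_div_iff₀ hpos ht0]
      have h2 : |2 * t + v| ≤ 3 * t := by
        refine (abs_add_le _ _).trans ?_
        rw [abs_of_pos (by linarith)]; linarith
      calc |v| * |2 * t + v| * t ≤ y ^ 2 * (3 * t) * t := by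
            gcongr; nlinarith [abs_nonneg v]
        _ ≤ _ := by nlinarith [sq_nonneg y]
    have hE40 : ‖E‖ ≤ 20 := hE.trans (by rw [div_le_iff₀ ht0]; nlinarith)
    have hexp : ‖Complex.exp E - 1‖ ≤ ‖E‖ * Real.exp 20 := by
      have := Complex.norm_exp_sub_sum_le_norm_mul_exp E 1
      simp at this
      exact this.trans (by gcongr)
    have hEn : ‖Complex.exp E‖ ≤ Real.exp 20 := by
      rw [Complex.norm_exp]; exact Real.exp_le_exp.2 ((Complex.re_le_norm E).trans hE40)
    have hdiff : ‖(Q : ℂ) * Complex.exp E - 1‖ ≤ 10 * Real.exp 40 * 4 * (y ^ 2 / t) := by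
      have e1 : (Q : ℂ) * Complex.exp E - 1 = ((Q - 1 : ℝ) : ℂ) * Complex.exp E + (Complex.exp E - 1) := by
        push_cast; ring
      rw [e1]
      refine (norm_add_le _ _).trans ?_
      rw [norm_mul, Complex.norm_real, Real.norm_eq_abs]
      have h20 : Real.exp 20 ≤ Real.exp 40 := Real.exp_le_exp.2 (by norm_num)
      calc _ ≤ 3 * y ^ 2 / t * Real.exp 40 + 10 * y ^ 2 / t * Real.exp 40 := by
            gcongr
            · exact hEn.trans h20
            · exact hexp.trans (by gcongr)
        _ = 13 * (Real.exp 40 * (y ^ 2 / t)) := by ring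
        _ ≤ 40 * (Real.exp 40 * (y ^ 2 / t)) := by gcongr; norm_num
        _ = _ := by ring
    have e2 : gammaWeight (line 0 (t + v)) - gammaWeight (line 0 t) * Complex.exp (Complex.I * v * freq t)
        = gammaWeight (line 0 t) * Complex.exp (Complex.I * v * freq t) * ((Q : ℂ) * Complex.exp E - 1) := by
      rw [hG]; ring
    rw [e2, norm_mul, norm_mul, hosc, mul_one, ← mul_assoc]
    calc _ ≤ C * (10 * Real.exp 40 * 4 * (y ^ 2 / t)) := by gcongr
      _ ≤ C * (10 * Real.exp 40 * 4 * (y ^ 6 / t)) := by gcongr; norm_num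
      _ = C * (10 * Real.exp 40 * 4) * y ^ 6 / t := by ring
      _ ≤ _ := by gcongr; linarith
  · have h1 := hCb t (by linarith) 0 ⟨le_rfl, zero_le_one⟩ v
    simp only [zero_div, Real.rpow_zero, mul_one] at h1
    have h2 : 1 + |v| / t ≤ y := by
      rw [hy]; gcongr
      exact div_le_self (abs_nonneg v) (by linarith)
    have hyt : 1 ≤ y ^ 2 / t := by rw [le_div_iff₀ ht0]; linarith
    calc _ ≤ powWeight t * (‖gammaWeight (line 0 (t + v))‖ + ‖gammaWeight (line 0 t)‖) := by
          gcongr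
          refine (norm_sub_le _ _).trans ?_
          rw [norm_mul, hosc, mul_one]
      _ = powWeight t * ‖gammaWeight (line 0 (t + v))‖ + powWeight t * ‖gammaWeight (line 0 t)‖ := by ring
      _ ≤ C * y ^ 4 + C * y ^ 4 := by
          refine add_le_add ?_ ?_
          · calc _ ≤ C * (1 + |v| / t) ^ 3 := h1
              _ ≤ C * y ^ 3 := by gcongr
              _ ≤ C * y ^ 4 := by gcongr; norm_num
          · exact h0.trans (le_mul_of_one_le_right hC.le (one_le_pow₀ hy1))
      _ ≤ 3 * C * y ^ 4 * 1 := by nlinarith [show 0 ≤ C * y ^ 4 by positivity]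
      _ ≤ 3 * C * y ^ 4 * (y ^ 2 / t) := by gcongr
      _ = C * 3 * y ^ 6 / t := by ring
      _ ≤ _ := by gcongr; linarith [Real.exp_pos 40]

open MeasureTheory

/-- Shifting a vertical line of integration across a strip of holomorphy. -/
lemma integral_line_eq_of_differentiableOn {f : ℂ → ℂ} {a b C : ℝ} (hab : a ≤ b)
    (hf : DifferentiableOn ℂ f {z | z.re ∈ Set.Icc a b})
    (hC : ∀ x ∈ Set.Icc a b, ∀ y : ℝ, ‖f (x + y * Complex.I)‖ ≤ C / (1 + y ^ 2)) :
    ∫ y : ℝ, f (a + y * Complex.I) = ∫ y : ℝ, f (b + y * Complex.I) := by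
  have hcont : ∀ x ∈ Set.Icc a b, Continuous fun y : ℝ => f (x + y * Complex.I) := fun x hx =>
    hf.continuousOn.comp_continuous (by fun_prop) (fun y => by simpa using hx)
  have hintgr : ∀ x ∈ Set.Icc a b, Integrable fun y : ℝ => f (x + y * Complex.I) := fun x hx =>
    (integrable_inv_one_add_sq.const_mul C).mono' (hcont x hx).aestronglyMeasurable
      (ae_of_all _ fun y => (hC x hx y).trans_eq (div_eq_mul_inv _ _))
  have haI : a ∈ Set.Icc a b := ⟨le_rfl, hab⟩
  have hbI : b ∈ Set.Icc a b := ⟨hab, le_rfl⟩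
  have hlim : ∀ x ∈ Set.Icc a b, Tendsto (fun R : ℝ => ∫ y in -R..R, f (x + y * Complex.I)) atTop
      (𝓝 (∫ y : ℝ, f (x + y * Complex.I))) := fun x hx =>
    intervalIntegral_tendsto_integral (hintgr x hx) tendsto_neg_atTop_atBot tendsto_id
  have hhor : ∀ ε : ℝ, |ε| = 1 →
      Tendsto (fun R : ℝ => ∫ x in a..b, f (x + ((ε * R : ℝ) : ℂ) * Complex.I)) atTop (𝓝 0) := by
    intro ε hε
    have hε2 : ε ^ 2 = 1 := by rw [← sq_abs, hε]; norm_num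
    refine squeeze_zero_norm (a := fun R : ℝ => C / (1 + R ^ 2) * |b - a|) (fun R => ?_) ?_
    · refine intervalIntegral.norm_integral_le_of_norm_le_const fun x hx => ?_
      rw [Set.uIoc_of_le hab] at hx
      refine (hC x ⟨hx.1.le, hx.2⟩ _).trans_eq ?_
      rw [mul_pow, hε2, one_mul]
    · have : Tendsto (fun R : ℝ => C / (1 + R ^ 2)) atTop (𝓝 0) :=
        tendsto_const_nhds.div_atTop (tendsto_atTop_add_const_left _ _ (tendsto_pow_atTop two_ne_zero))
      simpa using this.mul_const |b - a|
  have hrect : ∀ R : ℝ, (∫ x in a..b, f (x + ((-1 * R : ℝ) : ℂ) * Complex.I)) -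
      (∫ x in a..b, f (x + ((1 * R : ℝ) : ℂ) * Complex.I)) +
      Complex.I • (∫ y in -R..R, f (b + y * Complex.I)) -
      Complex.I • (∫ y in -R..R, f (a + y * Complex.I)) = 0 := by
    intro R
    have := Complex.integral_boundary_rect_eq_zero_of_differentiableOn f ⟨a, -R⟩ ⟨b, R⟩ (hf.mono ?_)
    · simpa using this
    · intro z hz
      have := hz.1
      simp only [Set.mem_preimage, Set.uIcc_of_le hab] at this
      exact this
  have := (((hhor (-1) (by norm_num)).sub (hhor 1 (by norm_num))).add
    ((hlim b hbI).const_smul Complex.I)).sub ((hlim a haI).const_smul Complex.I)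
  simp only [hrect] at this
  have h0 := tendsto_nhds_unique this tendsto_const_nhds
  have h1 : Complex.I * ((∫ y : ℝ, f (b + y * Complex.I)) - ∫ y : ℝ, f (a + y * Complex.I)) = 0 := by
    simpa [mul_sub] using h0
  rcases mul_eq_zero.1 h1 with h | h
  · exact absurd h Complex.I_ne_zero
  · exact (sub_eq_zero.1 h).symm

/-- The entire Riemann `ξ` function. -/
noncomputable def xi (s : ℂ) : ℂ := (s * (s - 1) * completedRiemannZeta₀ s + 1) / 2

lemma differentiable_xi : Differentiable ℂ xi := by
  unfold xi
  have := differentiable_completedZeta₀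
  fun_prop

lemma xi_eq_mul_riemannZeta {s : ℂ} (hs : 0 < s.re) (hs1 : s ≠ 1) :
    xi s = s * (s - 1) / 2 * (Real.pi : ℂ) ^ (-s / 2) * Complex.Gamma (s / 2) * riemannZeta s := by
  have hs0 : s ≠ 0 := fun h => by simp [h] at hs
  have hG : Complex.Gammaℝ s ≠ 0 := Complex.Gammaℝ_ne_zero_of_re_pos hs
  rw [riemannZeta_def_of_ne_zero hs0, mul_assoc, mul_assoc, ← mul_assoc (_ ^ _),
    ← Complex.Gammaℝ_def, mul_div_cancel₀ _ hG, completedRiemannZeta_eq, xi]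
  have h1 : 1 - s ≠ 0 := sub_ne_zero.2 hs1.symm
  field_simp
  ring

lemma xi_one_sub (s : ℂ) : xi (1 - s) = xi s := by
  rw [xi, xi, completedRiemannZeta₀_one_sub]; ring

lemma completedRiemannZeta₀_eq_mellin (s : ℂ) :
    completedRiemannZeta₀ s = mellin (HurwitzZeta.hurwitzEvenFEPair 0).f_modif (s / 2) / 2 := rfl

lemma conj_f_modif (x : ℝ) : (starRingEnd ℂ) ((HurwitzZeta.hurwitzEvenFEPair 0).f_modif x) =
    (HurwitzZeta.hurwitzEvenFEPair 0).f_modif x := by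
  simp only [WeakFEPair.f_modif, Pi.add_apply, map_add, HurwitzZeta.hurwitzEvenFEPair, Set.indicator]
  split_ifs <;> simp [Complex.conj_ofReal]

lemma completedRiemannZeta₀_conj (s : ℂ) :
    completedRiemannZeta₀ ((starRingEnd ℂ) s) = (starRingEnd ℂ) (completedRiemannZeta₀ s) := by
  rw [completedRiemannZeta₀_eq_mellin, completedRiemannZeta₀_eq_mellin, map_div₀, Complex.conj_ofNat,
    mellin, mellin, ← integral_conj]
  congr 1
  refine setIntegral_congr_fun measurableSet_Ioi fun x hx => ?_
  have hx0 : (0:ℝ) < x := hx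
  simp only [smul_eq_mul, map_mul, conj_f_modif]
  congr 1
  rw [Complex.cpow_def_of_ne_zero (by exact_mod_cast hx0.ne'),
    Complex.cpow_def_of_ne_zero (by exact_mod_cast hx0.ne'), ← Complex.exp_conj,
    ← Complex.ofReal_log hx0.le]
  simp [Complex.conj_ofReal, Complex.conj_ofNat]

lemma xi_conj (s : ℂ) : xi ((starRingEnd ℂ) s) = (starRingEnd ℂ) (xi s) := by
  rw [xi, xi, completedRiemannZeta₀_conj]
  simp [Complex.conj_ofNat]

lemma xi_line_zero_im (u : ℝ) : (xi (line 0 u)).im = 0 := by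
  have h : (starRingEnd ℂ) (line 0 u) = 1 - line 0 u := by
    apply Complex.ext
    · simp; norm_num
    · simp
  have := xi_conj (line 0 u)
  rw [h, xi_one_sub] at this
  exact Complex.conj_eq_iff_im.1 this.symm

lemma exists_norm_xi_le (a b : ℝ) : ∃ C : ℝ, 0 < C ∧ ∀ s : ℂ, s.re ∈ Set.Icc a b →
    ‖xi s‖ ≤ C * (1 + ‖s‖) ^ 2 := by
  set P := HurwitzZeta.hurwitzEvenFEPair 0 with hP
  have hconv : ∀ s : ℂ, MellinConvergent P.f_modif s := fun s =>
    (P.isStrongFEPair_toStrongFEPair.hasMellin s).1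
  have hn : ∀ s : ℂ, IntegrableOn (fun t : ℝ => t ^ (s.re - 1) * ‖P.f_modif t‖) (Set.Ioi 0) := by
    intro s
    refine IntegrableOn.congr_fun (Integrable.norm (hconv s)) (fun t ht => ?_) measurableSet_Ioi
    simp only [norm_smul]
    rw [Complex.norm_cpow_eq_rpow_re_of_pos ht, Complex.sub_re, Complex.one_re]
  set M := ∫ t in Set.Ioi (0:ℝ), (t ^ (a / 2 - 1) * ‖P.f_modif t‖ + t ^ (b / 2 - 1) * ‖P.f_modif t‖)
    with hM
  have ha := hn (a / 2 : ℝ)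
  have hb := hn (b / 2 : ℝ)
  rw [Complex.ofReal_re] at ha hb
  have hM0 : 0 ≤ M := by
    refine setIntegral_nonneg measurableSet_Ioi fun t ht => ?_
    have : (0:ℝ) < t := ht
    positivity
  have hbound : ∀ s : ℂ, s.re ∈ Set.Icc a b → ‖completedRiemannZeta₀ s‖ ≤ M := by
    intro s hs
    rw [completedRiemannZeta₀_eq_mellin, norm_div, Complex.norm_ofNat, mellin]
    refine (half_le_self (norm_nonneg _)).trans (norm_integral_le_of_norm_le (ha.add hb) ?_)
    refine (ae_restrict_iff' measurableSet_Ioi).2 (ae_of_all _ fun t ht => ?_)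
    have ht0 : (0:ℝ) < t := ht
    rw [norm_smul, Complex.norm_cpow_eq_rpow_re_of_pos ht0, ← add_mul]
    have hre : (s / 2 - 1).re = s.re / 2 - 1 := by simp
    rw [hre]
    gcongr
    rcases le_total t 1 with h | h
    · exact (Real.rpow_le_rpow_of_exponent_ge ht0 h (by linarith [hs.1])).trans
        (le_add_of_nonneg_right (by positivity))
    · exact (Real.rpow_le_rpow_of_exponent_le h (by linarith [hs.2])).trans
        (le_add_of_nonneg_left (by positivity))
  refine ⟨M + 1, by positivity, fun s hs => ?_⟩
  have h1 := hbound s hs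
  have h2 : ‖s - 1‖ ≤ 1 + ‖s‖ := by
    have := norm_sub_le s 1; rw [norm_one] at this; linarith
  rw [xi, norm_div, Complex.norm_ofNat]
  calc _ ≤ ‖s * (s - 1) * completedRiemannZeta₀ s + 1‖ := half_le_self (norm_nonneg _)
    _ ≤ ‖s‖ * ‖s - 1‖ * ‖completedRiemannZeta₀ s‖ + 1 := by
        refine (norm_add_le _ _).trans ?_
        rw [norm_mul, norm_mul, norm_one]
    _ ≤ (1 + ‖s‖) * (1 + ‖s‖) * M + 1 := by
        gcongr
        linarith [norm_nonneg s]
    _ ≤ _ := by nlinarith [norm_nonneg s]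

/-- The entire function whose restriction to the critical line is `-exp (π u / 4) Ξ(u)`. -/
noncomputable def xiTwist (s : ℂ) : ℂ := -Complex.exp (-Complex.I * Real.pi * (s - 1 / 2) / 4) * xi s

lemma differentiable_xiTwist : Differentiable ℂ xiTwist := by
  unfold xiTwist
  have := differentiable_xi
  fun_prop

lemma xiTwist_eq_mul {s : ℂ} (hs : 0 < s.re) (hs1 : s ≠ 1) :
    xiTwist s = gammaWeight s * riemannZeta s := by
  have hs0 : s / 2 ≠ 0 := fun h => by
    have : s = 0 := by linear_combination 2 * h
    simp [this] at hs
  rw [xiTwist, xi_eq_mul_riemannZeta hs hs1, gammaWeight, Complex.Gamma_add_one _ hs0]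
  ring

/-- The Hardy–Littlewood function without its power weight. -/
noncomputable def xiReal (u : ℝ) : ℝ := -Real.exp (Real.pi * u / 4) * XiF u

lemma xi_line_zero (u : ℝ) : xi (line 0 u) = (XiF u : ℝ) := by
  have h : (1 / 2 + Complex.I * u : ℂ) = line 0 u := by rw [line_eq]; push_cast; ring
  have hre : (xi (line 0 u)).re = XiF u := by
    rw [xi_eq_mul_riemannZeta (by simp) (fun h => by
      have := congrArg Complex.re h
      norm_num at this), XiF, h]
  apply Complex.ext
  · rw [hre, Complex.ofReal_re]
  · rw [xi_line_zero_im, Complex.ofReal_im]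

lemma xiTwist_line_zero (u : ℝ) : xiTwist (line 0 u) = (xiReal u : ℝ) := by
  have h1 : -Complex.I * Real.pi * (line 0 u - 1 / 2) / 4 = ((Real.pi * u / 4 : ℝ) : ℂ) := by
    rw [line_eq]; push_cast; linear_combination -(Real.pi * u / 4 : ℂ) * Complex.I_sq
  rw [xiTwist, h1, xi_line_zero, xiReal]
  push_cast; rfl

lemma continuous_xiReal : Continuous xiReal := by
  have h : xiReal = fun u => (xiTwist (line 0 u)).re := by
    funext u; rw [xiTwist_line_zero, Complex.ofReal_re]
  have hl : Continuous (line 0) := by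
    have : line 0 = fun u : ℝ => ((1 / 2 + 0 : ℝ) : ℂ) + u * Complex.I := funext (line_eq 0)
    rw [this]; fun_prop
  rw [h]
  exact Complex.continuous_re.comp (differentiable_xiTwist.continuous.comp hl)

lemma XHL_eq (u : ℝ) : XHL u = powWeight u * xiReal u := by
  rw [XHL, powWeight, xiReal]; ring

/-- Partial sums of the Dirichlet series of `ζ`. -/
noncomputable def dirPoly (N : ℕ) (s : ℂ) : ℂ := ∑ n ∈ Finset.Icc 1 N, (n : ℂ) ^ (-s)

lemma norm_riemannZeta_sub_dirPoly_le {N : ℕ} (hN : 1 ≤ N) {s : ℂ} (hs : 2 ≤ s.re) :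
    ‖riemannZeta s - dirPoly N s‖ ≤ 2 * (N : ℝ) ^ (2 - s.re) := by
  have hs1 : 1 < s.re := by linarith
  have hsum : Summable fun n : ℕ => 1 / (n : ℂ) ^ s := Complex.summable_one_div_nat_cpow.2 hs1
  have hsplit := hsum.sum_add_tsum_nat_add (N + 1)
  have hfin : ∑ n ∈ Finset.range (N + 1), 1 / (n : ℂ) ^ s = dirPoly N s := by
    rw [Finset.sum_range_succ', dirPoly]
    have h0 : s ≠ 0 := fun h => by simp [h] at hs; linarith
    rw [Nat.cast_zero, Complex.zero_cpow h0, div_zero, add_zero, Finset.range_eq_Ico,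
      Finset.sum_Ico_add' (fun n : ℕ => 1 / (n : ℂ) ^ s) 0 N 1]
    refine Finset.sum_congr ?_ fun n _ => ?_
    · ext n; simp
    · rw [Complex.cpow_neg, one_div]
  rw [zeta_eq_tsum_one_div_nat_cpow hs1, ← hsplit, hfin, add_sub_cancel_left]
  have hN0 : (0:ℝ) < N := by exact_mod_cast hN
  have hterm : ∀ n : ℕ, ‖1 / ((n + (N + 1) : ℕ) : ℂ) ^ s‖ ≤
      (N : ℝ) ^ (2 - s.re) * (1 / ((n + 1 : ℕ) : ℝ) ^ 2) := by
    intro n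
    have hm : (0:ℝ) < ((n + (N + 1) : ℕ) : ℝ) := by positivity
    rw [norm_div, norm_one, Complex.norm_natCast_cpow_of_pos (by omega)]
    have h1 : ((n + (N + 1) : ℕ) : ℝ) ^ s.re =
        ((n + (N + 1) : ℕ) : ℝ) ^ (s.re - 2) * ((n + (N + 1) : ℕ) : ℝ) ^ 2 := by
      rw [← Real.rpow_natCast, ← Real.rpow_add hm]; congr 1; push_cast; ring
    have h2 : (N : ℝ) ^ (2 - s.re) = 1 / (N : ℝ) ^ (s.re - 2) := by
      rw [← neg_sub, Real.rpow_neg hN0.le, one_div]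
    rw [h1, h2, ← one_div_mul_one_div]
    gcongr
    · linarith [(Nat.cast_nonneg n : (0:ℝ) ≤ n)]
    · omega
  have hsq : HasSum (fun n : ℕ => 1 / ((n + 1 : ℕ) : ℝ) ^ 2) (Real.pi ^ 2 / 6) := by
    have := (hasSum_nat_add_iff' 1).2 hasSum_zeta_two
    simpa using this
  refine (tsum_of_norm_bounded (hsq.mul_left ((N : ℝ) ^ (2 - s.re))) hterm).trans ?_
  rw [mul_comm]
  gcongr
  nlinarith [Real.pi_lt_d2, Real.pi_pos]

lemma sum_one_div_le (N : ℕ) : ∑ n ∈ Finset.Icc 1 N, 1 / (n : ℝ) ≤ 1 + Real.log N := by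
  have := harmonic_le_one_add_log N
  rw [harmonic_eq_sum_Icc] at this
  push_cast at this
  simpa [one_div] using this

lemma sum_inv_sub_le {N n : ℕ} (hn : n ∈ Finset.Icc 1 N) :
    ∑ m ∈ Finset.Icc 1 N with m < n, (1 / (m : ℝ) + 1 / ((n : ℝ) - m)) ≤ 2 * (1 + Real.log N) := by
  rw [Finset.mem_Icc] at hn
  rw [Finset.sum_add_distrib]
  have h1 : ∑ m ∈ Finset.Icc 1 N with m < n, 1 / (m : ℝ) ≤ 1 + Real.log N :=
    (Finset.sum_le_sum_of_subset_of_nonneg (Finset.filter_subset _ _) fun i _ _ => by positivity).trans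
      (sum_one_div_le N)
  have h2 : ∑ m ∈ Finset.Icc 1 N with m < n, 1 / ((n : ℝ) - m) ≤ 1 + Real.log N := by
    refine le_trans (le_of_eq ?_) ((Finset.sum_le_sum_of_subset_of_nonneg
      (Finset.filter_subset (fun m => m < n) (Finset.Icc 1 N)) fun i _ _ => by positivity).trans
      (sum_one_div_le N))
    refine Finset.sum_nbij' (fun m => n - m) (fun m => n - m) ?_ ?_ ?_ ?_ ?_
    · intro m hm; simp only [Finset.mem_filter, Finset.mem_Icc] at hm ⊢; omega
    · intro m hm; simp only [Finset.mem_filter, Finset.mem_Icc] at hm ⊢; omega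
    · intro m hm; simp only [Finset.mem_filter, Finset.mem_Icc] at hm ⊢; omega
    · intro m hm; simp only [Finset.mem_filter, Finset.mem_Icc] at hm ⊢; omega
    · intro m hm
      simp only [Finset.mem_filter, Finset.mem_Icc] at hm
      rw [Nat.cast_sub hm.2.le]
  linarith

lemma rpow_mul_div_abs_log_le {m n : ℕ} (hm : 1 ≤ m) (hmn : m < n) :
    (m : ℝ) ^ (-(1 / 2) : ℝ) * (n : ℝ) ^ (-(1 / 2) : ℝ) / |Real.log m - Real.log n| ≤
      1 / (m : ℝ) + 1 / ((n : ℝ) - m) := by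
  have hm0 : (0:ℝ) < m := by exact_mod_cast hm
  have hmn' : (m : ℝ) < n := by exact_mod_cast hmn
  have hn0 : (0:ℝ) < n := hm0.trans hmn'
  have hlog : ((n : ℝ) - m) / n ≤ |Real.log m - Real.log n| := by
    rw [abs_sub_comm, ← Real.log_div hn0.ne' hm0.ne']
    refine le_trans ?_ (le_abs_self _)
    have := Real.one_sub_inv_le_log_of_pos (show (0:ℝ) < n / m by positivity)
    rw [inv_div] at this
    refine le_trans (le_of_eq ?_) this
    field_simp
  have hd : 0 < (n : ℝ) - m := by linarith
  have hle : (m : ℝ) ^ (-(1 / 2) : ℝ) * (n : ℝ) ^ (-(1 / 2) : ℝ) ≤ 1 / m := by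
    calc _ ≤ (m : ℝ) ^ (-(1 / 2) : ℝ) * (m : ℝ) ^ (-(1 / 2) : ℝ) := by
          gcongr ?_ * ?_
          exact Real.rpow_le_rpow_of_nonpos hm0 hmn'.le (by norm_num)
      _ = 1 / m := by
          rw [← Real.rpow_add hm0, show (-(1 / 2) + -(1 / 2) : ℝ) = -1 by norm_num, Real.rpow_neg_one, one_div]
  calc _ ≤ 1 / (m : ℝ) / (((n : ℝ) - m) / n) := by gcongr
    _ = _ := by field_simp; ring

lemma sum_offdiag_le (N : ℕ) : ∑ m ∈ Finset.Icc 1 N, ∑ n ∈ Finset.Icc 1 N with n ≠ m,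
    (m : ℝ) ^ (-(1 / 2) : ℝ) * (n : ℝ) ^ (-(1 / 2) : ℝ) / |Real.log m - Real.log n| ≤
      4 * N * (1 + Real.log N) := by
  set F : ℕ → ℕ → ℝ := fun m n =>
    (m : ℝ) ^ (-(1 / 2) : ℝ) * (n : ℝ) ^ (-(1 / 2) : ℝ) / |Real.log m - Real.log n| with hF
  have hsymm : ∀ m n, F m n = F n m := fun m n => by
    simp only [hF]; rw [abs_sub_comm, mul_comm]
  have hlt : ∑ m ∈ Finset.Icc 1 N, ∑ n ∈ Finset.Icc 1 N with n < m, F m n ≤ 2 * N * (1 + Real.log N) := by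
    calc _ ≤ ∑ m ∈ Finset.Icc 1 N, 2 * (1 + Real.log N) := by
          refine Finset.sum_le_sum fun m hm => le_trans (Finset.sum_le_sum fun n hn => ?_) (sum_inv_sub_le hm)
          rw [Finset.mem_filter, Finset.mem_Icc] at hn
          rw [hsymm]
          exact rpow_mul_div_abs_log_le hn.1.1 hn.2
      _ = _ := by simp; ring
  have hgt : ∑ m ∈ Finset.Icc 1 N, ∑ n ∈ Finset.Icc 1 N with m < n, F m n =
      ∑ m ∈ Finset.Icc 1 N, ∑ n ∈ Finset.Icc 1 N with n < m, F m n := by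
    simp only [Finset.sum_filter]
    rw [Finset.sum_comm]
    refine Finset.sum_congr rfl fun m _ => Finset.sum_congr rfl fun n _ => ?_
    rw [hsymm]
  have hsplit : ∀ m, ∑ n ∈ Finset.Icc 1 N with n ≠ m, F m n =
      ∑ n ∈ Finset.Icc 1 N with n < m, F m n + ∑ n ∈ Finset.Icc 1 N with m < n, F m n := by
    intro m
    rw [← Finset.sum_union]
    · refine Finset.sum_congr ?_ fun _ _ => rfl
      ext n; simp only [Finset.mem_filter, Finset.mem_union, ← and_or_left, ne_eq, ← lt_or_lt_iff_ne]
    · rw [Finset.disjoint_filter]; intro n _ h1 h2; omega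
  calc _ = ∑ m ∈ Finset.Icc 1 N, ∑ n ∈ Finset.Icc 1 N with n ≠ m, F m n := rfl
    _ ≤ _ := by
      simp only [hsplit]
      rw [Finset.sum_add_distrib, hgt]
      linarith

/-- First derivative test for an oscillatory integral with slowly varying amplitude. -/
lemma norm_integral_mul_exp_le {A B M K θ : ℝ} (hA : 0 < A) (hAB : A ≤ B) (hθ : θ ≠ 0) {b b' : ℝ → ℂ}
    (hb : ∀ t ∈ Set.Icc A B, HasDerivAt b (b' t) t) (hb' : ContinuousOn b' (Set.Icc A B))
    (hM : ∀ t ∈ Set.Icc A B, ‖b t‖ ≤ M) (hK : ∀ t ∈ Set.Icc A B, ‖b' t‖ ≤ K / t) :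
    ‖∫ t in A..B, b t * Complex.exp (-(Complex.I * t * θ))‖ ≤ (2 * M + K * Real.log (B / A)) / |θ| := by
  have hc : -(Complex.I * θ) ≠ 0 := by simp [hθ]
  set e : ℝ → ℂ := fun t => Complex.exp (-(Complex.I * t * θ)) / -(Complex.I * θ) with he
  have hexp : ∀ t : ℝ, ‖e t‖ = 1 / |θ| := fun t => by
    simp only [he, norm_div, Complex.norm_exp, norm_neg, norm_mul, Complex.norm_I, Complex.norm_real,
      Real.norm_eq_abs]
    simp
  have hed : ∀ t : ℝ, HasDerivAt e (Complex.exp (-(Complex.I * t * θ))) t := fun t => by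
    have h1 : HasDerivAt (fun t : ℝ => -(Complex.I * (t : ℂ) * θ)) (-(Complex.I * 1 * θ)) t :=
      (((hasDerivAt_id t).ofReal_comp.const_mul Complex.I).mul_const (θ : ℂ)).neg
    have h2 := h1.cexp.div_const (-(Complex.I * θ))
    rwa [mul_one, mul_div_assoc, div_self hc, mul_one] at h2
  have hu : Set.uIcc A B = Set.Icc A B := Set.uIcc_of_le hAB
  have hparts := intervalIntegral.integral_mul_deriv_eq_deriv_mul (u := b) (v := e) (u' := b')
    (v' := fun t : ℝ => Complex.exp (-(Complex.I * t * θ))) (a := A) (b := B)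
    (fun t ht => hb t (hu ▸ ht)) (fun t _ => hed t)
    (hb'.intervalIntegrable_of_Icc hAB) (Continuous.intervalIntegrable (by fun_prop) _ _)
  rw [hparts]
  have hθ' : 0 < |θ| := abs_pos.2 hθ
  have h3 : ‖∫ t in A..B, b' t * e t‖ ≤ K * Real.log (B / A) / |θ| := by
    have hintgr : ∫ t in A..B, K / |θ| * t⁻¹ = K * Real.log (B / A) / |θ| := by
      rw [intervalIntegral.integral_const_mul, integral_inv_of_pos hA (hA.trans_le hAB)]; ring
    rw [← hintgr]
    refine intervalIntegral.norm_integral_le_of_norm_le hAB (ae_of_all _ fun t ht => ?_) ?_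
    · rw [norm_mul, hexp]
      calc _ ≤ K / t * (1 / |θ|) := by gcongr; exact hK t ⟨ht.1.le, ht.2⟩
        _ = _ := by rw [div_eq_mul_inv, div_eq_mul_inv, div_eq_mul_inv]; ring
    · refine ContinuousOn.intervalIntegrable fun t ht => ?_
      rw [hu] at ht
      have : t ≠ 0 := (hA.trans_le ht.1).ne'
      exact (ContinuousAt.continuousWithinAt (by fun_prop (disch := assumption)))
  calc _ ≤ ‖b B * e B‖ + ‖b A * e A‖ + ‖∫ t in A..B, b' t * e t‖ :=
        (norm_sub_le _ _).trans (add_le_add_left (norm_sub_le _ _) _)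
    _ ≤ M * (1 / |θ|) + M * (1 / |θ|) + K * Real.log (B / A) / |θ| := by
        rw [norm_mul, norm_mul, hexp, hexp]
        gcongr
        · exact hM B ⟨hAB, le_rfl⟩
        · exact hM A ⟨le_rfl, hAB⟩
    _ = _ := by ring

lemma natCast_cpow_neg_line {n : ℕ} (hn : 1 ≤ n) (σ t : ℝ) : (n : ℂ) ^ (-line σ t) =
    ((n : ℝ) ^ (-(1 / 2 + σ)) : ℝ) * Complex.exp (-(Complex.I * t * Real.log n)) := by
  have hn0 : (0:ℝ) < n := by exact_mod_cast hn
  have hnc : (n : ℂ) ≠ 0 := by exact_mod_cast hn0.ne'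
  rw [Complex.cpow_def_of_ne_zero hnc, Real.rpow_def_of_pos hn0, Complex.ofReal_exp, ← Complex.exp_add,
    line_eq, Complex.natCast_log]
  congr 1
  push_cast
  ring

/-- Mean square of a Dirichlet polynomial with slowly varying coefficients on the critical line. -/
theorem abs_integral_norm_sq_sub_diag_le (N : ℕ) {A B M K : ℝ} (hA : 0 < A) (hAB : A ≤ B)
    (hM0 : 0 ≤ M) {a a' : ℕ → ℝ → ℂ}
    (ha : ∀ n ∈ Finset.Icc 1 N, ∀ t ∈ Set.Icc A B, HasDerivAt (a n) (a' n t) t)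
    (ha' : ∀ n ∈ Finset.Icc 1 N, ContinuousOn (a' n) (Set.Icc A B))
    (hM : ∀ n ∈ Finset.Icc 1 N, ∀ t ∈ Set.Icc A B, ‖a n t‖ ≤ M)
    (hK : ∀ n ∈ Finset.Icc 1 N, ∀ t ∈ Set.Icc A B, ‖a' n t‖ ≤ K / t) :
    |(∫ t in A..B, ‖∑ n ∈ Finset.Icc 1 N, a n t * (n : ℂ) ^ (-line 0 t)‖ ^ 2) -
      ∑ n ∈ Finset.Icc 1 N, 1 / (n : ℝ) * ∫ t in A..B, ‖a n t‖ ^ 2| ≤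
      (2 * M ^ 2 + 2 * M * K * Real.log (B / A)) * (4 * N * (1 + Real.log N)) := by
  have hu : Set.uIcc A B = Set.Icc A B := Set.uIcc_of_le hAB
  have hac : ∀ n ∈ Finset.Icc 1 N, ContinuousOn (a n) (Set.Icc A B) := fun n hn t ht =>
    (ha n hn t ht).continuousAt.continuousWithinAt
  set w : ℕ → ℝ := fun n => (n : ℝ) ^ (-(1 / 2) : ℝ) with hw
  set J : ℕ → ℕ → ℂ := fun m n => ∫ t in A..B, (a m t * (starRingEnd ℂ) (a n t)) *
    Complex.exp (-(Complex.I * t * ((Real.log m - Real.log n : ℝ) : ℂ))) with hJ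
  have hterm : ∀ t : ℝ, ((‖∑ n ∈ Finset.Icc 1 N, a n t * (n : ℂ) ^ (-line 0 t)‖ ^ 2 : ℝ) : ℂ) =
      ∑ m ∈ Finset.Icc 1 N, ∑ n ∈ Finset.Icc 1 N, (w m * w n : ℝ) *
        ((a m t * (starRingEnd ℂ) (a n t)) *
          Complex.exp (-(Complex.I * t * ((Real.log m - Real.log n : ℝ) : ℂ)))) := by
    intro t
    rw [Complex.ofReal_pow, ← Complex.mul_conj', map_sum, Finset.sum_mul_sum]
    refine Finset.sum_congr rfl fun m hm => Finset.sum_congr rfl fun n hn => ?_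
    rw [natCast_cpow_neg_line (Finset.mem_Icc.1 hm).1, natCast_cpow_neg_line (Finset.mem_Icc.1 hn).1,
      add_zero, map_mul, map_mul, Complex.conj_ofReal, ← Complex.exp_conj]
    have : (starRingEnd ℂ) (-(Complex.I * t * Real.log n)) = Complex.I * t * Real.log n := by
      rw [map_neg, map_mul, map_mul, Complex.conj_I, Complex.conj_ofReal, Complex.conj_ofReal]; ring
    rw [this]
    have h2 : Complex.exp (-(Complex.I * t * ((Real.log m - Real.log n : ℝ) : ℂ))) =
        Complex.exp (-(Complex.I * t * Real.log m)) * Complex.exp (Complex.I * t * Real.log n) := by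
      rw [← Complex.exp_add]; congr 1; push_cast; ring
    rw [h2]
    push_cast
    ring
  have hcont : ∀ m ∈ Finset.Icc 1 N, ∀ n ∈ Finset.Icc 1 N, ContinuousOn (fun t : ℝ =>
      (a m t * (starRingEnd ℂ) (a n t)) *
        Complex.exp (-(Complex.I * t * ((Real.log m - Real.log n : ℝ) : ℂ)))) (Set.Icc A B) := by
    intro m hm n hn
    refine ContinuousOn.mul ((hac m hm).mul ?_) (Continuous.continuousOn (by fun_prop))
    exact Complex.continuous_conj.comp_continuousOn (hac n hn)
  have hintgr : ((∫ t in A..B, ‖∑ n ∈ Finset.Icc 1 N, a n t * (n : ℂ) ^ (-line 0 t)‖ ^ 2 : ℝ) : ℂ) =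
      ∑ m ∈ Finset.Icc 1 N, ∑ n ∈ Finset.Icc 1 N, (w m * w n : ℝ) * J m n := by
    rw [← intervalIntegral.integral_ofReal]
    simp only [hterm]
    rw [intervalIntegral.integral_finsetSum]
    · refine Finset.sum_congr rfl fun m hm => ?_
      rw [intervalIntegral.integral_finsetSum]
      · refine Finset.sum_congr rfl fun n hn => ?_
        rw [intervalIntegral.integral_const_mul]
      · exact fun n hn => ((hcont m hm n hn).intervalIntegrable_of_Icc hAB).const_mul _
    · exact fun m hm => (continuousOn_finsetSum _ fun n hn =>
        continuousOn_const.mul (hcont m hm n hn)).intervalIntegrable_of_Icc hAB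
  have hdiag : ∀ m ∈ Finset.Icc 1 N, ((w m * w m : ℝ) : ℂ) * J m m =
      ((1 / (m : ℝ) * ∫ t in A..B, ‖a m t‖ ^ 2 : ℝ) : ℂ) := by
    intro m hm
    have hm0 : (0:ℝ) < m := by exact_mod_cast (Finset.mem_Icc.1 hm).1
    have h1 : w m * w m = 1 / m := by
      simp only [hw]
      rw [← Real.rpow_add hm0, show (-(1 / 2) + -(1 / 2) : ℝ) = -1 by norm_num, Real.rpow_neg_one, one_div]
    rw [h1, Complex.ofReal_mul, ← intervalIntegral.integral_ofReal]
    simp only [hJ, sub_self, Complex.ofReal_zero, mul_zero, neg_zero, Complex.exp_zero, mul_one,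
      Complex.mul_conj', Complex.ofReal_pow]
  have hoff : ∀ m ∈ Finset.Icc 1 N, ∀ n ∈ Finset.Icc 1 N, n ≠ m → ‖((w m * w n : ℝ) : ℂ) * J m n‖ ≤
      (2 * M ^ 2 + 2 * M * K * Real.log (B / A)) *
        (w m * w n / |Real.log m - Real.log n|) := by
    intro m hm n hn hmn
    have hm0 : (0:ℝ) < m := by exact_mod_cast (Finset.mem_Icc.1 hm).1
    have hn0 : (0:ℝ) < n := by exact_mod_cast (Finset.mem_Icc.1 hn).1
    have hθ : Real.log m - Real.log n ≠ 0 := by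
      rw [sub_ne_zero]
      intro h
      exact hmn (by exact_mod_cast (Real.log_injOn_pos hm0 hn0 h).symm)
    have := norm_integral_mul_exp_le (b := fun t => a m t * (starRingEnd ℂ) (a n t))
      (b' := fun t => a' m t * (starRingEnd ℂ) (a n t) + a m t * (starRingEnd ℂ) (a' n t))
      (M := M ^ 2) (K := 2 * M * K) hA hAB hθ ?_ ?_ ?_ ?_
    · rw [norm_mul, Complex.norm_real, Real.norm_of_nonneg (by positivity)]
      calc _ ≤ w m * w n * ((2 * M ^ 2 + 2 * M * K * Real.log (B / A)) / |Real.log m - Real.log n|) := by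
            gcongr
        _ = _ := by ring
    · intro t ht
      exact (ha m hm t ht).mul (ha n hn t ht).star
    · exact ((ha' m hm).mul (Complex.continuous_conj.comp_continuousOn (hac n hn))).add
        ((hac m hm).mul (Complex.continuous_conj.comp_continuousOn (ha' n hn)))
    · intro t ht
      rw [norm_mul, Complex.norm_conj, sq]
      gcongr
      · exact hM m hm t ht
      · exact hM n hn t ht
    · intro t ht
      refine (norm_add_le _ _).trans ?_
      rw [norm_mul, norm_mul, Complex.norm_conj, Complex.norm_conj]
      have hKt : 0 ≤ K / t := (norm_nonneg _).trans (hK m hm t ht)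
      calc _ ≤ K / t * M + M * (K / t) := by
            gcongr
            · exact hK m hm t ht
            · exact hM n hn t ht
            · exact hM m hm t ht
            · exact hK n hn t ht
        _ = _ := by ring
  have hfin : ((∫ t in A..B, ‖∑ n ∈ Finset.Icc 1 N, a n t * (n : ℂ) ^ (-line 0 t)‖ ^ 2) -
      ∑ n ∈ Finset.Icc 1 N, 1 / (n : ℝ) * ∫ t in A..B, ‖a n t‖ ^ 2 : ℝ) =
      ∑ m ∈ Finset.Icc 1 N, ∑ n ∈ Finset.Icc 1 N with n ≠ m, ((w m * w n : ℝ) : ℂ) * J m n := by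
    rw [Complex.ofReal_sub, hintgr, Complex.ofReal_sum, ← Finset.sum_sub_distrib]
    refine Finset.sum_congr rfl fun m hm => ?_
    rw [← hdiag m hm, ← Finset.sum_erase_eq_sub hm, Finset.filter_ne']
  rw [← Real.norm_eq_abs, ← Complex.norm_real, hfin]
  refine (norm_sum_le _ _).trans ((Finset.sum_le_sum fun m hm => (norm_sum_le _ _).trans
    (Finset.sum_le_sum fun n hn => hoff m hm n (Finset.mem_filter.1 hn).1 (Finset.mem_filter.1 hn).2)).trans ?_)
  simp only [← Finset.mul_sum]
  rcases N.eq_zero_or_pos with h | h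
  · subst h; simp
  have h1 : (1:ℕ) ∈ Finset.Icc 1 N := Finset.mem_Icc.2 ⟨le_rfl, h⟩
  have hK0 : 0 ≤ K := by
    have := (norm_nonneg _).trans (hK 1 h1 A ⟨le_rfl, hAB⟩)
    by_contra! hcon
    exact absurd this (not_le.2 (div_neg_of_neg_of_pos hcon hA))
  have hlog : 0 ≤ Real.log (B / A) := Real.log_nonneg ((one_le_div hA).2 hAB)
  exact mul_le_mul_of_nonneg_left (sum_offdiag_le N) (by positivity)

/-- Mean value bound for `dirPoly` on vertical segments to the right of the critical line. -/
lemma integral_norm_dirPoly_sq_le (N : ℕ) {A B σ : ℝ} (hA : 0 < A) (hAB : A ≤ B) (hσ : 0 ≤ σ) (v : ℝ) :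
    ∫ t in A..B, ‖dirPoly N (line σ (t + v))‖ ^ 2 ≤ (B - A + 8 * N) * (1 + Real.log N) := by
  have hcoef : ∀ n ∈ Finset.Icc 1 N, ‖(n : ℂ) ^ (-((σ : ℂ) + v * Complex.I))‖ ≤ 1 := by
    intro n hn
    have hn1 := (Finset.mem_Icc.1 hn).1
    rw [Complex.norm_natCast_cpow_of_pos hn1]
    refine Real.rpow_le_one_of_one_le_of_nonpos (by exact_mod_cast hn1) ?_
    simp [hσ]
  have h := abs_integral_norm_sq_sub_diag_le N (M := 1) (K := 0) hA hAB zero_le_one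
    (a := fun n _ => (n : ℂ) ^ (-((σ : ℂ) + v * Complex.I))) (a' := fun _ _ => 0)
    (fun n _ t _ => hasDerivAt_const _ _) (fun n _ => continuousOn_const)
    (fun n hn t _ => hcoef n hn) (fun n _ t _ => by simp)
  have heq : ∀ t : ℝ, ∑ n ∈ Finset.Icc 1 N, (n : ℂ) ^ (-((σ : ℂ) + v * Complex.I)) * (n : ℂ) ^ (-line 0 t) =
      dirPoly N (line σ (t + v)) := by
    intro t
    refine Finset.sum_congr rfl fun n hn => ?_
    have hn1 := (Finset.mem_Icc.1 hn).1
    rw [← Complex.cpow_add _ _ (by exact_mod_cast (by omega : n ≠ 0))]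
    congr 1
    rw [line_eq, line_eq]; push_cast; ring
  simp only [heq] at h
  have hd : ∑ n ∈ Finset.Icc 1 N, 1 / (n : ℝ) *
      ∫ t in A..B, ‖(n : ℂ) ^ (-((σ : ℂ) + v * Complex.I))‖ ^ 2 ≤ (B - A) * (1 + Real.log N) := by
    calc _ ≤ ∑ n ∈ Finset.Icc 1 N, 1 / (n : ℝ) * (B - A) := by
          refine Finset.sum_le_sum fun n hn => ?_
          rw [intervalIntegral.integral_const, smul_eq_mul]
          gcongr
          have : ‖(n : ℂ) ^ (-((σ : ℂ) + v * Complex.I))‖ ^ 2 ≤ 1 :=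
            pow_le_one₀ (norm_nonneg _) (hcoef n hn)
          nlinarith
      _ ≤ _ := by
          rw [← Finset.sum_mul, mul_comm]
          have := sum_one_div_le N
          gcongr
  have := (abs_le.1 h).2
  linarith

lemma exists_pow_mul_exp_le (p : ℕ) (c : ℝ) {b : ℝ} (hb : 0 < b) : ∃ C : ℝ, 0 < C ∧
    ∀ y : ℝ, (1 + |y|) ^ p * Real.exp (c * |y| - b * y ^ 2) ≤ C := by
  refine ⟨p.factorial * Real.exp (1 + (c + 1) ^ 2 / (4 * b)), by positivity, fun y => ?_⟩
  have h1 := Real.pow_div_factorial_le_exp _ (show 0 ≤ 1 + |y| by positivity) p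
  rw [div_le_iff₀ (by positivity)] at h1
  calc _ ≤ Real.exp (1 + |y|) * p.factorial * Real.exp (c * |y| - b * y ^ 2) := by gcongr
    _ = p.factorial * Real.exp (1 + |y| + (c * |y| - b * y ^ 2)) := by rw [Real.exp_add (1 + |y|)]; ring
    _ ≤ _ := by
      refine mul_le_mul_of_nonneg_left (Real.exp_le_exp.2 ?_) (by positivity)
      have h2 : (c + 1) * |y| - b * |y| ^ 2 ≤ (c + 1) ^ 2 / (4 * b) := by
        rw [le_div_iff₀ (by positivity)]
        nlinarith [sq_nonneg (c + 1 - 2 * b * |y|)]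
      rw [sq_abs] at h2
      linarith

lemma exists_pow_mul_exp_le_div (p : ℕ) (c : ℝ) {b : ℝ} (hb : 0 < b) : ∃ C : ℝ, 0 < C ∧
    ∀ y : ℝ, (1 + |y|) ^ p * Real.exp (c * |y| - b * y ^ 2) ≤ C / (1 + y ^ 2) := by
  obtain ⟨C, hC, h⟩ := exists_pow_mul_exp_le (p + 2) c hb
  refine ⟨C, hC, fun y => ?_⟩
  rw [le_div_iff₀ (by positivity)]
  refine le_trans ?_ (h y)
  rw [pow_add, mul_right_comm]
  gcongr
  nlinarith [abs_nonneg y, sq_abs y]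

lemma integrable_pow_mul_exp (p : ℕ) (c : ℝ) {b : ℝ} (hb : 0 < b) :
    Integrable fun y : ℝ => (1 + |y|) ^ p * Real.exp (c * |y| - b * y ^ 2) := by
  obtain ⟨C, hC, h⟩ := exists_pow_mul_exp_le_div p c hb
  refine (integrable_inv_one_add_sq.const_mul C).mono'
    (Continuous.aestronglyMeasurable (by fun_prop)) (ae_of_all _ fun y => ?_)
  rw [Real.norm_of_nonneg (by positivity)]
  exact (h y).trans_eq (div_eq_mul_inv _ _)

lemma norm_cexp_sq (x y : ℝ) : ‖Complex.exp ((x + y * Complex.I) ^ 2)‖ = Real.exp (x ^ 2 - y ^ 2) := by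
  rw [Complex.norm_exp]
  congr 1
  simp [sq]

lemma add_mul_I_ne_zero {x : ℝ} (hx : x ≠ 0) (y : ℝ) : (x + y * Complex.I : ℂ) ≠ 0 := fun h => by
  have := congrArg Complex.re h
  simp at this
  exact hx this

lemma le_norm_add_mul_I {x : ℝ} (hx : 0 ≤ x) (y : ℝ) : x ≤ ‖(x + y * Complex.I : ℂ)‖ := by
  have := Complex.abs_re_le_norm (x + y * Complex.I : ℂ)
  simp [abs_of_nonneg hx] at this
  exact this

lemma integrable_exp_sq_div {c : ℝ} (hc : 0 < c) :
    Integrable fun y : ℝ => Complex.exp ((c + y * Complex.I) ^ 2) / (c + y * Complex.I) := by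
  refine ((integrable_pow_mul_exp 0 0 one_pos).const_mul (Real.exp (c ^ 2) / c)).mono'
    (Continuous.aestronglyMeasurable ?_) (ae_of_all _ fun y => ?_)
  · exact Continuous.div (by fun_prop) (by fun_prop) fun y => add_mul_I_ne_zero hc.ne' y
  · rw [norm_div, norm_cexp_sq, pow_zero, one_mul, zero_mul, zero_sub, one_mul, div_mul_eq_mul_div,
      ← Real.exp_add, ← sub_eq_add_neg]
    gcongr
    exact le_norm_add_mul_I hc.le y

lemma half_le_re_integral_exp_sq_div {c : ℝ} (hc : 0 < c) (hc' : c ≤ 1 / 40) :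
    1 / 2 ≤ (∫ y : ℝ, Complex.exp ((c + y * Complex.I) ^ 2) / (c + y * Complex.I)).re := by
  have hintgr := integrable_exp_sq_div hc
  have hre : (∫ y : ℝ, Complex.exp ((c + y * Complex.I) ^ 2) / (c + y * Complex.I)).re =
      ∫ y : ℝ, (Complex.exp ((c + y * Complex.I) ^ 2) / (c + y * Complex.I)).re :=
    (integral_re hintgr).symm
  rw [hre]
  have hexp : ∀ y : ℝ, (Complex.exp ((c + y * Complex.I) ^ 2) / (c + y * Complex.I)).re =
      Real.exp (c ^ 2 - y ^ 2) * ((c * Real.cos (2 * c * y) + y * Real.sin (2 * c * y)) / (c ^ 2 + y ^ 2)) := by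
    intro y
    have h1 : (c + y * Complex.I) ^ 2 = ((c ^ 2 - y ^ 2 : ℝ) : ℂ) + ((2 * c * y : ℝ) : ℂ) * Complex.I := by
      push_cast; linear_combination (y : ℂ) ^ 2 * Complex.I_sq
    have hn : c ^ 2 + y ^ 2 ≠ 0 := by positivity
    rw [h1, Complex.exp_add_mul_I, ← Complex.ofReal_exp, ← Complex.ofReal_cos, ← Complex.ofReal_sin,
      Complex.div_re]
    generalize Real.exp (c ^ 2 - y ^ 2) = e
    generalize Real.cos (2 * c * y) = p
    generalize Real.sin (2 * c * y) = q
    simp only [Complex.normSq_apply, Complex.mul_re, Complex.mul_im, Complex.add_re, Complex.add_im,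
      Complex.ofReal_re, Complex.ofReal_im, Complex.I_re, Complex.I_im, mul_zero, mul_one, zero_mul,
      add_zero, zero_add, sub_zero, sub_self, ← sq]
    field_simp
    ring
  have hlow : ∀ y : ℝ, (Set.Icc (-c) c).indicator (fun _ => Real.exp (-c ^ 2) / (2 * c)) y -
      8 * c * Real.exp (-1 * y ^ 2) ≤ (Complex.exp ((c + y * Complex.I) ^ 2) / (c + y * Complex.I)).re := by
    intro y
    rw [hexp]
    have hpos : 0 < c ^ 2 + y ^ 2 := by positivity
    have hcos : 1 - (2 * c * y) ^ 2 / 2 ≤ Real.cos (2 * c * y) := Real.one_sub_sq_div_two_le_cos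
    have hsin : -(2 * c * y ^ 2) ≤ y * Real.sin (2 * c * y) := by
      have h1 : |Real.sin (2 * c * y)| ≤ |2 * c * y| := Real.abs_sin_le_abs
      have h2 : |y * Real.sin (2 * c * y)| ≤ 2 * c * y ^ 2 := by
        rw [abs_mul]
        calc _ ≤ |y| * |2 * c * y| := by gcongr
          _ = _ := by rw [abs_mul, abs_of_pos (by positivity : 0 < 2 * c), ← sq_abs y]; ring
      exact (abs_le.1 h2).1
    have hbr : c / (c ^ 2 + y ^ 2) - 4 * c ≤
        (c * Real.cos (2 * c * y) + y * Real.sin (2 * c * y)) / (c ^ 2 + y ^ 2) := by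
      rw [le_div_iff₀ hpos, sub_mul, div_mul_cancel₀ _ hpos.ne']
      have h3 : c * (1 - (2 * c * y) ^ 2 / 2) ≤ c * Real.cos (2 * c * y) := by gcongr
      have hc2 : c ^ 2 ≤ 1 := by nlinarith
      have h4 : 2 * c * (c ^ 2 * y ^ 2) ≤ 2 * c * (1 * y ^ 2) := by gcongr
      have h5 : 0 ≤ c * c ^ 2 := by positivity
      nlinarith
    have he2 : Real.exp (c ^ 2) ≤ 2 := by
      have : c ^ 2 ≤ Real.log 2 := by nlinarith [Real.log_two_gt_d9]
      exact (Real.exp_le_exp.2 this).trans_eq (Real.exp_log two_pos)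
    have he1 : 1 ≤ Real.exp (c ^ 2) := Real.one_le_exp (by positivity)
    have hsplit : Real.exp (c ^ 2 - y ^ 2) = Real.exp (c ^ 2) * Real.exp (-1 * y ^ 2) := by
      rw [← Real.exp_add]; congr 1; ring
    have hind : (Set.Icc (-c) c).indicator (fun _ => Real.exp (-c ^ 2) / (2 * c)) y ≤
        Real.exp (c ^ 2 - y ^ 2) * (c / (c ^ 2 + y ^ 2)) := by
      by_cases hy : y ∈ Set.Icc (-c) c
      · rw [Set.indicator_of_mem hy]
        have hy2 : y ^ 2 ≤ c ^ 2 := sq_le_sq' hy.1 hy.2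
        have h1 : Real.exp (-c ^ 2) ≤ Real.exp (c ^ 2 - y ^ 2) := by
          apply Real.exp_le_exp.2; nlinarith [sq_nonneg c]
        have h2 : 1 / (2 * c) ≤ c / (c ^ 2 + y ^ 2) := by
          rw [div_le_div_iff₀ (by positivity) hpos]; nlinarith
        calc _ = Real.exp (-c ^ 2) * (1 / (2 * c)) := by ring
          _ ≤ _ := by gcongr
      · rw [Set.indicator_of_notMem hy]; positivity
    calc _ ≤ Real.exp (c ^ 2 - y ^ 2) * (c / (c ^ 2 + y ^ 2)) -
            4 * c * (Real.exp (c ^ 2) * Real.exp (-1 * y ^ 2)) := by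
          refine sub_le_sub hind ?_
          have : Real.exp (c ^ 2) * Real.exp (-1 * y ^ 2) ≤ 2 * Real.exp (-1 * y ^ 2) := by gcongr
          nlinarith
      _ = Real.exp (c ^ 2 - y ^ 2) * (c / (c ^ 2 + y ^ 2) - 4 * c) := by rw [hsplit]; ring
      _ ≤ _ := by gcongr
  have hI1 : Integrable fun y : ℝ => (Set.Icc (-c) c).indicator (fun _ => Real.exp (-c ^ 2) / (2 * c)) y :=
    (integrable_indicator_iff measurableSet_Icc).2 (by simp)
  have hI2 : Integrable fun y : ℝ => 8 * c * Real.exp (-1 * y ^ 2) :=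
    (integrable_exp_neg_mul_sq one_pos).const_mul _
  refine le_trans ?_ (integral_mono (hI1.sub hI2) hintgr.re hlow)
  simp only [Pi.sub_apply]
  rw [integral_sub hI1 hI2, integral_indicator measurableSet_Icc, setIntegral_const, integral_const_mul,
    integral_gaussian, div_one]
  have hvol : volume.real (Set.Icc (-c) c) = 2 * c := by
    rw [Real.volume_real_Icc_of_le (by linarith)]; ring
  rw [hvol, smul_eq_mul, mul_div_cancel₀ _ (by positivity)]
  have h1 : 1 - c ^ 2 ≤ Real.exp (-c ^ 2) := by linarith [Real.add_one_le_exp (-c ^ 2)]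
  have h2 : √Real.pi ≤ 2 := by
    rw [Real.sqrt_le_left (by norm_num)]; linarith [Real.pi_le_four]
  have h3 : 8 * c * √Real.pi ≤ 8 * c * 2 := by gcongr
  nlinarith

/-- Recovering `Ξ` from the values of `ξ` to the right of the critical line. -/
lemma abs_XiF_le {c : ℝ} (hc : 0 < c) (hc' : c ≤ 1 / 40) (t : ℝ) :
    |XiF t| ≤ 2 * ‖∫ y : ℝ, Complex.exp ((c + y * Complex.I) ^ 2) / (c + y * Complex.I) *
      xi (line 0 t + (c + y * Complex.I))‖ := by
  set s := line 0 t with hs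
  set g : ℂ → ℂ := fun w => xi (s + w) with hg
  have hgd : Differentiable ℂ g := differentiable_xi.comp (differentiable_id.const_add s)
  have hdd : Differentiable ℂ (dslope g 0) := by
    rw [← differentiableOn_univ, Complex.differentiableOn_dslope univ_mem]
    exact hgd.differentiableOn
  obtain ⟨C₀, hC₀, hxi⟩ := exists_norm_xi_le (1 / 2) (3 / 2)
  have hgb : ∀ x ∈ Set.Icc (0:ℝ) c, ∀ y : ℝ, ‖g (x + y * Complex.I)‖ ≤
      C₀ * (2 + ‖s‖) ^ 2 * (1 + |y|) ^ 2 := by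
    intro x hx y
    have h1 := hxi (s + (x + y * Complex.I)) (by
      have := hx.1; have := hx.2
      simp [hs]; constructor <;> linarith)
    have h2 : ‖(x + y * Complex.I : ℂ)‖ ≤ 1 + |y| := by
      refine (norm_add_le _ _).trans (add_le_add ?_ (by simp))
      rw [Complex.norm_real, Real.norm_of_nonneg hx.1]
      linarith [hx.2]
    refine h1.trans ?_
    rw [mul_assoc, ← mul_pow]
    gcongr
    nlinarith [norm_add_le s (x + y * Complex.I), norm_nonneg s, abs_nonneg y,
      mul_nonneg (norm_nonneg s) (abs_nonneg y)]
  obtain ⟨C₁, hC₁⟩ := ((isCompact_Icc (a := (0:ℝ)) (b := c)).reProdIm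
    (isCompact_Icc (a := (-1:ℝ)) (b := 1))).exists_bound_of_continuousOn hdd.continuous.continuousOn
  set D := |C₁| + 2 * (C₀ * (2 + ‖s‖) ^ 2) with hD
  have hD0 : 0 ≤ D := by positivity
  have hdb : ∀ x ∈ Set.Icc (0:ℝ) c, ∀ y : ℝ, ‖dslope g 0 (x + y * Complex.I)‖ ≤ D * (1 + |y|) ^ 2 := by
    intro x hx y
    have hone : 1 ≤ (1 + |y|) ^ 2 := one_le_pow₀ (by linarith [abs_nonneg y])
    have hE : 0 ≤ C₀ * (2 + ‖s‖) ^ 2 := by positivity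
    rcases le_total |y| 1 with hy | hy
    · have := hC₁ (x + y * Complex.I) (by
        rw [Complex.mem_reProdIm]; simpa using ⟨hx, abs_le.1 hy⟩)
      calc _ ≤ |C₁| := this.trans (le_abs_self _)
        _ ≤ D * 1 := by rw [hD, mul_one]; linarith
        _ ≤ _ := by gcongr
    · have hw1 : 1 ≤ ‖(x + y * Complex.I : ℂ)‖ := by
        have := Complex.abs_im_le_norm (x + y * Complex.I : ℂ)
        simp at this; exact hy.trans this
      have hw0 : (x + y * Complex.I : ℂ) ≠ 0 := fun h => by rw [h] at hw1; simp at hw1; linarith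
      rw [dslope_of_ne _ hw0, slope_def_field, sub_zero, norm_div]
      have h0 : ‖g 0‖ ≤ C₀ * (2 + ‖s‖) ^ 2 * (1 + |y|) ^ 2 := by
        refine le_trans ?_ (le_mul_of_one_le_right hE hone)
        simpa using hgb 0 ⟨le_rfl, hc.le⟩ 0
      calc _ ≤ ‖g (x + y * Complex.I) - g 0‖ := div_le_self (norm_nonneg _) hw1
        _ ≤ 2 * (C₀ * (2 + ‖s‖) ^ 2) * (1 + |y|) ^ 2 := by
          have := hgb x hx y
          linarith [norm_sub_le (g (x + y * Complex.I)) (g 0)]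
        _ ≤ _ := by gcongr; rw [hD]; linarith [abs_nonneg C₁]
  obtain ⟨C₂, hC₂, hgauss⟩ := exists_pow_mul_exp_le_div 2 0 one_pos
  have hexpc : ∀ x ∈ Set.Icc (0:ℝ) c, ∀ y : ℝ, ‖Complex.exp ((x + y * Complex.I) ^ 2)‖ ≤
      Real.exp 1 * Real.exp (0 * |y| - 1 * y ^ 2) := by
    intro x hx y
    rw [norm_cexp_sq, ← Real.exp_add, Real.exp_le_exp]
    nlinarith [hx.1, hx.2]
  have hshift := integral_line_eq_of_differentiableOn (a := 0) (b := c) (C := Real.exp 1 * D * C₂)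
    (f := fun w => Complex.exp (w ^ 2) * dslope g 0 w) hc.le
    (Differentiable.differentiableOn (by fun_prop)) (by
      intro x hx y
      rw [norm_mul]
      calc _ ≤ Real.exp 1 * Real.exp (0 * |y| - 1 * y ^ 2) * (D * (1 + |y|) ^ 2) := by
            gcongr
            · exact hexpc x hx y
            · exact hdb x hx y
        _ = Real.exp 1 * D * ((1 + |y|) ^ 2 * Real.exp (0 * |y| - 1 * y ^ 2)) := by ring
        _ ≤ Real.exp 1 * D * (C₂ / (1 + y ^ 2)) := by gcongr; exact hgauss y
        _ = _ := by ring)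
  have hg0 : g 0 = (XiF t : ℝ) := by simp only [hg, add_zero, hs]; exact xi_line_zero t
  have hleft : (∫ y : ℝ, Complex.exp (((0:ℝ) + y * Complex.I) ^ 2) *
      dslope g 0 ((0:ℝ) + y * Complex.I)).re = 0 := by
    have hintgr : Integrable fun y : ℝ => Complex.exp (((0:ℝ) + y * Complex.I) ^ 2) *
        dslope g 0 ((0:ℝ) + y * Complex.I) := by
      refine ((integrable_pow_mul_exp 2 0 one_pos).const_mul (Real.exp 1 * D)).mono'
        (Continuous.aestronglyMeasurable ?_) (ae_of_all _ fun y => ?_)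
      · have := hdd.continuous
        fun_prop
      · rw [norm_mul]
        calc _ ≤ Real.exp 1 * Real.exp (0 * |y| - 1 * y ^ 2) * (D * (1 + |y|) ^ 2) := by
              gcongr
              · exact hexpc 0 ⟨le_rfl, hc.le⟩ y
              · exact hdb 0 ⟨le_rfl, hc.le⟩ y
          _ = _ := by ring
    have hre : (∫ y : ℝ, Complex.exp (((0:ℝ) + y * Complex.I) ^ 2) *
        dslope g 0 ((0:ℝ) + y * Complex.I)).re =
        ∫ y : ℝ, (Complex.exp (((0:ℝ) + y * Complex.I) ^ 2) * dslope g 0 ((0:ℝ) + y * Complex.I)).re :=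
      (integral_re hintgr).symm
    rw [hre]
    refine integral_eq_zero_of_ae ?_
    have hne : ∀ᵐ y : ℝ, y ≠ 0 := by simp [ae_iff]
    filter_upwards [hne] with y hy
    have hw0 : (((0:ℝ) : ℂ) + y * Complex.I) ≠ 0 := by simp [hy]
    rw [dslope_of_ne _ hw0, slope_def_field, hg0, sub_zero]
    have h1 : g ((0:ℝ) + y * Complex.I) = (XiF (t + y) : ℝ) := by
      rw [← xi_line_zero]; simp only [hg, hs, line_eq]; push_cast; ring_nf
    have h2 : (((0:ℝ) : ℂ) + y * Complex.I) ^ 2 = ((-y ^ 2 : ℝ) : ℂ) := by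
      push_cast; linear_combination (y : ℂ) ^ 2 * Complex.I_sq
    rw [h1, h2, ← Complex.ofReal_exp, ← Complex.ofReal_sub, Complex.ofReal_zero, zero_add,
      div_mul_eq_div_div, ← Complex.ofReal_div, Complex.div_I, Complex.re_ofReal_mul]
    simp
  have hI1 := integrable_exp_sq_div hc
  have hI2 : Integrable fun y : ℝ => Complex.exp ((c + y * Complex.I) ^ 2) / (c + y * Complex.I) *
      g (c + y * Complex.I) := by
    refine ((integrable_pow_mul_exp 2 0 one_pos).const_mul
      (Real.exp 1 * (C₀ * (2 + ‖s‖) ^ 2) / c)).mono'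
      (Continuous.aestronglyMeasurable ?_) (ae_of_all _ fun y => ?_)
    · have := hgd.continuous
      exact Continuous.mul (Continuous.div (by fun_prop) (by fun_prop)
        fun y => add_mul_I_ne_zero hc.ne' y) (by fun_prop)
    · rw [norm_mul, norm_div]
      calc _ ≤ Real.exp 1 * Real.exp (0 * |y| - 1 * y ^ 2) / c *
              (C₀ * (2 + ‖s‖) ^ 2 * (1 + |y|) ^ 2) := by
            gcongr
            · exact hexpc c ⟨hc.le, le_rfl⟩ y
            · exact le_norm_add_mul_I hc.le y
            · exact hgb c ⟨hc.le, le_rfl⟩ y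
        _ = _ := by ring
  have hright : ∫ y : ℝ, Complex.exp ((c + y * Complex.I) ^ 2) * dslope g 0 (c + y * Complex.I) =
      (∫ y : ℝ, Complex.exp ((c + y * Complex.I) ^ 2) / (c + y * Complex.I) * g (c + y * Complex.I)) -
      (∫ y : ℝ, Complex.exp ((c + y * Complex.I) ^ 2) / (c + y * Complex.I)) * (XiF t : ℝ) := by
    rw [← integral_mul_const, ← integral_sub hI2 (hI1.mul_const _)]
    congr 1
    funext y
    have hw0 := add_mul_I_ne_zero hc.ne' y
    rw [dslope_of_ne _ hw0, slope_def_field, hg0, sub_zero]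
    ring
  have hkey := congrArg Complex.re hshift
  rw [hleft, hright, Complex.sub_re, Complex.re_mul_ofReal] at hkey
  have hk := half_le_re_integral_exp_sq_div hc hc'
  set κ := (∫ y : ℝ, Complex.exp ((c + y * Complex.I) ^ 2) / (c + y * Complex.I)).re
  have h3 : |κ * XiF t| ≤ ‖∫ y : ℝ, Complex.exp ((c + y * Complex.I) ^ 2) / (c + y * Complex.I) *
      g (c + y * Complex.I)‖ := by
    rw [← sub_eq_zero.1 hkey.symm]
    exact Complex.abs_re_le_norm _
  rw [abs_mul, abs_of_pos (by linarith)] at h3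
  have h4 : 1 / 2 * |XiF t| ≤ κ * |XiF t| := by gcongr
  linarith

/-- The kernel of the smoothed approximate functional equation. -/
noncomputable def afeKernel (w : ℂ) : ℂ := Complex.exp (w ^ 2 + Complex.I * Real.pi * w / 4) / w

lemma abs_xiReal_le {c : ℝ} (hc : 0 < c) (hc' : c ≤ 1 / 40) (t : ℝ) :
    |xiReal t| ≤ 2 * ‖∫ y : ℝ, afeKernel (c + y * Complex.I) * xiTwist (line 0 t + (c + y * Complex.I))‖ := by
  have h : ∀ y : ℝ, afeKernel (c + y * Complex.I) * xiTwist (line 0 t + (c + y * Complex.I)) =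
      -(Real.exp (Real.pi * t / 4) : ℝ) * (Complex.exp ((c + y * Complex.I) ^ 2) / (c + y * Complex.I) *
        xi (line 0 t + (c + y * Complex.I))) := by
    intro y
    rw [afeKernel, xiTwist, Complex.exp_add, Complex.ofReal_exp]
    generalize (c + y * Complex.I : ℂ) = w
    have h1 : -Complex.I * Real.pi * (line 0 t + w - 1 / 2) / 4 =
        ((Real.pi * t / 4 : ℝ) : ℂ) - Complex.I * Real.pi * w / 4 := by
      rw [line_eq]; push_cast; linear_combination -(Real.pi * t / 4 : ℂ) * Complex.I_sq
    rw [h1, Complex.exp_sub]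
    have := Complex.exp_ne_zero (Complex.I * Real.pi * w / 4)
    field_simp
  simp only [h]
  rw [integral_const_mul, norm_mul, norm_neg, Complex.norm_real, Real.norm_of_nonneg (Real.exp_pos _).le,
    xiReal, abs_mul, abs_neg, abs_of_pos (Real.exp_pos _)]
  have := mul_le_mul_of_nonneg_left (abs_XiF_le hc hc' t) (Real.exp_pos (Real.pi * t / 4)).le
  linarith

lemma norm_Gamma_le_Gamma_re {z : ℂ} (hz : 0 < z.re) : ‖Complex.Gamma z‖ ≤ Real.Gamma z.re := by
  rw [Complex.Gamma_eq_integral hz, Real.Gamma_eq_integral hz, Complex.GammaIntegral]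
  refine (norm_integral_le_integral_norm _).trans_eq (setIntegral_congr_fun measurableSet_Ioi fun x hx => ?_)
  have hx : 0 < x := hx
  rw [norm_mul, Complex.norm_real, Real.norm_of_nonneg (Real.exp_pos _).le,
    Complex.norm_cpow_eq_rpow_re_of_pos hx]
  simp

lemma norm_exp_twist_le (s : ℂ) :
    ‖Complex.exp (-Complex.I * Real.pi * (s - 1 / 2) / 4)‖ ≤ Real.exp |s.im| := by
  have h : (-Complex.I * Real.pi * (s - 1 / 2) / 4).re = Real.pi / 4 * s.im := by
    have h1 : -Complex.I * Real.pi * (s - 1 / 2) / 4 = ((Real.pi / 4 : ℝ) : ℂ) * (-Complex.I * (s - 1 / 2)) := by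
      push_cast; ring
    rw [h1, Complex.re_ofReal_mul]
    simp
  rw [Complex.norm_exp, Real.exp_le_exp, h]
  calc _ ≤ |Real.pi / 4 * s.im| := le_abs_self _
    _ = Real.pi / 4 * |s.im| := by rw [abs_mul, abs_of_pos (by positivity)]
    _ ≤ 1 * |s.im| := by gcongr; linarith [Real.pi_le_four]
    _ = _ := one_mul _

lemma norm_dirPoly_le (N : ℕ) {s : ℂ} (hs : 0 ≤ s.re) : ‖dirPoly N s‖ ≤ N := by
  refine (norm_sum_le_of_le (n := fun _ => 1) _ fun n hn => ?_).trans_eq (by simp)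
  have hn1 := (Finset.mem_Icc.1 hn).1
  rw [Complex.norm_natCast_cpow_of_pos hn1]
  exact Real.rpow_le_one_of_one_le_of_nonpos (by exact_mod_cast hn1) (by simpa using hs)

lemma differentiable_dirPoly (N : ℕ) : Differentiable ℂ (dirPoly N) := by
  intro s
  unfold dirPoly
  refine DifferentiableAt.fun_sum fun n hn => ?_
  have hn1 := (Finset.mem_Icc.1 hn).1
  have hn0 : (n : ℂ) ≠ 0 := by exact_mod_cast (by omega : n ≠ 0)
  exact DifferentiableAt.const_cpow (by fun_prop) (Or.inl hn0)

lemma differentiableAt_gammaWeight {s : ℂ} (hs : 0 < s.re) : DifferentiableAt ℂ gammaWeight s := by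
  have h1 : DifferentiableAt ℂ (fun s : ℂ => Complex.Gamma (s / 2 + 1)) s := by
    refine DifferentiableAt.comp s (Complex.differentiableAt_Gamma _ fun m hm => ?_) (by fun_prop)
    have := congrArg Complex.re hm
    simp at this
    linarith [(Nat.cast_nonneg m : (0:ℝ) ≤ m)]
  have h2 : DifferentiableAt ℂ (fun s : ℂ => (Real.pi : ℂ) ^ (-s / 2)) s :=
    DifferentiableAt.const_cpow (by fun_prop) (Or.inl (by exact_mod_cast Real.pi_ne_zero))
  unfold gammaWeight
  fun_prop

lemma norm_le_exp_abs_im {s : ℂ} {b : ℝ} (hb : |s.re| ≤ b) : 1 + ‖s‖ ≤ (1 + b) * Real.exp |s.im| := by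
  have h1 := Complex.norm_le_abs_re_add_abs_im s
  have h2 := Real.add_one_le_exp |s.im|
  have h3 : 0 ≤ b := (abs_nonneg _).trans hb
  nlinarith [abs_nonneg s.im]

lemma exists_norm_xiTwist_le (b : ℝ) : ∃ C : ℝ, 0 < C ∧ ∀ s : ℂ, s.re ∈ Set.Icc (1 / 2) b →
    ‖xiTwist s‖ ≤ C * Real.exp (4 * |s.im|) := by
  obtain ⟨C, hC, h⟩ := exists_norm_xi_le (1 / 2) b
  refine ⟨C * (1 + |b|) ^ 2, by positivity, fun s hs => ?_⟩
  have hb : |s.re| ≤ |b| := by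
    have := hs.1
    rw [abs_of_nonneg (by linarith)]; exact hs.2.trans (le_abs_self _)
  rw [xiTwist, norm_mul, norm_neg]
  calc _ ≤ Real.exp |s.im| * (C * ((1 + |b|) * Real.exp |s.im|) ^ 2) := by
        gcongr
        · exact norm_exp_twist_le s
        · exact (h s hs).trans (by gcongr; exact norm_le_exp_abs_im hb)
    _ = C * (1 + |b|) ^ 2 * Real.exp (3 * |s.im|) := by
        have : Real.exp (3 * |s.im|) = Real.exp |s.im| ^ 3 := by rw [← Real.exp_nat_mul]; norm_num
        rw [this]; ring
    _ ≤ _ := by gcongr; norm_num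

lemma exists_norm_gammaWeight_le_exp (b : ℝ) : ∃ C : ℝ, 0 < C ∧ ∀ s : ℂ, s.re ∈ Set.Icc (1 / 2) b →
    ‖gammaWeight s‖ ≤ C * Real.exp (4 * |s.im|) := by
  obtain ⟨C, hC⟩ := (isCompact_Icc (a := (5 / 4 : ℝ)) (b := b / 2 + 1)).exists_bound_of_continuousOn
    (f := Real.Gamma) (fun x hx => (Real.differentiableAt_Gamma fun m hm => by
      have := hx.1; rw [hm] at this
      linarith [(Nat.cast_nonneg m : (0:ℝ) ≤ m)]).continuousAt.continuousWithinAt)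
  refine ⟨(1 + |b|) * (|C| + 1), by positivity, fun s hs => ?_⟩
  have hs1 := hs.1
  have hb : |s.re| ≤ |b| := by
    rw [abs_of_nonneg (by linarith)]; exact hs.2.trans (le_abs_self _)
  have hre : (s / 2 + 1).re = s.re / 2 + 1 := by simp
  have hG : ‖Complex.Gamma (s / 2 + 1)‖ ≤ |C| + 1 := by
    refine (norm_Gamma_le_Gamma_re (by rw [hre]; linarith)).trans ?_
    have := hC (s.re / 2 + 1) ⟨by linarith, by linarith [hs.2]⟩
    rw [hre]
    linarith [(le_abs_self _).trans this, le_abs_self C]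
  have hpi : ‖(Real.pi : ℂ) ^ (-s / 2)‖ ≤ 1 := by
    rw [Complex.norm_cpow_eq_rpow_re_of_pos Real.pi_pos]
    refine Real.rpow_le_one_of_one_le_of_nonpos (by linarith [Real.pi_gt_three]) ?_
    simp; linarith
  have hs' : ‖s - 1‖ ≤ (1 + |b|) * Real.exp |s.im| := by
    refine (norm_sub_le _ _).trans ?_
    rw [norm_one, add_comm]; exact norm_le_exp_abs_im hb
  rw [gammaWeight, norm_mul, norm_neg, norm_mul, norm_mul]
  calc _ ≤ Real.exp |s.im| * ((1 + |b|) * Real.exp |s.im| * 1 * (|C| + 1)) := by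
        gcongr
        exact norm_exp_twist_le s
    _ = (1 + |b|) * (|C| + 1) * Real.exp (2 * |s.im|) := by rw [two_mul, Real.exp_add]; ring
    _ ≤ _ := by gcongr; norm_num

/-- The error in replacing `ζ` by `dirPoly N`, with the gamma factor attached. -/
noncomputable def zetaRem (N : ℕ) (s : ℂ) : ℂ := xiTwist s - gammaWeight s * dirPoly N s

lemma exists_norm_zetaRem_line_le {k : ℕ} (hk : 1 ≤ k) : ∃ C : ℝ, 0 < C ∧ ∀ N : ℕ, 1 ≤ N → ∀ u : ℝ,
    ‖zetaRem N (line (2 * k) u)‖ ≤ C * (1 + |u|) ^ (k + 2) * (N : ℝ) ^ (3 / 2 - 2 * k : ℝ) := by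
  obtain ⟨C, hC, h⟩ := norm_gammaWeight_even_le k
  refine ⟨C * 2, by positivity, fun N hN u => ?_⟩
  have hk' : (1:ℝ) ≤ k := by exact_mod_cast hk
  have hre : 2 ≤ (line (2 * k) u).re := by simp; linarith
  have hne : line (2 * k) u ≠ 1 := fun h => by rw [h] at hre; norm_num at hre
  rw [zetaRem, xiTwist_eq_mul (by linarith) hne, ← mul_sub, norm_mul]
  have h2 := norm_riemannZeta_sub_dirPoly_le hN hre
  calc _ ≤ C * (1 + |u|) ^ (k + 2) * (2 * (N : ℝ) ^ (2 - (line (2 * k) u).re)) := by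
        gcongr
        exact h u
    _ = _ := by
        rw [line_re, show (2 - (1 / 2 + 2 * k) : ℝ) = 3 / 2 - 2 * k by ring]; ring

lemma line_zero_add (t x y : ℝ) : line 0 t + (x + y * Complex.I) = line x (t + y) := by
  rw [line_eq, line_eq]; push_cast; ring

/-- Splitting off `dirPoly N` on one line and moving the remainder to a line further right. -/
lemma integral_mul_xiTwist_eq {φ : ℂ → ℂ} {a b M c β : ℝ} (ha : 0 ≤ a) (hab : a ≤ b) (hβ : 0 < β)
    (hφ : DifferentiableOn ℂ φ {z | z.re ∈ Set.Icc a b})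
    (hM : ∀ x ∈ Set.Icc a b, ∀ y : ℝ, ‖φ (x + y * Complex.I)‖ ≤ M * Real.exp (c * |y| - β * y ^ 2))
    (N : ℕ) (t : ℝ) :
    ∫ y : ℝ, φ (a + y * Complex.I) * xiTwist (line a (t + y)) =
      (∫ y : ℝ, φ (a + y * Complex.I) * (gammaWeight (line a (t + y)) * dirPoly N (line a (t + y)))) +
        ∫ y : ℝ, φ (b + y * Complex.I) * zetaRem N (line b (t + y)) := by
  obtain ⟨C₁, hC₁, h1⟩ := exists_norm_xiTwist_le (1 / 2 + b)
  obtain ⟨C₂, hC₂, h2⟩ := exists_norm_gammaWeight_le_exp (1 / 2 + b)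
  have hcoer : ∀ x ∈ Set.Icc a b, ∀ y : ℝ, Real.exp (4 * |(line x (t + y)).im|) ≤
      Real.exp (4 * |t|) * Real.exp (4 * |y|) := fun x _ y => by
    rw [line_im, ← Real.exp_add, ← mul_add]; gcongr; exact abs_add_le _ _
  have hre : ∀ x ∈ Set.Icc a b, ∀ y : ℝ, (line x (t + y)).re ∈ Set.Icc (1 / 2) (1 / 2 + b) :=
    fun x hx y => by rw [line_re]; exact ⟨by linarith [hx.1], by linarith [hx.2]⟩
  have hM0 : 0 ≤ M := by
    have := (norm_nonneg _).trans (hM a ⟨le_rfl, hab⟩ 0)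
    exact nonneg_of_mul_nonneg_left this (Real.exp_pos _)
  have hD : ∀ x ∈ Set.Icc a b, ∀ y : ℝ,
      ‖φ (x + y * Complex.I) * (gammaWeight (line x (t + y)) * dirPoly N (line x (t + y)))‖ ≤
      M * (C₂ * N) * Real.exp (4 * |t|) * ((1 + |y|) ^ 0 * Real.exp ((c + 4) * |y| - β * y ^ 2)) := by
    intro x hx y
    rw [norm_mul, norm_mul]
    have hr := hre x hx y
    calc _ ≤ M * Real.exp (c * |y| - β * y ^ 2) *
          (C₂ * (Real.exp (4 * |t|) * Real.exp (4 * |y|)) * N) := by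
          gcongr
          · exact hM x hx y
          · exact (h2 _ hr).trans (by gcongr; exact hcoer x hx y)
          · exact norm_dirPoly_le N (by linarith [hr.1])
      _ = _ := by
          rw [show (c + 4) * |y| - β * y ^ 2 = c * |y| - β * y ^ 2 + 4 * |y| by ring, Real.exp_add]; ring
  have hX : ∀ x ∈ Set.Icc a b, ∀ y : ℝ, ‖φ (x + y * Complex.I) * xiTwist (line x (t + y))‖ ≤
      M * C₁ * Real.exp (4 * |t|) * ((1 + |y|) ^ 0 * Real.exp ((c + 4) * |y| - β * y ^ 2)) := by
    intro x hx y
    rw [norm_mul]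
    have hr := hre x hx y
    calc _ ≤ M * Real.exp (c * |y| - β * y ^ 2) *
          (C₁ * (Real.exp (4 * |t|) * Real.exp (4 * |y|))) := by
          gcongr
          · exact hM x hx y
          · exact (h1 _ hr).trans (by gcongr; exact hcoer x hx y)
      _ = _ := by
          rw [show (c + 4) * |y| - β * y ^ 2 = c * |y| - β * y ^ 2 + 4 * |y| by ring, Real.exp_add]; ring
  have hline : ∀ x : ℝ, Continuous fun y : ℝ => line x (t + y) := fun x => by
    simp only [line_eq]; fun_prop
  have hφc : Continuous fun y : ℝ => φ (a + y * Complex.I) :=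
    hφ.continuousOn.comp_continuous (by fun_prop) fun y => by simpa using hab
  have hgc : Continuous fun y : ℝ => gammaWeight (line a (t + y)) := by
    rw [continuous_iff_continuousAt]
    intro y
    exact (differentiableAt_gammaWeight (by simp; linarith)).continuousAt.comp (hline a).continuousAt
  have hdc : Continuous fun y : ℝ => dirPoly N (line a (t + y)) :=
    (differentiable_dirPoly N).continuous.comp (hline a)
  have hxc : Continuous fun y : ℝ => xiTwist (line a (t + y)) :=
    differentiable_xiTwist.continuous.comp (hline a)
  have haI : a ∈ Set.Icc a b := ⟨le_rfl, hab⟩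
  have hiD : Integrable fun y : ℝ => φ (a + y * Complex.I) *
      (gammaWeight (line a (t + y)) * dirPoly N (line a (t + y))) :=
    ((integrable_pow_mul_exp 0 (c + 4) hβ).const_mul _).mono'
      (hφc.mul (hgc.mul hdc)).aestronglyMeasurable (ae_of_all _ fun y => hD a haI y)
  have hiX : Integrable fun y : ℝ => φ (a + y * Complex.I) * xiTwist (line a (t + y)) :=
    ((integrable_pow_mul_exp 0 (c + 4) hβ).const_mul _).mono'
      (hφc.mul hxc).aestronglyMeasurable (ae_of_all _ fun y => hX a haI y)
  obtain ⟨C₃, hC₃, h3⟩ := exists_pow_mul_exp_le_div 0 (c + 4) hβ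
  have hshift := integral_line_eq_of_differentiableOn
    (f := fun w => φ w * zetaRem N (line 0 t + w)) (a := a) (b := b)
    (C := (M * C₁ * Real.exp (4 * |t|) + M * (C₂ * N) * Real.exp (4 * |t|)) * C₃) hab ?_ ?_
  · simp only [line_zero_add] at hshift
    rw [← hshift, ← sub_eq_iff_eq_add', ← integral_sub hiX hiD]
    congr 1
    funext y
    rw [zetaRem]; ring
  · refine hφ.mul fun w hw => DifferentiableAt.differentiableWithinAt ?_
    have hw' : 0 < (line 0 t + w).re := by
      have := hw.1; simp; linarith
    have h4 := differentiableAt_gammaWeight hw'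
    have h5 : DifferentiableAt ℂ (fun w => line 0 t + w) w := by fun_prop
    have h6 : DifferentiableAt ℂ (zetaRem N) (line 0 t + w) :=
      (differentiable_xiTwist _).sub (h4.mul (differentiable_dirPoly N _))
    exact h6.comp w h5
  · intro x hx y
    rw [line_zero_add, zetaRem, mul_sub]
    refine (norm_sub_le _ _).trans ((add_le_add (hX x hx y) (hD x hx y)).trans ?_)
    rw [← add_mul, mul_div_assoc]
    gcongr
    exact h3 y

/-- Weighted Cauchy–Schwarz followed by Tonelli. -/
lemma lintegral_sq_lintegral_le {α β : Type*} [MeasurableSpace α] [MeasurableSpace β] {μ : Measure α}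
    {ν : Measure β} [SFinite μ] [SFinite ν] {k : β → ENNReal} {F : α → β → ENNReal} {B : β → ENNReal}
    (hk : Measurable k) (hF : Measurable (Function.uncurry F))
    (hB : ∀ᵐ v ∂ν, ∫⁻ t, F t v ^ 2 ∂μ ≤ B v) :
    ∫⁻ t, (∫⁻ v, k v * F t v ∂ν) ^ 2 ∂μ ≤ (∫⁻ v, k v ∂ν) * ∫⁻ v, k v * B v ∂ν := by
  have hFt : ∀ t, Measurable (F t) := fun t => hF.comp measurable_prodMk_left
  have hFv : ∀ v, Measurable fun t => F t v := fun v => hF.comp measurable_prodMk_right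
  have hcs : ∀ t, (∫⁻ v, k v * F t v ∂ν) ^ 2 ≤ (∫⁻ v, k v ∂ν) * ∫⁻ v, k v * F t v ^ 2 ∂ν := by
    intro t
    have h := ENNReal.lintegral_mul_le_Lp_mul_Lq ν Real.HolderConjugate.two_two
      (f := fun v => k v ^ (1 / 2 : ℝ)) (g := fun v => k v ^ (1 / 2 : ℝ) * F t v)
      (hk.pow_const _).aemeasurable ((hk.pow_const _).mul (hFt t)).aemeasurable
    have hhalf : ∀ x : ENNReal, x ^ (1 / 2 : ℝ) * x ^ (1 / 2 : ℝ) = x := fun x => by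
      rw [← ENNReal.rpow_add_of_nonneg _ _ (by norm_num) (by norm_num)]; norm_num
    have hsq : ∀ x : ENNReal, (x ^ (1 / 2 : ℝ)) ^ 2 = x := fun x => by rw [sq, hhalf]
    have e1 : ∀ v, ((fun v => k v ^ (1 / 2 : ℝ)) * fun v => k v ^ (1 / 2 : ℝ) * F t v) v = k v * F t v :=
      fun v => by simp only [Pi.mul_apply]; rw [← mul_assoc, hhalf]
    have e2 : ∀ v, (k v ^ (1 / 2 : ℝ) * F t v) ^ (2:ℝ) = k v * F t v ^ 2 := fun v => by
      rw [ENNReal.rpow_two, mul_pow, hsq]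
    have e3 : ∀ v, (k v ^ (1 / 2 : ℝ)) ^ (2:ℝ) = k v := fun v => by rw [ENNReal.rpow_two, hsq]
    simp only [e1, e2, e3] at h
    calc _ ≤ ((∫⁻ v, k v ∂ν) ^ (1 / 2 : ℝ) * (∫⁻ v, k v * F t v ^ 2 ∂ν) ^ (1 / 2 : ℝ)) ^ 2 := by gcongr
      _ = _ := by rw [mul_pow, hsq, hsq]
  calc _ ≤ ∫⁻ t, (∫⁻ v, k v ∂ν) * ∫⁻ v, k v * F t v ^ 2 ∂ν ∂μ := lintegral_mono hcs
    _ = (∫⁻ v, k v ∂ν) * ∫⁻ t, ∫⁻ v, k v * F t v ^ 2 ∂ν ∂μ := by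
      refine lintegral_const_mul _ (Measurable.lintegral_prod_right' (f := fun p : α × β =>
        k p.2 * F p.1 p.2 ^ 2) ?_)
      exact (hk.comp measurable_snd).mul (hF.pow_const 2)
    _ = (∫⁻ v, k v ∂ν) * ∫⁻ v, ∫⁻ t, k v * F t v ^ 2 ∂μ ∂ν := by
      rw [lintegral_lintegral_swap]
      exact ((hk.comp measurable_snd).mul (hF.pow_const 2)).aemeasurable
    _ ≤ _ := by
      gcongr 1
      refine lintegral_mono_ae ?_
      filter_upwards [hB] with v hv
      rw [lintegral_const_mul _ ((hFv v).pow_const 2)]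
      gcongr

lemma lintegral_enorm_sq_eq {E : Type*} [NormedAddCommGroup E] {f : ℝ → E} (hf : Continuous f)
    {A B : ℝ} (hAB : A ≤ B) :
    ∫⁻ t in Set.Ioc A B, ‖f t‖ₑ ^ 2 = ENNReal.ofReal (∫ t in A..B, ‖f t‖ ^ 2) := by
  have hc : Continuous fun t => ‖f t‖ ^ 2 := by fun_prop
  rw [intervalIntegral.integral_of_le hAB, ofReal_integral_eq_lintegral_ofReal
    ((intervalIntegrable_iff_integrableOn_Ioc_of_le hAB).1 (hc.intervalIntegrable _ _))
    (ae_of_all _ fun t => by positivity)]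
  refine lintegral_congr fun t => ?_
  rw [← ofReal_norm, ENNReal.ofReal_pow (norm_nonneg _)]

lemma norm_afeKernel_le (x y : ℝ) : ‖afeKernel (x + y * Complex.I)‖ ≤
    Real.exp (x ^ 2) * Real.exp (1 * |y| - 1 * y ^ 2) / ‖(x + y * Complex.I : ℂ)‖ := by
  rw [afeKernel, norm_div, Complex.norm_exp, ← Real.exp_add]
  gcongr
  have h : ((x + y * Complex.I) ^ 2 + Complex.I * Real.pi * (x + y * Complex.I) / 4 : ℂ).re =
      x ^ 2 - y ^ 2 - Real.pi / 4 * y := by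
    have h1 : ((x + y * Complex.I) ^ 2 + Complex.I * Real.pi * (x + y * Complex.I) / 4 : ℂ) =
        ((x ^ 2 - y ^ 2 - Real.pi / 4 * y : ℝ) : ℂ) +
          ((2 * x * y + Real.pi / 4 * x : ℝ) : ℂ) * Complex.I := by
      push_cast; linear_combination ((y : ℂ) ^ 2 + Real.pi / 4 * y) * Complex.I_sq
    rw [h1]
    simp only [Complex.add_re, Complex.re_ofReal_mul, Complex.I_re, Complex.ofReal_re, mul_zero, add_zero]
  rw [h]
  have h2 : -(Real.pi / 4 * y) ≤ 1 * |y| := by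
    calc _ ≤ |Real.pi / 4 * y| := neg_le_abs _
      _ = Real.pi / 4 * |y| := by rw [abs_mul, abs_of_pos (by positivity)]
      _ ≤ _ := by gcongr; linarith [Real.pi_le_four]
  linarith

lemma lintegral_inv_add_abs_le {c : ℝ} (hc : 0 < c) (hc1 : c ≤ 1) :
    ∫⁻ y in Set.Icc (-1:ℝ) 1, ENNReal.ofReal (c + |y|)⁻¹ ≤ ENNReal.ofReal (2 * (1 + Real.log (1 / c))) := by
  have hcont : Continuous fun y : ℝ => (c + |y|)⁻¹ :=
    Continuous.inv₀ (by fun_prop) fun y => by positivity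
  rw [← ofReal_integral_eq_lintegral_ofReal hcont.integrableOn_Icc (ae_of_all _ fun y => by positivity)]
  refine ENNReal.ofReal_le_ofReal ?_
  have h1 : ∫ y in (0:ℝ)..1, (c + |y|)⁻¹ = Real.log ((c + 1) / c) := by
    rw [intervalIntegral.integral_congr (g := fun y => (c + y)⁻¹),
      intervalIntegral.integral_comp_add_left (fun x => x⁻¹), add_zero,
      integral_inv_of_pos hc (by linarith)]
    intro y hy
    rw [Set.uIcc_of_le zero_le_one] at hy
    simp only [abs_of_nonneg hy.1]
  have h2 : ∫ y in (-1:ℝ)..0, (c + |y|)⁻¹ = ∫ y in (0:ℝ)..1, (c + |y|)⁻¹ := by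
    have := intervalIntegral.integral_comp_neg (fun y : ℝ => (c + |y|)⁻¹) (a := 0) (b := 1)
    simpa using this.symm
  rw [integral_Icc_eq_integral_Ioc, ← intervalIntegral.integral_of_le (by norm_num),
    ← intervalIntegral.integral_add_adjacent_intervals (b := 0) (hcont.intervalIntegrable _ _)
      (hcont.intervalIntegrable _ _), h2, h1, ← two_mul]
  have h3 : Real.log ((c + 1) / c) ≤ 1 + Real.log (1 / c) := by
    rw [Real.log_div (by positivity) hc.ne', Real.log_div one_ne_zero hc.ne', Real.log_one]
    linarith [Real.log_le_sub_one_of_pos (by linarith : 0 < c + 1)]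
  linarith

lemma exists_lintegral_afeKernel_le (p : ℕ) : ∃ C : ℝ, 0 < C ∧ ∀ c : ℝ, 0 < c → c ≤ 1 →
    ∫⁻ y : ℝ, ENNReal.ofReal (‖afeKernel (c + y * Complex.I)‖ * (1 + |y|) ^ p) ≤
      ENNReal.ofReal (C * (1 + Real.log (1 / c))) := by
  obtain ⟨C₁, hC₁, h1⟩ := exists_pow_mul_exp_le p 1 one_pos
  have hintgr := integrable_pow_mul_exp p 1 one_pos
  set J := ∫ y : ℝ, (1 + |y|) ^ p * Real.exp (1 * |y| - 1 * y ^ 2) with hJ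
  have hJ0 : 0 ≤ J := integral_nonneg fun y => by positivity
  refine ⟨Real.exp 1 * (2 * C₁ * 2 + 2 * J), by positivity, fun c hc hc1 => ?_⟩
  have hlog : 0 ≤ Real.log (1 / c) := Real.log_nonneg ((one_le_div hc).2 hc1)
  have hpt : ∀ y : ℝ, ‖afeKernel (c + y * Complex.I)‖ * (1 + |y|) ^ p ≤
      Real.exp 1 * (2 * C₁ * (Set.Icc (-1:ℝ) 1).indicator (fun y => (c + |y|)⁻¹) y +
        2 * ((1 + |y|) ^ p * Real.exp (1 * |y| - 1 * y ^ 2))) := by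
    intro y
    have hw : (c + |y|) / 2 ≤ ‖(c + y * Complex.I : ℂ)‖ := by
      have ha := Complex.abs_re_le_norm (c + y * Complex.I : ℂ)
      have hb := Complex.abs_im_le_norm (c + y * Complex.I : ℂ)
      simp [abs_of_pos hc] at ha hb
      linarith
    have hcy : 0 < c + |y| := by positivity
    have hE : Real.exp (c ^ 2) ≤ Real.exp 1 := Real.exp_le_exp.2 (by nlinarith)
    calc _ ≤ Real.exp (c ^ 2) * Real.exp (1 * |y| - 1 * y ^ 2) / ‖(c + y * Complex.I : ℂ)‖ *
            (1 + |y|) ^ p := by gcongr; exact norm_afeKernel_le c y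
      _ ≤ Real.exp 1 * Real.exp (1 * |y| - 1 * y ^ 2) / ((c + |y|) / 2) * (1 + |y|) ^ p := by gcongr
      _ = Real.exp 1 * (2 * ((1 + |y|) ^ p * Real.exp (1 * |y| - 1 * y ^ 2) * (c + |y|)⁻¹)) := by
        field_simp
      _ ≤ _ := by
        gcongr
        by_cases hy : y ∈ Set.Icc (-1:ℝ) 1
        · rw [Set.indicator_of_mem hy]
          have : (1 + |y|) ^ p * Real.exp (1 * |y| - 1 * y ^ 2) * (c + |y|)⁻¹ ≤ C₁ * (c + |y|)⁻¹ := by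
            gcongr; exact h1 y
          have h0 : 0 ≤ 2 * ((1 + |y|) ^ p * Real.exp (1 * |y| - 1 * y ^ 2)) := by positivity
          linarith
        · rw [Set.indicator_of_notMem hy, mul_zero, zero_add]
          have hy1 : 1 ≤ |y| := by
            by_contra! hcon
            exact hy ⟨(abs_lt.1 hcon).1.le, (abs_lt.1 hcon).2.le⟩
          have : (c + |y|)⁻¹ ≤ 1 := inv_le_one_of_one_le₀ (by linarith)
          exact mul_le_mul_of_nonneg_left (mul_le_of_le_one_right (by positivity) this) two_pos.le
  have hmeas : Measurable fun y : ℝ => (c + |y|)⁻¹ := by fun_prop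
  calc _ ≤ ∫⁻ y : ℝ, ENNReal.ofReal (Real.exp 1) * (ENNReal.ofReal (2 * C₁) *
        (Set.Icc (-1:ℝ) 1).indicator (fun y => ENNReal.ofReal (c + |y|)⁻¹) y +
        ENNReal.ofReal (2 * ((1 + |y|) ^ p * Real.exp (1 * |y| - 1 * y ^ 2)))) := by
        refine lintegral_mono fun y => (ENNReal.ofReal_le_ofReal (hpt y)).trans_eq ?_
        have hi : 0 ≤ (Set.Icc (-1:ℝ) 1).indicator (fun y => (c + |y|)⁻¹) y :=
          Set.indicator_nonneg (fun y _ => by positivity) y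
        rw [ENNReal.ofReal_mul (by positivity), ENNReal.ofReal_add (by positivity) (by positivity),
          ENNReal.ofReal_mul (by positivity : 0 ≤ 2 * C₁)]
        congr 3
        by_cases hy : y ∈ Set.Icc (-1:ℝ) 1
        · simp [Set.indicator_of_mem hy]
        · simp [Set.indicator_of_notMem hy]
    _ = ENNReal.ofReal (Real.exp 1) * (ENNReal.ofReal (2 * C₁) *
          (∫⁻ y in Set.Icc (-1:ℝ) 1, ENNReal.ofReal (c + |y|)⁻¹) + ENNReal.ofReal (2 * J)) := by
        have hm1 : Measurable ((Set.Icc (-1:ℝ) 1).indicator (fun y => ENNReal.ofReal (c + |y|)⁻¹)) :=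
          hmeas.ennreal_ofReal.indicator measurableSet_Icc
        rw [lintegral_const_mul _ (by fun_prop), lintegral_add_left (by fun_prop),
          lintegral_const_mul _ hm1, lintegral_indicator measurableSet_Icc,
          ← ofReal_integral_eq_lintegral_ofReal (hintgr.const_mul 2) (ae_of_all _ fun y => by positivity),
          integral_const_mul]
    _ ≤ ENNReal.ofReal (Real.exp 1) * (ENNReal.ofReal (2 * C₁) *
          ENNReal.ofReal (2 * (1 + Real.log (1 / c))) + ENNReal.ofReal (2 * J)) := by
        gcongr
        exact lintegral_inv_add_abs_le hc hc1
    _ ≤ _ := by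
        rw [← ENNReal.ofReal_mul (by positivity), ← ENNReal.ofReal_add (by positivity) (by positivity),
          ← ENNReal.ofReal_mul (by positivity)]
        refine ENNReal.ofReal_le_ofReal ?_
        rw [mul_assoc (Real.exp 1)]
        refine mul_le_mul_of_nonneg_left ?_ (Real.exp_pos _).le
        nlinarith [mul_nonneg hJ0 hlog]

lemma enorm_xiReal_le {c : ℝ} (hc : 0 < c) (hc' : c ≤ 1 / 40) {k : ℕ} (hk : 1 ≤ k) (N : ℕ) (u : ℝ) :
    ‖xiReal u‖ₑ ≤ 2 * ((∫⁻ y : ℝ, ‖afeKernel (c + y * Complex.I)‖ₑ *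
        ‖gammaWeight (line c (u + y)) * dirPoly N (line c (u + y))‖ₑ) +
      ∫⁻ y : ℝ, ‖afeKernel ((2 * k : ℝ) + y * Complex.I)‖ₑ * ‖zetaRem N (line (2 * k) (u + y))‖ₑ) := by
  have hk' : (1:ℝ) ≤ k := by exact_mod_cast hk
  have hcb : c ≤ 2 * k := by linarith
  have h := abs_xiReal_le hc hc' u
  simp only [line_zero_add] at h
  rw [integral_mul_xiTwist_eq (b := 2 * k) (M := Real.exp ((2 * k : ℝ) ^ 2) / c) (c := 1) (β := 1)
    hc.le hcb one_pos ?_ ?_ N u] at h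
  · have h2 : ‖xiReal u‖ₑ ≤ ENNReal.ofReal (2 * ‖(∫ y : ℝ, afeKernel (c + y * Complex.I) *
        (gammaWeight (line c (u + y)) * dirPoly N (line c (u + y)))) +
        ∫ y : ℝ, afeKernel ((2 * k : ℝ) + y * Complex.I) * zetaRem N (line (2 * k) (u + y))‖) := by
      rw [← ofReal_norm]; exact ENNReal.ofReal_le_ofReal h
    rw [ENNReal.ofReal_mul two_pos.le, ofReal_norm, ENNReal.ofReal_ofNat] at h2
    refine h2.trans ?_
    gcongr
    refine (enorm_add_le _ _).trans ?_
    gcongr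
    · exact (enorm_integral_le_lintegral_enorm _).trans_eq (by simp only [enorm_mul])
    · exact (enorm_integral_le_lintegral_enorm _).trans_eq (by simp only [enorm_mul])
  · intro z hz
    have hz0 : z ≠ 0 := fun h => by
      have := hz.1; rw [h] at this; simp at this; linarith
    unfold afeKernel
    exact (DifferentiableAt.div (by fun_prop) (by fun_prop) hz0).differentiableWithinAt
  · intro x hx y
    have hx0 : 0 < x := hc.trans_le hx.1
    refine (norm_afeKernel_le x y).trans ?_
    rw [div_mul_eq_mul_div]
    gcongr
    · exact hx.2
    · exact hx.1.trans (le_norm_add_mul_I hx0.le y)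

lemma powWeight_le_one {t : ℝ} (ht : 1 ≤ t) : powWeight t ≤ 1 := by
  rw [powWeight, div_le_one (by positivity)]
  have h1 : t ^ (1 / 4 : ℝ) ≤ t ^ (1:ℝ) := Real.rpow_le_rpow_of_exponent_le ht (by norm_num)
  rw [Real.rpow_one] at h1
  nlinarith

lemma continuous_line (σ : ℝ) : Continuous (line σ) := by
  have : line σ = fun u : ℝ => ((1 / 2 + σ : ℝ) : ℂ) + u * Complex.I := funext (line_eq σ)
  rw [this]; fun_prop

lemma continuous_gammaWeight_line {σ : ℝ} (hσ : 0 ≤ σ) : Continuous fun u => gammaWeight (line σ u) := by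
  rw [continuous_iff_continuousAt]
  intro u
  exact (differentiableAt_gammaWeight (by simp; linarith)).continuousAt.comp
    (continuous_line σ).continuousAt

lemma continuous_dirPoly_line (N : ℕ) (σ : ℝ) : Continuous fun u => dirPoly N (line σ u) :=
  (differentiable_dirPoly N).continuous.comp (continuous_line σ)

lemma ennreal_add_sq_le (a b : ENNReal) : (a + b) ^ 2 ≤ 2 * (a ^ 2 + b ^ 2) := by
  have h := ENNReal.rpow_add_le_mul_rpow_add_rpow a b (p := 2) (by norm_num)
  rwa [ENNReal.rpow_two, ENNReal.rpow_two, ENNReal.rpow_two,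
    show (2:ℝ) - 1 = 1 by norm_num, ENNReal.rpow_one] at h

/-- Size of the mean square of `dirPoly N` on a segment of length `U`. -/
noncomputable def polyMass (N : ℕ) (U : ℝ) : ℝ := (U + 8 * N) * (1 + Real.log N)

lemma polyMass_nonneg {N : ℕ} (hN : 1 ≤ N) {U : ℝ} (hU : 0 ≤ U) : 0 ≤ polyMass N U := by
  have : 0 ≤ Real.log N := Real.log_nonneg (by exact_mod_cast hN)
  unfold polyMass; positivity

lemma lintegral_dirPoly_sq_le (N : ℕ) {A B σ : ℝ} (hA : 0 < A) (hAB : A ≤ B) (hσ : 0 ≤ σ) (v : ℝ) :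
    ∫⁻ t in Set.Ioc A B, ‖dirPoly N (line σ (t + v))‖ₑ ^ 2 ≤ ENNReal.ofReal (polyMass N (B - A)) := by
  have hc : Continuous fun t => dirPoly N (line σ (t + v)) :=
    (continuous_dirPoly_line N σ).comp (by fun_prop)
  rw [lintegral_enorm_sq_eq hc hAB]
  exact ENNReal.ofReal_le_ofReal (integral_norm_dirPoly_sq_le N hA hAB hσ v)

/-- Size of the mean square of the shifted, normalised `xiReal`. -/
noncomputable def crudeMass (k N : ℕ) (c T T₁ : ℝ) : ℝ :=
  T₁ ^ c * (1 + Real.log (1 / c)) ^ 2 * polyMass N (T₁ - T) +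
    (T₁ - T) * (T₁ ^ (k + 2) * (N : ℝ) ^ (3 / 2 - 2 * k : ℝ)) ^ 2

lemma crudeMass_nonneg {k N : ℕ} (hN : 1 ≤ N) {c T T₁ : ℝ} (hT : 0 ≤ T) (hTT : T ≤ T₁) :
    0 ≤ crudeMass k N c T T₁ := by
  have h1 := polyMass_nonneg hN (sub_nonneg.2 hTT)
  have h2 := sub_nonneg.2 hTT
  have h3 := hT.trans hTT
  unfold crudeMass; positivity

set_option maxHeartbeats 400000 in
theorem exists_lintegral_xiReal_sq_le {k : ℕ} (hk : 1 ≤ k) : ∃ C : ℝ, 0 < C ∧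
    ∀ (T T₁ c x v : ℝ) (N : ℕ), 1 ≤ T → T ≤ T₁ → 0 < c → c ≤ 1 / 40 → 1 ≤ N → 0 ≤ x → x ≤ T →
    ∫⁻ t in Set.Ioc T T₁, ‖powWeight t * xiReal (t + x + v)‖ₑ ^ 2 ≤
      ENNReal.ofReal (C * (1 + |v|) ^ (2 * k + 4) * crudeMass k N c T T₁) := by
  obtain ⟨C₃, hC₃, h3⟩ := powWeight_mul_norm_gammaWeight_le
  obtain ⟨C₄, hC₄, h4⟩ := exists_norm_zetaRem_line_le hk
  obtain ⟨C₅, hC₅, h5⟩ := exists_lintegral_afeKernel_le 3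
  have hk' : (1:ℝ) ≤ k := by exact_mod_cast hk
  have hJint := integrable_pow_mul_exp (k + 2) 1 one_pos
  set J := ∫ y : ℝ, (1 + |y|) ^ (k + 2) * Real.exp (1 * |y| - 1 * y ^ 2) with hJ
  have hJ0 : 0 ≤ J := integral_nonneg fun y => by positivity
  set C₆ := Real.exp ((2 * k : ℝ) ^ 2) * (C₄ * 3 ^ (k + 2)) * J with hC₆
  have hC₆0 : 0 ≤ C₆ := by positivity
  refine ⟨8 * ((8 * C₃) ^ 2 * C₅ ^ 2 + C₆ ^ 2), by positivity,
    fun T T₁ c x v N hT hTT hc hc' hN hx hxT => ?_⟩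
  have hT₁ : 1 ≤ T₁ := hT.trans hTT
  have hNR : (1:ℝ) ≤ N := by exact_mod_cast hN
  have hN0 : (0:ℝ) < N := by linarith
  set A := 8 * C₃ * T₁ ^ (c / 2) * (1 + |v|) ^ 3 with hA
  have hA0 : 0 ≤ A := by positivity
  set q : ℝ → ENNReal := fun y => ENNReal.ofReal (‖afeKernel (c + y * Complex.I)‖ * (1 + |y|) ^ 3) with hq
  set R := C₆ * (T₁ ^ (k + 2) * (1 + |v|) ^ (k + 2) * (N : ℝ) ^ (3 / 2 - 2 * k : ℝ)) with hR
  have hR0 : 0 ≤ R := by positivity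
  have hpt : ∀ t ∈ Set.Ioc T T₁, ‖powWeight t * xiReal (t + x + v)‖ₑ ≤
      2 * (ENNReal.ofReal A * (∫⁻ y : ℝ, q y * ‖dirPoly N (line c (t + (x + v + y)))‖ₑ) +
        ENNReal.ofReal R) := by
    intro t ht
    have ht1 : 1 ≤ t := hT.trans ht.1.le
    have hr0 : 0 ≤ powWeight t := powWeight_nonneg (by linarith)
    have hr1 := powWeight_le_one ht1
    have hre : ‖powWeight t‖ₑ = ENNReal.ofReal (powWeight t) := Real.enorm_of_nonneg hr0
    have hxt : x ≤ t := hxT.trans ht.1.le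
    rw [enorm_mul, hre]
    calc _ ≤ ENNReal.ofReal (powWeight t) * (2 * ((∫⁻ y : ℝ, ‖afeKernel (c + y * Complex.I)‖ₑ *
            ‖gammaWeight (line c (t + x + v + y)) * dirPoly N (line c (t + x + v + y))‖ₑ) +
          ∫⁻ y : ℝ, ‖afeKernel ((2 * k : ℝ) + y * Complex.I)‖ₑ *
            ‖zetaRem N (line (2 * k) (t + x + v + y))‖ₑ)) := by
          gcongr
          exact enorm_xiReal_le hc hc' hk N _
      _ = 2 * ((∫⁻ y : ℝ, ENNReal.ofReal (powWeight t) * (‖afeKernel (c + y * Complex.I)‖ₑ *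
            ‖gammaWeight (line c (t + x + v + y)) * dirPoly N (line c (t + x + v + y))‖ₑ)) +
          ∫⁻ y : ℝ, ENNReal.ofReal (powWeight t) * (‖afeKernel ((2 * k : ℝ) + y * Complex.I)‖ₑ *
            ‖zetaRem N (line (2 * k) (t + x + v + y))‖ₑ)) := by
          rw [lintegral_const_mul' _ _ ENNReal.ofReal_ne_top, lintegral_const_mul' _ _ ENNReal.ofReal_ne_top]
          ring
      _ ≤ _ := by
          gcongr
          · rw [← lintegral_const_mul' _ _ ENNReal.ofReal_ne_top]
            refine lintegral_mono fun y => ?_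
            have hbd : powWeight t * ‖gammaWeight (line c (t + x + v + y))‖ ≤ A * (1 + |y|) ^ 3 := by
              have := h3 t ht1 c ⟨hc.le, by linarith⟩ (x + v + y)
              rw [show t + (x + v + y) = t + x + v + y by ring] at this
              refine this.trans ?_
              have hfr : 1 + |x + v + y| / t ≤ 2 * (1 + |v|) * (1 + |y|) := by
                have e1 : |x + v + y| ≤ t + |v| + |y| := by
                  refine (abs_add_three _ _ _).trans ?_
                  rw [abs_of_nonneg hx]; linarith
                have e2 : |x + v + y| / t ≤ 1 + |v| + |y| := by
                  rw [div_le_iff₀ (by linarith)]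
                  nlinarith [abs_nonneg v, abs_nonneg y]
                nlinarith [abs_nonneg v, abs_nonneg y, mul_nonneg (abs_nonneg v) (abs_nonneg y)]
              have ht2 : t ^ (c / 2) ≤ T₁ ^ (c / 2) :=
                Real.rpow_le_rpow (by linarith) ht.2 (by positivity)
              calc _ ≤ C₃ * T₁ ^ (c / 2) * (2 * (1 + |v|) * (1 + |y|)) ^ 3 := by gcongr
                _ = _ := by rw [hA]; ring
            rw [enorm_mul, ← ofReal_norm (afeKernel _), ← ofReal_norm (gammaWeight _),
              show t + (x + v + y) = t + x + v + y by ring]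
            simp only [hq]
            set κ := ‖afeKernel (c + y * Complex.I)‖
            have hκ : 0 ≤ κ := norm_nonneg _
            set g := ‖gammaWeight (line c (t + x + v + y))‖
            set d := ‖dirPoly N (line c (t + x + v + y))‖ₑ
            calc _ = ENNReal.ofReal (κ * (powWeight t * g)) * d := by
                  rw [ENNReal.ofReal_mul hκ, ENNReal.ofReal_mul hr0]; ring
              _ ≤ ENNReal.ofReal (κ * (A * (1 + |y|) ^ 3)) * d :=
                  mul_le_mul_left (ENNReal.ofReal_le_ofReal (mul_le_mul_of_nonneg_left hbd hκ)) _
              _ = _ := by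
                  rw [show κ * (A * (1 + |y|) ^ 3) = A * (κ * (1 + |y|) ^ 3) by ring,
                    ENNReal.ofReal_mul hA0, mul_assoc]
          · set Q := Real.exp ((2 * k : ℝ) ^ 2) * (C₄ * 3 ^ (k + 2)) *
              (T₁ ^ (k + 2) * (1 + |v|) ^ (k + 2) * (N : ℝ) ^ (3 / 2 - 2 * k : ℝ)) with hQ
            have hQJ : R = Q * J := by rw [hR, hQ, hC₆]; ring
            rw [hQJ, hJ, ← integral_const_mul, ofReal_integral_eq_lintegral_ofReal (hJint.const_mul _)
              (ae_of_all _ fun y => by positivity)]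
            refine lintegral_mono fun y => ?_
            rw [← ofReal_norm (afeKernel _), ← ofReal_norm (zetaRem _ _), ← ENNReal.ofReal_mul (norm_nonneg _),
              ← ENNReal.ofReal_mul hr0]
            refine ENNReal.ofReal_le_ofReal ?_
            have hz := h4 N hN (t + x + v + y)
            have hkn : ‖afeKernel ((2 * k : ℝ) + y * Complex.I)‖ ≤
                Real.exp ((2 * k : ℝ) ^ 2) * Real.exp (1 * |y| - 1 * y ^ 2) := by
              refine (norm_afeKernel_le _ y).trans (div_le_self (by positivity) ?_)
              exact le_trans (by linarith) (le_norm_add_mul_I (x := 2 * k) (by positivity) y)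
            have hsum : 1 + |t + x + v + y| ≤ 3 * T₁ * (1 + |v|) * (1 + |y|) := by
              have e1 : |t + x + v + y| ≤ 2 * T₁ + |v| + |y| := by
                have a1 := abs_add_le (t + x + v) y
                have a2 := abs_add_le (t + x) v
                have a3 : |t + x| ≤ 2 * T₁ := by
                  rw [abs_of_nonneg (by linarith)]; linarith [ht.2]
                linarith
              have e2 : 0 ≤ (T₁ - 1) * (|v| + |y| + |v| * |y|) :=
                mul_nonneg (by linarith) (by positivity)
              nlinarith [abs_nonneg v, abs_nonneg y, mul_nonneg (abs_nonneg v) (abs_nonneg y)]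
            calc _ ≤ 1 * (Real.exp ((2 * k : ℝ) ^ 2) * Real.exp (1 * |y| - 1 * y ^ 2) *
                  (C₄ * (3 * T₁ * (1 + |v|) * (1 + |y|)) ^ (k + 2) * (N : ℝ) ^ (3 / 2 - 2 * k : ℝ))) := by
                  gcongr
                  exact hz.trans (by gcongr)
              _ = _ := by rw [hQ, mul_pow, mul_pow, mul_pow]; ring
  have hqm : Measurable q := by
    have : Measurable fun y : ℝ => afeKernel (c + y * Complex.I) := by unfold afeKernel; fun_prop
    exact (this.norm.mul (by fun_prop)).ennreal_ofReal
  have hFm : Measurable (Function.uncurry fun t y : ℝ => ‖dirPoly N (line c (t + (x + v + y)))‖ₑ) := by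
    have : Continuous fun p : ℝ × ℝ => dirPoly N (line c (p.1 + (x + v + p.2))) :=
      (continuous_dirPoly_line N c).comp (by fun_prop)
    exact this.measurable.enorm
  have hms := lintegral_sq_lintegral_le (μ := volume.restrict (Set.Ioc T T₁)) (ν := (volume : Measure ℝ))
    (k := q) (B := fun _ => ENNReal.ofReal (polyMass N (T₁ - T))) hqm hFm
    (ae_of_all _ fun y => lintegral_dirPoly_sq_le N (by linarith) hTT hc.le _)
  have hq5 := h5 c hc (by linarith)
  rw [lintegral_mul_const _ hqm] at hms
  set ℓ := 1 + Real.log (1 / c) with hℓ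
  have hℓ0 : 0 ≤ ℓ := by
    have : 0 ≤ Real.log (1 / c) := Real.log_nonneg ((one_le_div hc).2 (by linarith))
    linarith
  have hpm := polyMass_nonneg hN (sub_nonneg.2 hTT)
  have hsqadd : ∀ a b : ENNReal, (2 * (a + b)) ^ 2 ≤ 8 * (a ^ 2 + b ^ 2) := by
    intro a b
    calc _ = 4 * (a + b) ^ 2 := by ring
      _ ≤ 4 * (2 * (a ^ 2 + b ^ 2)) := by gcongr; exact ennreal_add_sq_le a b
      _ = _ := by ring
  calc _ ≤ ∫⁻ t in Set.Ioc T T₁, 8 * (ENNReal.ofReal A ^ 2 *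
        (∫⁻ y : ℝ, q y * ‖dirPoly N (line c (t + (x + v + y)))‖ₑ) ^ 2 + ENNReal.ofReal R ^ 2) := by
        refine setLIntegral_mono' measurableSet_Ioc fun t ht => ?_
        refine (pow_le_pow_left' (hpt t ht) 2).trans ((hsqadd _ _).trans_eq ?_)
        rw [mul_pow]
    _ = 8 * (ENNReal.ofReal A ^ 2 * (∫⁻ t in Set.Ioc T T₁,
        (∫⁻ y : ℝ, q y * ‖dirPoly N (line c (t + (x + v + y)))‖ₑ) ^ 2) +
          ENNReal.ofReal R ^ 2 * ENNReal.ofReal (T₁ - T)) := by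
        rw [lintegral_const_mul' _ _ (by norm_num), lintegral_add_right _ measurable_const,
          lintegral_const_mul' _ _ (by finiteness), setLIntegral_const, Real.volume_Ioc]
    _ ≤ 8 * (ENNReal.ofReal A ^ 2 * (ENNReal.ofReal (C₅ * ℓ) *
          (ENNReal.ofReal (C₅ * ℓ) * ENNReal.ofReal (polyMass N (T₁ - T)))) +
          ENNReal.ofReal R ^ 2 * ENNReal.ofReal (T₁ - T)) := by
        gcongr
        exact hms.trans (by gcongr)
    _ = ENNReal.ofReal (8 * (A ^ 2 * (C₅ * ℓ * (C₅ * ℓ * polyMass N (T₁ - T))) + R ^ 2 * (T₁ - T))) := by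
        have hU : 0 ≤ T₁ - T := by linarith
        have h8 : ENNReal.ofReal 8 = 8 := ENNReal.ofReal_ofNat 8
        rw [← ENNReal.ofReal_pow hA0, ← ENNReal.ofReal_pow hR0, ← h8,
          ← ENNReal.ofReal_mul (mul_nonneg hC₅.le hℓ0), ← ENNReal.ofReal_mul (mul_nonneg hC₅.le hℓ0),
          ← ENNReal.ofReal_mul (sq_nonneg A), ← ENNReal.ofReal_mul (sq_nonneg R),
          ← ENNReal.ofReal_add (by positivity) (by positivity), ← ENNReal.ofReal_mul (by norm_num)]
    _ ≤ _ := by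
        refine ENNReal.ofReal_le_ofReal ?_
        have hv1 : 1 ≤ 1 + |v| := by linarith [abs_nonneg v]
        have hA2 : A ^ 2 ≤ (8 * C₃) ^ 2 * T₁ ^ c * (1 + |v|) ^ (2 * k + 4) := by
          have e1 : (T₁ ^ (c / 2)) ^ 2 = T₁ ^ c := by
            rw [← Real.rpow_natCast, ← Real.rpow_mul (by linarith)]; congr 1; push_cast; ring
          calc A ^ 2 = (8 * C₃) ^ 2 * (T₁ ^ (c / 2)) ^ 2 * (1 + |v|) ^ 6 := by rw [hA]; ring
            _ ≤ _ := by
              rw [e1]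
              gcongr
              omega
        have hR2 : R ^ 2 = C₆ ^ 2 * (1 + |v|) ^ (2 * k + 4) *
            (T₁ ^ (k + 2) * (N : ℝ) ^ (3 / 2 - 2 * k : ℝ)) ^ 2 := by
          rw [hR, show 2 * k + 4 = (k + 2) * 2 by ring, pow_mul (1 + |v|)]; ring
        have hU : 0 ≤ T₁ - T := by linarith
        rw [hR2, crudeMass]
        set V := (1 + |v|) ^ (2 * k + 4)
        set Z := (T₁ ^ (k + 2) * (N : ℝ) ^ (3 / 2 - 2 * k : ℝ)) ^ 2
        have hV : 0 ≤ V := by positivity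
        have hZ : 0 ≤ Z := by positivity
        have hP : 0 ≤ T₁ ^ c * ℓ ^ 2 * polyMass N (T₁ - T) := by positivity
        have hE : 0 ≤ C₅ * ℓ * (C₅ * ℓ * polyMass N (T₁ - T)) := by positivity
        have e1 := mul_le_mul_of_nonneg_right hA2 hE
        have e2 : 0 ≤ C₆ ^ 2 * (V * (T₁ ^ c * ℓ ^ 2 * polyMass N (T₁ - T))) := by positivity
        have e3 : 0 ≤ (8 * C₃) ^ 2 * C₅ ^ 2 * (V * ((T₁ - T) * Z)) := by positivity
        linarith

/-- The Gaussian density of standard deviation `Δ`. -/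
noncomputable def gauss (Δ v : ℝ) : ℝ :=
  Real.exp (-(1 / (2 * Δ ^ 2)) * v ^ 2) / (Δ * Real.sqrt (2 * Real.pi))

lemma gauss_pos {Δ : ℝ} (hΔ : 0 < Δ) (v : ℝ) : 0 < gauss Δ v := by
  have : 0 < Real.sqrt (2 * Real.pi) := Real.sqrt_pos.2 (by positivity)
  unfold gauss; positivity

lemma continuous_gauss (Δ : ℝ) : Continuous (gauss Δ) := by unfold gauss; fun_prop

lemma integral_gauss {Δ : ℝ} (hΔ : 0 < Δ) : ∫ v, gauss Δ v = 1 := by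
  simp only [gauss]
  rw [integral_div, integral_gaussian]
  have h : Real.pi / (1 / (2 * Δ ^ 2)) = Δ ^ 2 * (2 * Real.pi) := by field_simp
  rw [h, Real.sqrt_mul (by positivity), Real.sqrt_sq hΔ.le, div_self]
  have : 0 < Real.sqrt (2 * Real.pi) := Real.sqrt_pos.2 (by positivity)
  positivity

lemma integrable_gauss_mul_exp {Δ : ℝ} (hΔ : 0 < Δ) (p : ℕ) (c : ℝ) :
    Integrable fun v => gauss Δ v * ((1 + |v|) ^ p * Real.exp (c * |v|)) := by
  have h := (integrable_pow_mul_exp p c (b := 1 / (2 * Δ ^ 2)) (by positivity)).div_const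
    (Δ * Real.sqrt (2 * Real.pi))
  refine h.congr (ae_of_all _ fun v => ?_)
  simp only [gauss]
  rw [sub_eq_add_neg, Real.exp_add, neg_mul]
  ring

lemma integrable_gauss_smul {E : Type*} [NormedAddCommGroup E] [NormedSpace ℝ E] {Δ : ℝ} (hΔ : 0 < Δ)
    {f : ℝ → E} (hf : AEStronglyMeasurable f) {K c : ℝ} {p : ℕ}
    (h : ∀ v, ‖f v‖ ≤ K * ((1 + |v|) ^ p * Real.exp (c * |v|))) : Integrable fun v => gauss Δ v • f v := by
  refine ((integrable_gauss_mul_exp hΔ p c).const_mul K).mono'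
    ((continuous_gauss Δ).aestronglyMeasurable.smul hf) (ae_of_all _ fun v => ?_)
  rw [norm_smul, Real.norm_of_nonneg (gauss_pos hΔ v).le]
  calc _ ≤ gauss Δ v * (K * ((1 + |v|) ^ p * Real.exp (c * |v|))) :=
        mul_le_mul_of_nonneg_left (h v) (gauss_pos hΔ v).le
    _ = _ := by ring

lemma exists_lintegral_gauss_le (p : ℕ) : ∃ C : ℝ, 0 < C ∧ ∀ Δ, 0 < Δ → Δ ≤ 1 →
    ∫⁻ v, ENNReal.ofReal (gauss Δ v * (1 + |v|) ^ p) ≤ ENNReal.ofReal C ∧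
    ∫⁻ v, ENNReal.ofReal (gauss Δ v * (|v| * (1 + |v|) ^ p)) ≤ ENNReal.ofReal (C * Δ) := by
  have hscale : ∀ p : ℕ, ∀ Δ, 0 < Δ → ∫⁻ v, ENNReal.ofReal (gauss Δ v * (1 + |v / Δ|) ^ p) =
      ENNReal.ofReal (∫ v, gauss 1 v * (1 + |v|) ^ p) := by
    intro p Δ hΔ
    have hintgr : Integrable fun v => gauss 1 v * (1 + |v|) ^ p := by
      simpa using integrable_gauss_mul_exp one_pos p 0
    have hg : ∀ v, gauss Δ v * (1 + |v / Δ|) ^ p = Δ⁻¹ * (gauss 1 (v / Δ) * (1 + |v / Δ|) ^ p) := by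
      intro v
      simp only [gauss]
      rw [show -(1 / (2 * Δ ^ 2)) * v ^ 2 = -(1 / (2 * (1:ℝ) ^ 2)) * (v / Δ) ^ 2 by field_simp]
      field_simp
    simp only [hg]
    have hint2 := (hintgr.comp_div hΔ.ne').const_mul Δ⁻¹
    rw [← ofReal_integral_eq_lintegral_ofReal hint2
      (ae_of_all _ fun v => by have := gauss_pos one_pos (v / Δ); positivity), integral_const_mul,
      Measure.integral_comp_div (fun v => gauss 1 v * (1 + |v|) ^ p), abs_of_pos hΔ, smul_eq_mul,
      inv_mul_cancel_left₀ hΔ.ne']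
  set C := fun p : ℕ => ∫ v, gauss 1 v * (1 + |v|) ^ p
  have hC : ∀ p, 0 ≤ C p := fun p => integral_nonneg fun v => by
    have := gauss_pos one_pos v; positivity
  have hvd : ∀ {Δ v : ℝ}, 0 < Δ → Δ ≤ 1 → |v| ≤ |v / Δ| := fun {Δ v} h h' => by
    rw [abs_div, abs_of_pos h, le_div_iff₀ h]
    exact mul_le_of_le_one_right (abs_nonneg v) h'
  refine ⟨C p + C (p + 1) + 1, by linarith [hC p, hC (p + 1)], fun Δ hΔ hΔ' => ⟨?_, ?_⟩⟩
  · calc _ ≤ ∫⁻ v, ENNReal.ofReal (gauss Δ v * (1 + |v / Δ|) ^ p) := by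
          refine lintegral_mono fun v => ENNReal.ofReal_le_ofReal ?_
          have := gauss_pos hΔ v
          have := hvd (v := v) hΔ hΔ'
          gcongr
      _ ≤ _ := by
          rw [hscale p Δ hΔ]
          exact ENNReal.ofReal_le_ofReal (by linarith [hC (p + 1)])
  · calc _ ≤ ∫⁻ v, ENNReal.ofReal Δ * ENNReal.ofReal (gauss Δ v * (1 + |v / Δ|) ^ (p + 1)) := by
          refine lintegral_mono fun v => ?_
          rw [← ENNReal.ofReal_mul hΔ.le]
          refine ENNReal.ofReal_le_ofReal ?_
          have hg := gauss_pos hΔ v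
          have h1 := hvd (v := v) hΔ hΔ'
          have h2 : |v| ≤ Δ * (1 + |v / Δ|) := by
            rw [abs_div, abs_of_pos hΔ, mul_add, mul_div_cancel₀ _ hΔ.ne']; linarith
          calc _ ≤ gauss Δ v * (Δ * (1 + |v / Δ|) * (1 + |v / Δ|) ^ p) := by gcongr
            _ = _ := by ring
      _ ≤ _ := by
          rw [lintegral_const_mul' _ _ ENNReal.ofReal_ne_top, hscale (p + 1) Δ hΔ,
            ← ENNReal.ofReal_mul hΔ.le, mul_comm]
          exact ENNReal.ofReal_le_ofReal (by gcongr; linarith [hC p])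

lemma abs_powWeight_sub_le {t x : ℝ} (ht : 0 < t) (hx : 0 ≤ x) (hxt : x ≤ t) :
    |powWeight (t + x) - powWeight t| ≤ 3 * (x / t) * powWeight t := by
  have ht4 : 0 < t ^ (1 / 4 : ℝ) := by positivity
  have h1 : t ^ (1 / 4 : ℝ) ≤ (t + x) ^ (1 / 4 : ℝ) := Real.rpow_le_rpow ht.le (by linarith) (by norm_num)
  have h2 : (t + x) ^ (1 / 4 : ℝ) ≤ (1 + x / t) * t ^ (1 / 4 : ℝ) := by
    rw [show t + x = (1 + x / t) * t by field_simp, Real.mul_rpow (by positivity) ht.le]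
    gcongr
    have : 1 ≤ 1 + x / t := by linarith [div_nonneg hx ht.le]
    exact (Real.rpow_le_rpow_of_exponent_le this (by norm_num)).trans_eq (Real.rpow_one _)
  have hxt0 : 0 ≤ x / t := by positivity
  unfold powWeight
  rw [abs_le]
  constructor
  · have h3 : (1 - 3 * (x / t)) * (1 / 4 + (t + x) ^ 2) ≤ 1 / 4 + t ^ 2 := by
      have h4 : x = x / t * t := by field_simp
      have h5 : x / t ≤ 1 := (div_le_one ht).2 hxt
      set q := x / t
      rw [h4]
      nlinarith [mul_nonneg hxt0 (sq_nonneg t), mul_nonneg (mul_nonneg hxt0 hxt0) (sq_nonneg t),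
        mul_nonneg (mul_nonneg hxt0 (mul_nonneg hxt0 hxt0)) (sq_nonneg t)]
    have h6 : (1 - 3 * (x / t)) / (1 / 4 + t ^ 2) ≤ 1 / (1 / 4 + (t + x) ^ 2) := by
      rw [div_le_div_iff₀ (by positivity) (by positivity), one_mul]; exact h3
    have h7 : t ^ (1 / 4 : ℝ) * ((1 - 3 * (x / t)) / (1 / 4 + t ^ 2)) ≤
        (t + x) ^ (1 / 4 : ℝ) / (1 / 4 + (t + x) ^ 2) := by
      calc _ ≤ t ^ (1 / 4 : ℝ) * (1 / (1 / 4 + (t + x) ^ 2)) := by gcongr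
        _ ≤ (t + x) ^ (1 / 4 : ℝ) * (1 / (1 / 4 + (t + x) ^ 2)) := by gcongr
        _ = _ := by ring
    have h8 : t ^ (1 / 4 : ℝ) * ((1 - 3 * (x / t)) / (1 / 4 + t ^ 2)) =
      t ^ (1 / 4 : ℝ) / (1 / 4 + t ^ 2) - 3 * (x / t) * (t ^ (1 / 4 : ℝ) / (1 / 4 + t ^ 2)) := by ring
    linarith
  · have h3 : (t + x) ^ (1 / 4 : ℝ) / (1 / 4 + (t + x) ^ 2) ≤ (1 + x / t) * t ^ (1 / 4 : ℝ) / (1 / 4 + t ^ 2) := by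
      gcongr; linarith
    have h4 : 0 ≤ x / t * (t ^ (1 / 4 : ℝ) / (1 / 4 + t ^ 2)) := by positivity
    have h5 : (1 + x / t) * t ^ (1 / 4 : ℝ) / (1 / 4 + t ^ 2) = t ^ (1 / 4 : ℝ) / (1 / 4 + t ^ 2) +
      x / t * (t ^ (1 / 4 : ℝ) / (1 / 4 + t ^ 2)) := by ring
    linarith

lemma exists_abs_xiReal_le : ∃ C : ℝ, 0 < C ∧ ∀ u, |xiReal u| ≤ C * Real.exp (4 * |u|) := by
  obtain ⟨C, hC, h⟩ := exists_norm_xiTwist_le (1 / 2)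
  refine ⟨C, hC, fun u => ?_⟩
  have := h (line 0 u) (by simp)
  rwa [xiTwist_line_zero, Complex.norm_real, line_im] at this

lemma integral_xiReal_sub_shift (t H v : ℝ) :
    (∫ x in (0:ℝ)..H, xiReal (t + x)) - ∫ x in (0:ℝ)..H, xiReal (t + x + v) =
      v * ∫ θ in (0:ℝ)..1, (xiReal (t + θ * v) - xiReal (t + H + θ * v)) := by
  have hc := continuous_xiReal
  have hi : ∀ a b, IntervalIntegrable xiReal volume a b := fun a b => hc.intervalIntegrable a b
  have h1 : ∀ s, v * ∫ θ in (0:ℝ)..1, xiReal (s + θ * v) = ∫ u in s..(s + v), xiReal u := by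
    intro s
    have := intervalIntegral.mul_integral_comp_add_mul (f := xiReal) (a := 0) (b := 1) v s
    simpa [mul_comm v] using this
  have h2 : ∀ s, ∫ x in (0:ℝ)..H, xiReal (s + x) = ∫ u in s..(s + H), xiReal u := by
    intro s; simp [intervalIntegral.integral_comp_add_left (a := 0) (b := H) xiReal s]
  have h3 : ∫ x in (0:ℝ)..H, xiReal (t + x + v) = ∫ u in (t + v)..(t + v + H), xiReal u := by
    rw [← h2]; congr 1; ext x; congr 1; ring
  rw [intervalIntegral.integral_sub, mul_sub, h1, h1, h2, h3]
  · have e1 := intervalIntegral.integral_add_adjacent_intervals (hi t (t + v)) (hi (t + v) (t + v + H))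
    have e2 := intervalIntegral.integral_add_adjacent_intervals (hi t (t + H)) (hi (t + H) (t + H + v))
    rw [show t + v + H = t + H + v by ring] at e1 ⊢
    linarith
  · exact (hc.comp (by fun_prop)).intervalIntegrable _ _
  · exact (hc.comp (by fun_prop)).intervalIntegrable _ _

/-- Gaussian smoothing of the integral of `xiReal` over `[t, t + H]`. -/
noncomputable def smoothXi (Δ H t : ℝ) : ℝ := ∫ x in (0:ℝ)..H, ∫ v, gauss Δ v * xiReal (t + x + v)

lemma integrable_gauss_mul_xiReal {Δ : ℝ} (hΔ : 0 < Δ) (H t : ℝ) :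
    Integrable (Function.uncurry fun x v => gauss Δ v * xiReal (t + x + v))
      ((volume.restrict (Set.uIoc 0 H)).prod volume) := by
  obtain ⟨C, hC, hY⟩ := exists_abs_xiReal_le
  have : IsFiniteMeasure (volume.restrict (Set.uIoc 0 H)) := ⟨by simp [Set.uIoc]⟩
  have hb := (integrable_const (μ := volume.restrict (Set.uIoc 0 H))
    (C * Real.exp (4 * (|t| + |H|)))).mul_prod (integrable_gauss_mul_exp hΔ 0 4)
  refine hb.mono' ?_ ?_
  · refine Continuous.aestronglyMeasurable ?_
    have := (continuous_gauss Δ)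
    have := continuous_xiReal
    fun_prop
  · have : ∀ᵐ z : ℝ × ℝ ∂((volume.restrict (Set.uIoc 0 H)).prod volume), z.1 ∈ Set.uIoc 0 H :=
      Measure.quasiMeasurePreserving_fst.ae (ae_restrict_mem measurableSet_uIoc)
    filter_upwards [this] with z hz
    simp only [Function.uncurry]
    rw [norm_mul, Real.norm_of_nonneg (gauss_pos hΔ _).le, pow_zero, one_mul]
    have h1 : |z.1| ≤ |H| := by
      rcases Set.mem_uIoc.1 hz with h | h
      · rw [abs_of_pos h.1]; exact h.2.trans (le_abs_self _)
      · rw [abs_of_nonpos h.2]; linarith [neg_le_abs H, h.1]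
    have h2 : |t + z.1 + z.2| ≤ |t| + |H| + |z.2| := (abs_add_three _ _ _).trans (by linarith)
    calc _ ≤ gauss Δ z.2 * (C * Real.exp (4 * (|t| + |H| + |z.2|))) := by
          have := (gauss_pos hΔ z.2).le
          refine mul_le_mul_of_nonneg_left ((hY _).trans ?_) this
          gcongr
      _ = _ := by rw [mul_add 4 (|t| + |H|), Real.exp_add]; ring

lemma smoothXi_eq {Δ : ℝ} (hΔ : 0 < Δ) (H t : ℝ) :
    smoothXi Δ H t = ∫ v, gauss Δ v * ∫ x in (0:ℝ)..H, xiReal (t + x + v) := by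
  unfold smoothXi
  rw [intervalIntegral_integral_swap (integrable_gauss_mul_xiReal hΔ H t)]
  congr 1; ext v; exact intervalIntegral.integral_const_mul _ _

/-- Mean square of a superposition of shifted `xiReal`. -/
lemma lintegral_sq_shift_xiReal_le {k : ℕ} {C T T₁ c x M : ℝ} {N : ℕ}
    (hC : ∀ v, ∫⁻ t in Set.Ioc T T₁, ‖powWeight t * xiReal (t + x + v)‖ₑ ^ 2 ≤
      ENNReal.ofReal (C * (1 + |v|) ^ (2 * k + 4) * crudeMass k N c T T₁))
    (hcm : 0 ≤ C * crudeMass k N c T T₁) (hM : 0 ≤ M) {Δ : ℝ} (hΔ : 0 < Δ)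
    (hG : ∫⁻ v, ENNReal.ofReal (gauss Δ v * (|v| * (1 + |v|) ^ (2 * k + 4))) ≤ ENNReal.ofReal M) :
    ∫⁻ t in Set.Ioc T T₁, (∫⁻ v, ∫⁻ θ in Set.Ioc (0:ℝ) 1, ENNReal.ofReal (gauss Δ v * |v|) *
      ‖powWeight t * xiReal (t + x + θ * v)‖ₑ) ^ 2 ≤ ENNReal.ofReal (M ^ 2 * (C * crudeMass k N c T T₁)) := by
  set ν := (volume : Measure ℝ).prod (volume.restrict (Set.Ioc (0:ℝ) 1)) with hν
  have hpw : Measurable powWeight := by unfold powWeight; fun_prop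
  have hk : Measurable fun z : ℝ × ℝ => ENNReal.ofReal (gauss Δ z.1 * |z.1|) := by
    have := (continuous_gauss Δ).measurable
    fun_prop
  have hF : Measurable (Function.uncurry fun (t : ℝ) (z : ℝ × ℝ) =>
      ‖powWeight t * xiReal (t + x + z.2 * z.1)‖ₑ) := by
    have := continuous_xiReal.measurable
    fun_prop
  have hms := lintegral_sq_lintegral_le (μ := volume.restrict (Set.Ioc T T₁)) (ν := ν)
    (B := fun z => ENNReal.ofReal ((1 + |z.1|) ^ (2 * k + 4) * (C * crudeMass k N c T T₁))) hk hF (by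
      have : ∀ᵐ z : ℝ × ℝ ∂ν, z.2 ∈ Set.Ioc (0:ℝ) 1 :=
        Measure.quasiMeasurePreserving_snd.ae (ae_restrict_mem measurableSet_Ioc)
      filter_upwards [this] with z hz
      refine (hC _).trans (ENNReal.ofReal_le_ofReal ?_)
      have hzz : |z.2 * z.1| ≤ |z.1| := by
        rw [abs_mul, abs_of_pos hz.1]
        exact mul_le_of_le_one_left (abs_nonneg _) hz.2
      rw [mul_right_comm, mul_comm]
      gcongr)
  have h1 : ∫⁻ z : ℝ × ℝ, ENNReal.ofReal (gauss Δ z.1 * |z.1|) ∂ν ≤ ENNReal.ofReal M := by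
    rw [hν, lintegral_prod _ hk.aemeasurable]
    simp only [lintegral_const, Measure.restrict_apply_univ, Real.volume_Ioc, sub_zero,
      ENNReal.ofReal_one, mul_one]
    refine le_trans (lintegral_mono fun v => ENNReal.ofReal_le_ofReal ?_) hG
    have := gauss_pos hΔ v
    gcongr
    exact le_mul_of_one_le_right (abs_nonneg v) (one_le_pow₀ (by linarith [abs_nonneg v]))
  have h2 : ∫⁻ z : ℝ × ℝ, ENNReal.ofReal (gauss Δ z.1 * |z.1|) *
      ENNReal.ofReal ((1 + |z.1|) ^ (2 * k + 4) * (C * crudeMass k N c T T₁)) ∂ν ≤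
      ENNReal.ofReal (M * (C * crudeMass k N c T T₁)) := by
    rw [hν, lintegral_prod _ (by fun_prop)]
    simp only [lintegral_const, Measure.restrict_apply_univ, Real.volume_Ioc, sub_zero,
      ENNReal.ofReal_one, mul_one]
    rw [ENNReal.ofReal_mul hM]
    calc _ = ∫⁻ v, ENNReal.ofReal (gauss Δ v * (|v| * (1 + |v|) ^ (2 * k + 4))) *
          ENNReal.ofReal (C * crudeMass k N c T T₁) := by
          refine lintegral_congr fun v => ?_
          have := gauss_pos hΔ v
          rw [← ENNReal.ofReal_mul (by positivity), ← ENNReal.ofReal_mul (by positivity)]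
          congr 1; ring
      _ ≤ _ := by
          rw [lintegral_mul_const' _ _ ENNReal.ofReal_ne_top]
          gcongr
  calc _ = ∫⁻ t in Set.Ioc T T₁, (∫⁻ z : ℝ × ℝ, ENNReal.ofReal (gauss Δ z.1 * |z.1|) *
        ‖powWeight t * xiReal (t + x + z.2 * z.1)‖ₑ ∂ν) ^ 2 := by
        refine lintegral_congr fun t => ?_
        rw [hν, lintegral_prod]
        exact (hk.mul (hF.comp measurable_prodMk_left)).aemeasurable
    _ ≤ _ := hms.trans (mul_le_mul' h1 h2)
    _ = _ := by rw [← ENNReal.ofReal_mul hM]; congr 1; ring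

lemma enorm_integral_XHL_sub_smoothXi_le {Δ : ℝ} (hΔ : 0 < Δ) {T H t : ℝ} (hT : 1 ≤ T) (ht : T ≤ t)
    (hH : 0 ≤ H) (hHT : H ≤ T) :
    ‖(∫ u in t..(t + H), XHL u) - powWeight t * smoothXi Δ H t‖ₑ ≤
      (∫⁻ x in Set.Ioc 0 H, ENNReal.ofReal (3 * (H / T)) * ‖powWeight t * xiReal (t + x)‖ₑ) +
      ((∫⁻ v, ∫⁻ θ in Set.Ioc (0:ℝ) 1, ENNReal.ofReal (gauss Δ v * |v|) *
        ‖powWeight t * xiReal (t + 0 + θ * v)‖ₑ) +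
      ∫⁻ v, ∫⁻ θ in Set.Ioc (0:ℝ) 1, ENNReal.ofReal (gauss Δ v * |v|) *
        ‖powWeight t * xiReal (t + H + θ * v)‖ₑ) := by
  have ht0 : 0 < t := by linarith
  have hYc := continuous_xiReal
  obtain ⟨C, hC, hY⟩ := exists_abs_xiReal_le
  have hpc : ContinuousOn (fun x => powWeight (t + x)) (Set.uIcc 0 H) := by
    rw [Set.uIcc_of_le hH]
    unfold powWeight
    refine ContinuousOn.div ?_ (by fun_prop) fun x _ => by positivity
    exact ContinuousOn.rpow_const (by fun_prop) fun x hx => Or.inl (by linarith [hx.1])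
  have e1 : ∫ u in t..(t + H), XHL u = ∫ x in (0:ℝ)..H, powWeight (t + x) * xiReal (t + x) := by
    rw [← intervalIntegral.integral_congr (g := fun x => powWeight (t + x) * xiReal (t + x))
      (f := fun x => XHL (t + x)) fun x _ => XHL_eq _]
    simp [intervalIntegral.integral_comp_add_left (a := 0) (b := H) XHL t]
  have hYi : IntervalIntegrable (fun x => xiReal (t + x)) volume 0 H :=
    (hYc.comp (by fun_prop)).intervalIntegrable _ _
  have e2 : (∫ u in t..(t + H), XHL u) = (∫ x in (0:ℝ)..H, (powWeight (t + x) - powWeight t) * xiReal (t + x)) +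
      powWeight t * ∫ x in (0:ℝ)..H, xiReal (t + x) := by
    rw [e1, ← intervalIntegral.integral_const_mul, ← intervalIntegral.integral_add]
    · congr 1; ext x; ring
    · exact hYi.continuousOn_mul (hpc.sub continuousOn_const)
    · exact hYi.const_mul _
  have hgi : Integrable (gauss Δ) := by simpa using integrable_gauss_mul_exp hΔ 0 0
  have hgYi : Integrable fun v => gauss Δ v * ∫ x in (0:ℝ)..H, xiReal (t + x + v) := by
    refine integrable_gauss_smul (f := fun v => ∫ x in (0:ℝ)..H, xiReal (t + x + v)) hΔ
      (K := C * Real.exp (4 * (t + H)) * H) (p := 0) (c := 4) ?_ fun v => ?_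
    · refine (intervalIntegral.continuous_parametric_intervalIntegral_of_continuous' ?_ _ _).aestronglyMeasurable
      fun_prop
    · have := intervalIntegral.norm_integral_le_of_norm_le_const (a := 0) (b := H)
        (f := fun x => xiReal (t + x + v)) (C := C * Real.exp (4 * (t + H + |v|))) fun x hx => ?_
      · rw [sub_zero, abs_of_nonneg hH, mul_add 4 (t + H), Real.exp_add] at this
        rw [pow_zero, one_mul]
        linarith
      · rw [Set.uIoc_of_le hH] at hx
        refine (hY _).trans ?_
        have : |t + x + v| ≤ t + H + |v| := by
          refine (abs_add_le _ _).trans ?_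
          rw [abs_of_nonneg (by linarith [hx.1])]; linarith [hx.2]
        gcongr
  have e3 : (∫ x in (0:ℝ)..H, xiReal (t + x)) - smoothXi Δ H t = ∫ v, gauss Δ v *
      (v * ∫ θ in (0:ℝ)..1, (xiReal (t + 0 + θ * v) - xiReal (t + H + θ * v))) := by
    rw [smoothXi_eq hΔ]
    simp only [add_zero, ← integral_xiReal_sub_shift, mul_sub]
    rw [integral_sub (hgi.mul_const _) hgYi, integral_mul_const, integral_gauss hΔ, one_mul]
  have e4 : (∫ u in t..(t + H), XHL u) - powWeight t * smoothXi Δ H t =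
      (∫ x in (0:ℝ)..H, (powWeight (t + x) - powWeight t) * xiReal (t + x)) +
      powWeight t * ∫ v, gauss Δ v *
      (v * ∫ θ in (0:ℝ)..1, (xiReal (t + 0 + θ * v) - xiReal (t + H + θ * v))) := by
    rw [← e3, e2]; ring
  rw [e4]
  have hYm := hYc.measurable
  refine (enorm_add_le _ _).trans (add_le_add ?_ ?_)
  · rw [intervalIntegral.integral_of_le hH]
    refine (enorm_integral_le_lintegral_enorm _).trans (setLIntegral_mono' measurableSet_Ioc fun x hx => ?_)
    rw [enorm_mul, enorm_mul, ← mul_assoc]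
    gcongr
    rw [← ofReal_norm, ← ofReal_norm, ← ENNReal.ofReal_mul (by positivity)]
    refine ENNReal.ofReal_le_ofReal ?_
    rw [Real.norm_of_nonneg (powWeight_nonneg ht0.le)]
    refine (abs_powWeight_sub_le ht0 hx.1.le (by linarith [hx.2])).trans ?_
    have := powWeight_nonneg ht0.le
    gcongr
    exact hx.2
  · rw [← integral_const_mul, ← lintegral_add_left (by
      have := (continuous_gauss Δ).measurable
      refine Measurable.lintegral_prod_right' (f := fun z : ℝ × ℝ => ENNReal.ofReal (gauss Δ z.1 * |z.1|) *
        ‖powWeight t * xiReal (t + 0 + z.2 * z.1)‖ₑ) ?_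
      fun_prop)]
    refine (enorm_integral_le_lintegral_enorm _).trans (lintegral_mono fun v => ?_)
    rw [← lintegral_add_left (by fun_prop)]
    rw [show powWeight t * (gauss Δ v * (v * ∫ θ in (0:ℝ)..1,
      (xiReal (t + 0 + θ * v) - xiReal (t + H + θ * v)))) = ∫ θ in (0:ℝ)..1, gauss Δ v * v *
      (powWeight t * xiReal (t + 0 + θ * v) - powWeight t * xiReal (t + H + θ * v)) by
        rw [← mul_assoc, ← mul_assoc, ← intervalIntegral.integral_const_mul]; congr 1; ext θ; ring,
      intervalIntegral.integral_of_le zero_le_one]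
    refine (enorm_integral_le_lintegral_enorm _).trans (lintegral_mono fun θ => ?_)
    rw [enorm_mul, ← mul_add, ← ofReal_norm (gauss Δ v * v), norm_mul, Real.norm_of_nonneg (gauss_pos hΔ v).le,
      Real.norm_eq_abs]
    gcongr
    exact enorm_sub_le

theorem exists_lintegral_smoothing_le {k : ℕ} (hk : 1 ≤ k) : ∃ C : ℝ, 0 < C ∧
    ∀ (T T₁ c Δ H : ℝ) (N : ℕ), 1 ≤ T → T ≤ T₁ → 0 < c → c ≤ 1 / 40 → 1 ≤ N → 0 < Δ → Δ ≤ 1 →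
    0 ≤ H → H ≤ T →
    ∫⁻ t in Set.Ioc T T₁, ‖(∫ u in t..(t + H), XHL u) - powWeight t * smoothXi Δ H t‖ₑ ^ 2 ≤
      ENNReal.ofReal (C * ((H ^ 2 / T) ^ 2 + Δ ^ 2) * crudeMass k N c T T₁) := by
  obtain ⟨C, hC, h⟩ := exists_lintegral_xiReal_sq_le hk
  obtain ⟨C₁, hC₁, h1⟩ := exists_lintegral_gauss_le (2 * k + 4)
  refine ⟨18 * C + 8 * C₁ ^ 2 * C, by positivity, fun T T₁ c Δ H N hT hTT hc hc' hN hΔ hΔ' hH hHT => ?_⟩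
  have hcm := crudeMass_nonneg (k := k) (c := c) hN (by linarith) hTT
  have hx : ∀ x, 0 ≤ x → x ≤ T → ∀ v, _ := fun x hx hxT v => h T T₁ c x v N hT hTT hc hc' hN hx hxT
  have hS := fun x (hx0 : 0 ≤ x) hxT => lintegral_sq_shift_xiReal_le (hx x hx0 hxT)
    (mul_nonneg hC.le hcm) (by positivity : 0 ≤ C₁ * Δ) hΔ (h1 Δ hΔ hΔ').2
  have hF : Measurable (Function.uncurry fun t x : ℝ => ‖powWeight t * xiReal (t + x)‖ₑ) := by
    have hpw : Measurable powWeight := by unfold powWeight; fun_prop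
    have := continuous_xiReal.measurable
    fun_prop
  have hE := lintegral_sq_lintegral_le (μ := volume.restrict (Set.Ioc T T₁))
    (ν := volume.restrict (Set.Ioc 0 H)) (k := fun _ => ENNReal.ofReal (3 * (H / T)))
    (B := fun _ => ENNReal.ofReal (C * crudeMass k N c T T₁)) measurable_const hF (by
      filter_upwards [ae_restrict_mem measurableSet_Ioc] with x hx'
      simpa using hx x hx'.1.le (hx'.2.trans hHT) 0)
  set a₁ : ℝ → ENNReal := fun t => ∫⁻ x in Set.Ioc 0 H,
    ENNReal.ofReal (3 * (H / T)) * ‖powWeight t * xiReal (t + x)‖ₑ with ha₁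
  set a₂ : ℝ → ℝ → ENNReal := fun x t => ∫⁻ v, ∫⁻ θ in Set.Ioc (0:ℝ) 1, ENNReal.ofReal (gauss Δ v * |v|) *
        ‖powWeight t * xiReal (t + x + θ * v)‖ₑ with ha₂
  have ha₁m : Measurable a₁ := Measurable.lintegral_prod_right'
    (f := fun z : ℝ × ℝ => ENNReal.ofReal (3 * (H / T)) * ‖powWeight z.1 * xiReal (z.1 + z.2)‖ₑ)
    (hF.const_mul _)
  have ha₂m : ∀ x, Measurable (a₂ x) := fun x => by
    refine Measurable.lintegral_prod_right' (f := fun w : ℝ × ℝ => ∫⁻ θ in Set.Ioc (0:ℝ) 1,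
      ENNReal.ofReal (gauss Δ w.2 * |w.2|) * ‖powWeight w.1 * xiReal (w.1 + x + θ * w.2)‖ₑ) ?_
    refine Measurable.lintegral_prod_right' (f := fun z : (ℝ × ℝ) × ℝ =>
      ENNReal.ofReal (gauss Δ z.1.2 * |z.1.2|) * ‖powWeight z.1.1 * xiReal (z.1.1 + x + z.2 * z.1.2)‖ₑ) ?_
    have hpw : Measurable powWeight := by unfold powWeight; fun_prop
    have := continuous_xiReal.measurable
    have := (continuous_gauss Δ).measurable
    fun_prop
  calc _ ≤ ∫⁻ t in Set.Ioc T T₁, (2 * a₁ t ^ 2 + (4 * a₂ 0 t ^ 2 + 4 * a₂ H t ^ 2)) := by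
        refine setLIntegral_mono' measurableSet_Ioc fun t ht => ?_
        refine (pow_le_pow_left' (enorm_integral_XHL_sub_smoothXi_le hΔ hT ht.1.le hH hHT) 2).trans ?_
        refine (ennreal_add_sq_le _ _).trans ?_
        calc _ ≤ 2 * (a₁ t ^ 2 + 2 * (a₂ 0 t ^ 2 + a₂ H t ^ 2)) := by
              gcongr
              exact ennreal_add_sq_le _ _
          _ = _ := by ring
    _ = 2 * (∫⁻ t in Set.Ioc T T₁, a₁ t ^ 2) + (4 * (∫⁻ t in Set.Ioc T T₁, a₂ 0 t ^ 2) +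
        4 * ∫⁻ t in Set.Ioc T T₁, a₂ H t ^ 2) := by
        rw [lintegral_add_left ((ha₁m.pow_const 2).const_mul _),
          lintegral_add_left (((ha₂m 0).pow_const 2).const_mul _),
          lintegral_const_mul _ (ha₁m.pow_const 2), lintegral_const_mul _ ((ha₂m 0).pow_const 2),
          lintegral_const_mul _ ((ha₂m H).pow_const 2)]
    _ ≤ 2 * ENNReal.ofReal ((3 * (H / T) * H) ^ 2 * (C * crudeMass k N c T T₁)) +
        (4 * ENNReal.ofReal ((C₁ * Δ) ^ 2 * (C * crudeMass k N c T T₁)) +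
          4 * ENNReal.ofReal ((C₁ * Δ) ^ 2 * (C * crudeMass k N c T T₁))) := by
        gcongr
        · refine hE.trans_eq ?_
          have hT0 : 0 < T := by linarith
          have e : 0 ≤ 3 * (H / T) := by positivity
          have hCm : 0 ≤ C * crudeMass k N c T T₁ := by positivity
          simp only [lintegral_const, Measure.restrict_apply_univ, Real.volume_Ioc, sub_zero]
          rw [← ENNReal.ofReal_mul e, ← ENNReal.ofReal_mul e, ← ENNReal.ofReal_mul (by positivity),
            ← ENNReal.ofReal_mul (by positivity)]
          congr 1; ring
        · exact hS 0 le_rfl (by linarith)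
        · exact hS H hH hHT
    _ = ENNReal.ofReal ((18 * C * (H ^ 2 / T) ^ 2 + 8 * C₁ ^ 2 * C * Δ ^ 2) * crudeMass k N c T T₁) := by
        have h2 : (2 : ENNReal) = ENNReal.ofReal 2 := (ENNReal.ofReal_ofNat 2).symm
        have h4 : (4 : ENNReal) = ENNReal.ofReal 4 := (ENNReal.ofReal_ofNat 4).symm
        rw [h2, h4, ← ENNReal.ofReal_mul (by norm_num), ← ENNReal.ofReal_mul (by norm_num),
          ← ENNReal.ofReal_add (by positivity) (by positivity),
          ← ENNReal.ofReal_add (by positivity) (by positivity)]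
        congr 1; ring
    _ ≤ _ := by
        refine ENNReal.ofReal_le_ofReal (mul_le_mul_of_nonneg_right ?_ hcm)
        have e1 : 0 ≤ 18 * C * Δ ^ 2 := by positivity
        have e2 : 0 ≤ 8 * C₁ ^ 2 * C * (H ^ 2 / T) ^ 2 := by positivity
        linarith

lemma integral_gauss_mul_exp {Δ : ℝ} (hΔ : 0 < Δ) (ω : ℝ) :
    ∫ v : ℝ, (gauss Δ v : ℂ) * Complex.exp (Complex.I * v * ω) =
      (Real.exp (-(Δ ^ 2 * ω ^ 2 / 2)) : ℝ) := by
  have hb : (0:ℝ) < 1 / (2 * Δ ^ 2) := by positivity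
  have h := fourierIntegral_gaussian (b := ((1 / (2 * Δ ^ 2) : ℝ) : ℂ)) (by rwa [Complex.ofReal_re]) ω
  have hsq : (0:ℝ) < Real.sqrt (2 * Real.pi) := Real.sqrt_pos.2 (by positivity)
  have hc : ((Real.pi : ℂ) / ((1 / (2 * Δ ^ 2) : ℝ) : ℂ)) ^ (1 / 2 : ℂ) =
      ((Δ * Real.sqrt (2 * Real.pi) : ℝ) : ℂ) := by
    rw [← Complex.ofReal_div, show (1 / 2 : ℂ) = ((1 / 2 : ℝ) : ℂ) by push_cast; rfl,
      ← Complex.ofReal_cpow (by positivity), ← Real.sqrt_eq_rpow]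
    congr 1
    rw [show Real.pi / (1 / (2 * Δ ^ 2)) = Δ ^ 2 * (2 * Real.pi) by field_simp,
      Real.sqrt_mul (by positivity), Real.sqrt_sq hΔ.le]
  have he : Complex.exp (-(ω : ℂ) ^ 2 / (4 * ((1 / (2 * Δ ^ 2) : ℝ) : ℂ))) =
      (Real.exp (-(Δ ^ 2 * ω ^ 2 / 2)) : ℝ) := by
    rw [Complex.ofReal_exp]
    congr 1
    have : (Δ : ℂ) ≠ 0 := by exact_mod_cast hΔ.ne'
    push_cast
    field_simp
    ring
  rw [hc, he] at h
  have hintgr : ∀ v : ℝ, (gauss Δ v : ℂ) * Complex.exp (Complex.I * v * ω) =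
      (Complex.exp (Complex.I * ω * v) * Complex.exp (-((1 / (2 * Δ ^ 2) : ℝ) : ℂ) * (v : ℂ) ^ 2)) /
        ((Δ * Real.sqrt (2 * Real.pi) : ℝ) : ℂ) := by
    intro v
    rw [gauss, Complex.ofReal_div, Complex.ofReal_exp, mul_right_comm Complex.I]
    push_cast
    ring
  simp only [hintgr]
  rw [integral_div, h, mul_div_cancel_left₀]
  exact_mod_cast (by positivity : Δ * Real.sqrt (2 * Real.pi) ≠ 0)

/-- The exponential integral over `[0, H]`. -/
noncomputable def sincKernel (H ω : ℝ) : ℂ := ∫ x in (0:ℝ)..H, Complex.exp (Complex.I * x * ω)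

/-- The coefficient of `n ^ (-s)` in the smoothed main term, at `ω = freq t - log n`. -/
noncomputable def smoothCoef (Δ H ω : ℝ) : ℂ :=
  sincKernel H ω * (Real.exp (-(Δ ^ 2 * ω ^ 2 / 2)) : ℝ)

/-- The smoothed Dirichlet polynomial. -/
noncomputable def smoothPoly (N : ℕ) (Δ H t : ℝ) : ℂ :=
  ∑ n ∈ Finset.Icc 1 N, smoothCoef Δ H (freq t - Real.log n) * (n : ℂ) ^ (-line 0 t)

lemma integral_gauss_mul_dirPoly {Δ : ℝ} (hΔ : 0 < Δ) (N : ℕ) (t x : ℝ) :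
    ∫ v : ℝ, (gauss Δ v : ℂ) * (Complex.exp (Complex.I * (x + v : ℝ) * freq t) *
      dirPoly N (line 0 (t + x + v))) =
    ∑ n ∈ Finset.Icc 1 N, Complex.exp (Complex.I * x * (freq t - Real.log n : ℝ)) *
      ((Real.exp (-(Δ ^ 2 * (freq t - Real.log n) ^ 2 / 2)) : ℝ) * (n : ℂ) ^ (-line 0 t)) := by
  have hterm : ∀ v : ℝ, (gauss Δ v : ℂ) * (Complex.exp (Complex.I * (x + v : ℝ) * freq t) *
      dirPoly N (line 0 (t + x + v))) = ∑ n ∈ Finset.Icc 1 N,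
      ((gauss Δ v : ℂ) * Complex.exp (Complex.I * v * (freq t - Real.log n : ℝ))) *
      (Complex.exp (Complex.I * x * (freq t - Real.log n : ℝ)) * (n : ℂ) ^ (-line 0 t)) := by
    intro v
    rw [dirPoly, Finset.mul_sum, Finset.mul_sum]
    refine Finset.sum_congr rfl fun n hn => ?_
    have hn1 := (Finset.mem_Icc.1 hn).1
    rw [natCast_cpow_neg_line hn1, natCast_cpow_neg_line hn1]
    have : Complex.exp (Complex.I * (x + v : ℝ) * freq t) *
        Complex.exp (-(Complex.I * (t + x + v : ℝ) * Real.log n)) =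
        Complex.exp (Complex.I * v * (freq t - Real.log n : ℝ)) *
        Complex.exp (Complex.I * x * (freq t - Real.log n : ℝ)) *
        Complex.exp (-(Complex.I * t * Real.log n)) := by
      rw [← Complex.exp_add, ← Complex.exp_add, ← Complex.exp_add]
      congr 1
      push_cast
      ring
    linear_combination (gauss Δ v : ℂ) * (((n : ℝ) ^ (-(1 / 2 + 0 : ℝ)) : ℝ) : ℂ) * this
  simp only [hterm]
  rw [integral_finsetSum]
  · refine Finset.sum_congr rfl fun n _ => ?_
    rw [integral_mul_const, integral_gauss_mul_exp hΔ]
    ring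
  · intro n _
    refine Integrable.mul_const ?_ _
    refine integrable_gauss_smul (f := fun v : ℝ => Complex.exp (Complex.I * v * (freq t - Real.log n : ℝ)))
      (K := 1) (p := 0) (c := 0) hΔ (Continuous.aestronglyMeasurable (by fun_prop)) fun v => ?_
    rw [show Complex.I * v * (freq t - Real.log n : ℝ) = ((v * (freq t - Real.log n) : ℝ) : ℂ) * Complex.I by
      push_cast; ring, Complex.norm_exp_ofReal_mul_I]
    simp

lemma smoothPoly_eq {Δ : ℝ} (N : ℕ) (H t : ℝ) :
    smoothPoly N Δ H t = ∫ x in (0:ℝ)..H,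
      ∑ n ∈ Finset.Icc 1 N, Complex.exp (Complex.I * x * (freq t - Real.log n : ℝ)) *
      ((Real.exp (-(Δ ^ 2 * (freq t - Real.log n) ^ 2 / 2)) : ℝ) * (n : ℂ) ^ (-line 0 t)) := by
  rw [intervalIntegral.integral_finsetSum]
  · refine Finset.sum_congr rfl fun n _ => ?_
    rw [intervalIntegral.integral_mul_const, smoothCoef, sincKernel]
    ring
  · intro n _
    exact Continuous.intervalIntegrable (by fun_prop) _ _

/-- The Gaussian average of `xiReal`, after moving the line of integration for the remainder. -/
lemma integral_gauss_mul_xiReal_eq {Δ : ℝ} (hΔ : 0 < Δ) (k N : ℕ) (u : ℝ) :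
    ((∫ v, gauss Δ v * xiReal (u + v) : ℝ) : ℂ) =
      (∫ v : ℝ, (gauss Δ v : ℂ) * (gammaWeight (line 0 (u + v)) * dirPoly N (line 0 (u + v)))) +
      ∫ y : ℝ, Complex.exp (((2 * k : ℝ) + y * Complex.I) ^ 2 / (2 * Δ ^ 2 : ℝ)) /
        (Δ * Real.sqrt (2 * Real.pi) : ℝ) * zetaRem N (line (2 * k) (u + y)) := by
  have hsq : (0:ℝ) < Real.sqrt (2 * Real.pi) := Real.sqrt_pos.2 (by positivity)
  have hD : (0:ℝ) < Δ * Real.sqrt (2 * Real.pi) := by positivity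
  set φ : ℂ → ℂ := fun w => Complex.exp (w ^ 2 / (2 * Δ ^ 2 : ℝ)) / (Δ * Real.sqrt (2 * Real.pi) : ℝ) with hφ
  have hn : ∀ x y : ℝ, ‖φ (x + y * Complex.I)‖ = Real.exp ((x ^ 2 - y ^ 2) / (2 * Δ ^ 2)) /
      (Δ * Real.sqrt (2 * Real.pi)) := by
    intro x y
    rw [hφ]
    simp only
    rw [norm_div, Complex.norm_real, Real.norm_of_nonneg hD.le, Complex.norm_exp, Complex.div_ofReal_re]
    simp [sq]
  have h := integral_mul_xiTwist_eq (φ := φ) (a := 0) (b := 2 * k)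
    (M := Real.exp ((2 * k : ℝ) ^ 2 / (2 * Δ ^ 2)) / (Δ * Real.sqrt (2 * Real.pi))) (c := 0)
    (β := 1 / (2 * Δ ^ 2)) le_rfl (by positivity) (by positivity)
    (Differentiable.differentiableOn (by rw [hφ]; fun_prop)) (by
      intro x hx y
      rw [hn, div_mul_eq_mul_div, ← Real.exp_add]
      gcongr
      rw [sub_div, zero_mul, zero_sub, ← sub_eq_add_neg, one_div_mul_eq_div]
      gcongr
      · exact hx.1
      · exact hx.2) N u
  have hφ0 : ∀ v : ℝ, φ ((0:ℝ) + v * Complex.I) = gauss Δ v := by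
    intro v
    rw [hφ, gauss]
    simp only
    rw [Complex.ofReal_div, Complex.ofReal_exp]
    congr 2
    push_cast
    rw [zero_add, mul_pow, Complex.I_sq]
    ring
  simp only [hφ0, xiTwist_line_zero] at h
  rw [← h]
  refine integral_complex_ofReal.symm.trans ?_
  congr 1; ext v; push_cast; rfl

lemma exists_norm_integral_zetaRem_le {k : ℕ} (hk : 1 ≤ k) : ∃ C : ℝ, 0 < C ∧
    ∀ (Δ u : ℝ) (N : ℕ), 0 < Δ → Δ ≤ 1 → 1 ≤ N →
    ‖∫ y : ℝ, Complex.exp (((2 * k : ℝ) + y * Complex.I) ^ 2 / (2 * Δ ^ 2 : ℝ)) /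
        (Δ * Real.sqrt (2 * Real.pi) : ℝ) * zetaRem N (line (2 * k) (u + y))‖ ≤
      C * (Real.exp ((2 * k) ^ 2 / (2 * Δ ^ 2)) * ((1 + |u|) ^ (k + 2) * (N : ℝ) ^ (3 / 2 - 2 * k : ℝ))) := by
  obtain ⟨C₄, hC₄, h4⟩ := exists_norm_zetaRem_line_le hk
  obtain ⟨C₁, hC₁, h1⟩ := exists_lintegral_gauss_le (k + 2)
  refine ⟨C₁ * C₄, by positivity, fun Δ u N hΔ hΔ' hN => ?_⟩
  have hN0 : (0:ℝ) < N := by exact_mod_cast hN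
  have hsq : (0:ℝ) < Real.sqrt (2 * Real.pi) := Real.sqrt_pos.2 (by positivity)
  set A := C₄ * (Real.exp ((2 * k) ^ 2 / (2 * Δ ^ 2)) * ((1 + |u|) ^ (k + 2) * (N : ℝ) ^ (3 / 2 - 2 * k : ℝ))) with hA
  have hA0 : 0 ≤ A := by positivity
  rw [← ENNReal.ofReal_le_ofReal_iff (by positivity), ofReal_norm]
  refine (enorm_integral_le_lintegral_enorm _).trans ?_
  calc _ ≤ ∫⁻ y, ENNReal.ofReal A * ENNReal.ofReal (gauss Δ y * (1 + |y|) ^ (k + 2)) := by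
        refine lintegral_mono fun y => ?_
        rw [← ENNReal.ofReal_mul hA0, ← ofReal_norm]
        refine ENNReal.ofReal_le_ofReal ?_
        rw [norm_mul, norm_div, Complex.norm_real, Real.norm_of_nonneg (by positivity), Complex.norm_exp,
          Complex.div_ofReal_re]
        have e1 : ((((2 * k : ℝ) : ℂ) + y * Complex.I) ^ 2).re = (2 * k) ^ 2 - y ^ 2 := by simp [sq]
        have e2 : 1 + |u + y| ≤ (1 + |u|) * (1 + |y|) := by
          nlinarith [abs_add_le u y, mul_nonneg (abs_nonneg u) (abs_nonneg y)]
        rw [e1]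
        calc _ ≤ Real.exp (((2 * k) ^ 2 - y ^ 2) / (2 * Δ ^ 2)) / (Δ * Real.sqrt (2 * Real.pi)) *
              (C₄ * ((1 + |u|) * (1 + |y|)) ^ (k + 2) * (N : ℝ) ^ (3 / 2 - 2 * k : ℝ)) := by
              gcongr
              exact (h4 N hN _).trans (by gcongr)
          _ = _ := by
              rw [sub_div, sub_eq_add_neg, Real.exp_add, mul_pow (1 + |u|), hA, gauss, ← neg_div, neg_mul,
                one_div_mul_eq_div, neg_div]
              ring
    _ ≤ ENNReal.ofReal A * ENNReal.ofReal C₁ := by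
        rw [lintegral_const_mul' _ _ ENNReal.ofReal_ne_top]
        gcongr
        exact (h1 Δ hΔ hΔ').1
    _ = _ := by rw [← ENNReal.ofReal_mul hA0, hA]; congr 1; ring

lemma integrable_gauss_mul_gammaWeight_mul_dirPoly {Δ : ℝ} (hΔ : 0 < Δ) (N : ℕ) (u : ℝ) :
    Integrable fun v : ℝ => (gauss Δ v : ℂ) * (gammaWeight (line 0 (u + v)) * dirPoly N (line 0 (u + v))) := by
  obtain ⟨C, hC, h⟩ := exists_norm_gammaWeight_le_exp (1 / 2)
  have hP := continuous_gammaWeight_line le_rfl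
  have hD := continuous_dirPoly_line N 0
  refine integrable_gauss_smul (f := fun v => gammaWeight (line 0 (u + v)) * dirPoly N (line 0 (u + v)))
    (K := C * Real.exp (4 * |u|) * N) (p := 0) (c := 4) hΔ
    (((hP.comp (by fun_prop : Continuous fun v => u + v)).mul
      (hD.comp (by fun_prop : Continuous fun v => u + v))).aestronglyMeasurable) fun v => ?_
  have h1 := h (line 0 (u + v)) (by simp)
  rw [line_im] at h1
  have h2 := norm_dirPoly_le N (s := line 0 (u + v)) (by simp)
  rw [norm_mul, pow_zero, one_mul]
  calc _ ≤ C * Real.exp (4 * (|u| + |v|)) * N := by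
        gcongr
        refine h1.trans ?_
        gcongr
        exact abs_add_le _ _
    _ = _ := by rw [mul_add, Real.exp_add]; ring

lemma integrable_gauss_mul_exp_mul_dirPoly {Δ : ℝ} (hΔ : 0 < Δ) (N : ℕ) (t x ω : ℝ) :
    Integrable fun v : ℝ => (gauss Δ v : ℂ) * (Complex.exp (Complex.I * (x + v : ℝ) * ω) *
      dirPoly N (line 0 (t + x + v))) := by
  have hD := (continuous_dirPoly_line N 0).comp (by fun_prop : Continuous fun v => t + x + v)
  refine integrable_gauss_smul (f := fun v : ℝ => Complex.exp (Complex.I * (x + v : ℝ) * ω) *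
      dirPoly N (line 0 (t + x + v))) (K := N) (p := 0) (c := 0) hΔ
    ((Continuous.mul (by fun_prop) hD).aestronglyMeasurable) fun v => ?_
  have h2 := norm_dirPoly_le N (s := line 0 (t + x + v)) (by simp)
  rw [norm_mul, show Complex.I * (x + v : ℝ) * ω = (((x + v) * ω : ℝ) : ℂ) * Complex.I by push_cast; ring,
    Complex.norm_exp_ofReal_mul_I]
  simpa using h2

lemma exists_enorm_smoothXi_sub_le {k : ℕ} (hk : 1 ≤ k) : ∃ C : ℝ, 0 < C ∧
    ∀ (T T₁ Δ H t : ℝ) (N : ℕ), 4 ≤ T → 0 < Δ → Δ ≤ 1 → 1 ≤ N → 0 ≤ H → H ≤ T → t ∈ Set.Ioc T T₁ →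
    ‖((powWeight t * smoothXi Δ H t : ℝ) : ℂ) -
        powWeight t * gammaWeight (line 0 t) * smoothPoly N Δ H t‖ₑ ≤
      (∫⁻ x in Set.Ioc 0 H, ∫⁻ v, ENNReal.ofReal (C * (1 + H) ^ 6 / T * (gauss Δ v * (1 + |v|) ^ 6)) *
        ‖dirPoly N (line 0 (t + (x + v)))‖ₑ) +
      ENNReal.ofReal (C * (H * (Real.exp ((2 * k) ^ 2 / (2 * Δ ^ 2)) *
        (T₁ ^ (k + 2) * (N : ℝ) ^ (3 / 2 - 2 * k : ℝ))))) := by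
  obtain ⟨C₂, hC₂, h2⟩ := gammaWeight_approx
  obtain ⟨C₅, hC₅, h5⟩ := exists_norm_integral_zetaRem_le hk
  refine ⟨C₂ + C₅ * 3 ^ (k + 2), by positivity, fun T T₁ Δ H t N hT hΔ hΔ' hN hH hHT ht => ?_⟩
  have ht0 : 0 < t := by linarith [ht.1]
  have hN0 : (0:ℝ) < N := by exact_mod_cast hN
  have hT₁ : 4 ≤ T₁ := by linarith [ht.1, ht.2]
  have hr0 := powWeight_nonneg ht0.le
  have hr1 := powWeight_le_one (t := t) (by linarith [ht.1])
  set r := powWeight t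
  set P := gammaWeight (line 0 t)
  set τ : ℝ → ℂ := fun x => ∫ y : ℝ, Complex.exp (((2 * k : ℝ) + y * Complex.I) ^ 2 / (2 * Δ ^ 2 : ℝ)) /
        (Δ * Real.sqrt (2 * Real.pi) : ℝ) * zetaRem N (line (2 * k) (t + x + y)) with hτ
  set E := Real.exp ((2 * k) ^ 2 / (2 * Δ ^ 2)) * (T₁ ^ (k + 2) * (N : ℝ) ^ (3 / 2 - 2 * k : ℝ)) with hE
  have hE0 : 0 ≤ E := by positivity
  have hsm : ((r * smoothXi Δ H t : ℝ) : ℂ) - r * P * smoothPoly N Δ H t = ∫ x in (0:ℝ)..H,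
      (r * ((∫ v, gauss Δ v * xiReal (t + x + v) : ℝ) : ℂ) - r * P *
        ∫ v : ℝ, (gauss Δ v : ℂ) * (Complex.exp (Complex.I * (x + v : ℝ) * freq t) *
      dirPoly N (line 0 (t + x + v)))) := by
    simp only [integral_gauss_mul_dirPoly hΔ]
    rw [intervalIntegral.integral_sub, intervalIntegral.integral_const_mul,
      intervalIntegral.integral_const_mul, ← smoothPoly_eq, intervalIntegral.integral_ofReal,
      Complex.ofReal_mul, smoothXi]
    · have := (integrable_gauss_mul_xiReal hΔ H t).integral_prod_left
      rw [Set.uIoc_of_le hH] at this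
      rw [intervalIntegrable_iff_integrableOn_Ioc_of_le hH]
      exact (this.ofReal (𝕜 := ℂ)).const_mul _
    · exact Continuous.intervalIntegrable (by fun_prop) _ _
  rw [hsm, intervalIntegral.integral_of_le hH]
  refine (enorm_integral_le_lintegral_enorm _).trans ?_
  calc _ ≤ ∫⁻ x in Set.Ioc 0 H, ((∫⁻ v, ENNReal.ofReal ((C₂ + C₅ * 3 ^ (k + 2)) * (1 + H) ^ 6 / T *
        (gauss Δ v * (1 + |v|) ^ 6)) * ‖dirPoly N (line 0 (t + (x + v)))‖ₑ) +
        ENNReal.ofReal (C₅ * 3 ^ (k + 2) * E)) := by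
        refine setLIntegral_mono' measurableSet_Ioc fun x hx => ?_
        have hsplit : r * ((∫ v, gauss Δ v * xiReal (t + x + v) : ℝ) : ℂ) - r * P *
            (∫ v : ℝ, (gauss Δ v : ℂ) * (Complex.exp (Complex.I * (x + v : ℝ) * freq t) *
              dirPoly N (line 0 (t + x + v)))) =
            (∫ v : ℝ, (gauss Δ v : ℂ) * (r * (gammaWeight (line 0 (t + (x + v))) -
              P * Complex.exp (Complex.I * (x + v : ℝ) * freq t)) * dirPoly N (line 0 (t + (x + v))))) +
            r * τ x := by
          rw [integral_gauss_mul_xiReal_eq hΔ k N (t + x), mul_add, add_sub_right_comm, mul_assoc (r : ℂ),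
            ← mul_sub, ← integral_const_mul P, ← integral_sub
              (integrable_gauss_mul_gammaWeight_mul_dirPoly hΔ N _)
              ((integrable_gauss_mul_exp_mul_dirPoly hΔ N t x _).const_mul P), ← integral_const_mul]
          congr 1
          refine integral_congr_ae (ae_of_all _ fun v => ?_)
          simp only [add_assoc]
          ring
        rw [hsplit]
        refine (enorm_add_le _ _).trans (add_le_add ?_ ?_)
        · refine (enorm_integral_le_lintegral_enorm _).trans (lintegral_mono fun v => ?_)
          rw [enorm_mul, enorm_mul, ← mul_assoc]
          gcongr
          rw [← enorm_mul, ← ofReal_norm]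
          refine ENNReal.ofReal_le_ofReal ?_
          have hg := gauss_pos hΔ v
          rw [norm_mul, norm_mul, Complex.norm_real, Complex.norm_real, Real.norm_of_nonneg hr0,
            Real.norm_of_nonneg hg.le]
          have h3 := h2 t (by linarith [ht.1]) (x + v)
          have h4 : 1 + |x + v| ≤ (1 + H) * (1 + |v|) := by
            have := abs_add_le x v
            rw [abs_of_pos hx.1] at this
            nlinarith [hx.2, mul_nonneg hH (abs_nonneg v)]
          calc _ ≤ gauss Δ v * (C₂ * (1 + |x + v|) ^ 6 / t) := by
                  gcongr
            _ ≤ gauss Δ v * ((C₂ + C₅ * 3 ^ (k + 2)) * ((1 + H) * (1 + |v|)) ^ 6 / T) := by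
                  gcongr
                  · linarith [show 0 ≤ C₅ * 3 ^ (k + 2) by positivity]
                  · exact ht.1.le
            _ = _ := by rw [mul_pow]; ring
        · rw [← ofReal_norm]
          refine ENNReal.ofReal_le_ofReal ?_
          rw [norm_mul, Complex.norm_real, Real.norm_of_nonneg hr0]
          have h6 : 1 + |t + x| ≤ 3 * T₁ := by
            rw [abs_of_pos (by linarith [hx.1])]; linarith [hx.2, ht.1, ht.2]
          calc _ ≤ 1 * (C₅ * (Real.exp ((2 * k) ^ 2 / (2 * Δ ^ 2)) *
                  ((3 * T₁) ^ (k + 2) * (N : ℝ) ^ (3 / 2 - 2 * k : ℝ)))) := by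
                gcongr
                exact (h5 Δ (t + x) N hΔ hΔ' hN).trans (by gcongr)
            _ = _ := by rw [hE, mul_pow 3 T₁]; ring
    _ ≤ _ := by
        rw [lintegral_add_right _ measurable_const, setLIntegral_const, Real.volume_Ioc, sub_zero,
          ← ENNReal.ofReal_mul (by positivity)]
        refine add_le_add le_rfl (ENNReal.ofReal_le_ofReal ?_)
        have : 0 ≤ C₂ * (H * E) := by positivity
        linarith

theorem exists_lintegral_smoothXi_sub_le {k : ℕ} (hk : 1 ≤ k) : ∃ C : ℝ, 0 < C ∧
    ∀ (T T₁ Δ H : ℝ) (N : ℕ), 4 ≤ T → T ≤ T₁ → 0 < Δ → Δ ≤ 1 → 1 ≤ N → 0 ≤ H → H ≤ T →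
    ∫⁻ t in Set.Ioc T T₁, ‖((powWeight t * smoothXi Δ H t : ℝ) : ℂ) -
        powWeight t * gammaWeight (line 0 t) * smoothPoly N Δ H t‖ₑ ^ 2 ≤
      ENNReal.ofReal (C * ((H * (1 + H) ^ 6 / T) ^ 2 * polyMass N (T₁ - T) +
        (T₁ - T) * (H * (Real.exp ((2 * k) ^ 2 / (2 * Δ ^ 2)) *
        (T₁ ^ (k + 2) * (N : ℝ) ^ (3 / 2 - 2 * k : ℝ)))) ^ 2)) := by
  obtain ⟨C, hC, h⟩ := exists_enorm_smoothXi_sub_le hk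
  obtain ⟨C₁, hC₁, h1⟩ := exists_lintegral_gauss_le 6
  refine ⟨2 * C ^ 2 * (1 + C₁ ^ 2), by positivity, fun T T₁ Δ H N hT hTT hΔ hΔ' hN hH hHT => ?_⟩
  have hN0 : (0:ℝ) < N := by exact_mod_cast hN
  have hT0 : 0 < T := by linarith
  have hT₁ : 0 < T₁ := by linarith
  have hU : 0 ≤ T₁ - T := by linarith
  have hpm := polyMass_nonneg hN hU
  set E := Real.exp ((2 * k) ^ 2 / (2 * Δ ^ 2)) * (T₁ ^ (k + 2) * (N : ℝ) ^ (3 / 2 - 2 * k : ℝ))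
  have hE0 : 0 ≤ E := by positivity
  set A := C * (1 + H) ^ 6 / T with hA
  have hA0 : 0 ≤ A := by positivity
  set ν := (volume.restrict (Set.Ioc 0 H)).prod (volume : Measure ℝ) with hν
  have hkm : Measurable fun z : ℝ × ℝ => ENNReal.ofReal (A * (gauss Δ z.2 * (1 + |z.2|) ^ 6)) := by
    have := (continuous_gauss Δ).measurable
    fun_prop
  have hF : Measurable (Function.uncurry fun (t : ℝ) (z : ℝ × ℝ) => ‖dirPoly N (line 0 (t + (z.1 + z.2)))‖ₑ) := by
    have := (continuous_dirPoly_line N 0).measurable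
    exact (this.comp (by fun_prop : Measurable fun p : ℝ × ℝ × ℝ => p.1 + (p.2.1 + p.2.2))).enorm
  have hms := lintegral_sq_lintegral_le (μ := volume.restrict (Set.Ioc T T₁)) (ν := ν)
    (B := fun _ => ENNReal.ofReal (polyMass N (T₁ - T))) hkm hF
    (ae_of_all _ fun z => lintegral_dirPoly_sq_le N hT0 hTT le_rfl _)
  have hk1 : ∫⁻ z : ℝ × ℝ, ENNReal.ofReal (A * (gauss Δ z.2 * (1 + |z.2|) ^ 6)) ∂ν ≤
      ENNReal.ofReal (A * C₁ * H) := by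
    rw [hν, lintegral_prod _ hkm.aemeasurable]
    simp only [ENNReal.ofReal_mul hA0]
    rw [lintegral_const_mul' _ _ ENNReal.ofReal_ne_top, setLIntegral_const, Real.volume_Ioc, sub_zero,
      ENNReal.ofReal_mul (by positivity), ENNReal.ofReal_mul hA0]
    gcongr
    exact (h1 Δ hΔ hΔ').1
  rw [lintegral_mul_const _ hkm] at hms
  calc _ ≤ ∫⁻ t in Set.Ioc T T₁, 2 * ((∫⁻ z : ℝ × ℝ, ENNReal.ofReal (A * (gauss Δ z.2 * (1 + |z.2|) ^ 6)) *
        ‖dirPoly N (line 0 (t + (z.1 + z.2)))‖ₑ ∂ν) ^ 2 + ENNReal.ofReal (C * (H * E)) ^ 2) := by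
        refine setLIntegral_mono' measurableSet_Ioc fun t ht => ?_
        refine (pow_le_pow_left' (h T T₁ Δ H t N hT hΔ hΔ' hN hH hHT ht) 2).trans ?_
        refine (ennreal_add_sq_le _ _).trans_eq ?_
        rw [hν, lintegral_prod]
        exact (hkm.mul (hF.comp measurable_prodMk_left)).aemeasurable
    _ ≤ 2 * (ENNReal.ofReal (A * C₁ * H) * (ENNReal.ofReal (A * C₁ * H) * ENNReal.ofReal (polyMass N (T₁ - T))) +
        ENNReal.ofReal (C * (H * E)) ^ 2 * ENNReal.ofReal (T₁ - T)) := by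
        rw [lintegral_const_mul' _ _ (by norm_num), lintegral_add_right _ measurable_const,
          setLIntegral_const, Real.volume_Ioc]
        gcongr
        exact hms.trans (by gcongr)
    _ = ENNReal.ofReal (2 * ((A * C₁ * H) ^ 2 * polyMass N (T₁ - T) + (C * (H * E)) ^ 2 * (T₁ - T))) := by
        have e2 : (2 : ENNReal) = ENNReal.ofReal 2 := (ENNReal.ofReal_ofNat 2).symm
        have e3 : 0 ≤ A * C₁ * H := by positivity
        have e4 : 0 ≤ C * (H * E) := by positivity
        rw [e2, ← ENNReal.ofReal_pow e4, ← ENNReal.ofReal_mul e3, ← ENNReal.ofReal_mul e3,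
          ← ENNReal.ofReal_mul (sq_nonneg _), ← ENNReal.ofReal_add (by positivity) (by positivity),
          ← ENNReal.ofReal_mul (by norm_num)]
        congr 1; ring
    _ ≤ _ := by
        refine ENNReal.ofReal_le_ofReal ?_
        have e1 : A * C₁ * H = C * C₁ * (H * (1 + H) ^ 6 / T) := by rw [hA]; ring
        rw [e1]
        set Q := H * (1 + H) ^ 6 / T
        have e5 : 0 ≤ 2 * C ^ 2 * (Q ^ 2 * polyMass N (T₁ - T)) := by positivity
        have e6 : 0 ≤ 2 * C ^ 2 * C₁ ^ 2 * ((T₁ - T) * (H * E) ^ 2) := by positivity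
        linarith

lemma norm_cexp_I_mul_mul (x ω : ℝ) : ‖Complex.exp (Complex.I * x * ω)‖ = 1 := by
  rw [show Complex.I * x * ω = ((x * ω : ℝ) : ℂ) * Complex.I by push_cast; ring,
    Complex.norm_exp_ofReal_mul_I]

lemma norm_sincKernel_le {H : ℝ} (hH : 0 ≤ H) (ω : ℝ) : ‖sincKernel H ω‖ ≤ H := by
  have h := intervalIntegral.norm_integral_le_of_norm_le_const (a := 0) (b := H) (C := 1)
    (f := fun x : ℝ => Complex.exp (Complex.I * x * ω)) fun x _ => (norm_cexp_I_mul_mul x ω).le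
  simpa [sincKernel, abs_of_nonneg hH] using h

lemma sincKernel_eq {ω : ℝ} (hω : ω ≠ 0) (H : ℝ) :
    sincKernel H ω = (Complex.exp (Complex.I * H * ω) - 1) / (Complex.I * ω) := by
  have hc : Complex.I * (ω : ℂ) ≠ 0 := mul_ne_zero Complex.I_ne_zero (by exact_mod_cast hω)
  have h := integral_exp_mul_complex (a := 0) (b := H) hc
  rw [sincKernel]
  simp only [mul_right_comm Complex.I _ (ω : ℂ)]
  rw [h]; simp

lemma norm_sincKernel_sq {ω : ℝ} (hω : ω ≠ 0) (H : ℝ) :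
    ‖sincKernel H ω‖ ^ 2 = 2 * ((1 - Real.cos (H * ω)) / ω ^ 2) := by
  rw [sincKernel_eq hω, norm_div, div_pow, norm_mul, Complex.norm_I, one_mul, Complex.norm_real,
    Real.norm_eq_abs, sq_abs, ← Complex.normSq_eq_norm_sq,
    show Complex.I * H * ω = ((H * ω : ℝ) : ℂ) * Complex.I by push_cast; ring, Complex.exp_mul_I,
    Complex.normSq_apply]
  simp only [Complex.sub_re, Complex.sub_im, Complex.add_re, Complex.add_im, Complex.mul_re,
    Complex.mul_im, Complex.I_re, Complex.I_im, Complex.one_re, Complex.one_im,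
    ← Complex.ofReal_cos, ← Complex.ofReal_sin, Complex.ofReal_re, Complex.ofReal_im]
  rw [mul_div_assoc']
  congr 1
  nlinarith [Real.sin_sq_add_cos_sq (H * ω)]

lemma norm_smoothCoef_sq (Δ H ω : ℝ) :
    ‖smoothCoef Δ H ω‖ ^ 2 = ‖sincKernel H ω‖ ^ 2 * Real.exp (-(Δ ^ 2 * ω ^ 2)) := by
  rw [smoothCoef, norm_mul, mul_pow, Complex.norm_real, Real.norm_of_nonneg (Real.exp_pos _).le,
    ← Real.exp_nat_mul]
  congr 2; push_cast; ring

lemma norm_smoothCoef_le {H : ℝ} (hH : 0 ≤ H) (Δ ω : ℝ) : ‖smoothCoef Δ H ω‖ ≤ H := by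
  rw [smoothCoef, norm_mul, Complex.norm_real, Real.norm_of_nonneg (Real.exp_pos _).le]
  have h1 : Real.exp (-(Δ ^ 2 * ω ^ 2 / 2)) ≤ 1 := Real.exp_le_one_iff.2 (by
    have : 0 ≤ Δ ^ 2 * ω ^ 2 := by positivity
    linarith)
  calc _ ≤ H * 1 := mul_le_mul (norm_sincKernel_le hH ω) h1 (Real.exp_pos _).le hH
    _ = H := mul_one H

lemma norm_smoothCoef_sq_le_div {ω : ℝ} (hω : ω ≠ 0) (Δ H : ℝ) :
    ‖smoothCoef Δ H ω‖ ^ 2 ≤ 4 * (1 / ω ^ 2) := by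
  have h1 : Real.exp (-(Δ ^ 2 * ω ^ 2)) ≤ 1 := Real.exp_le_one_iff.2 (by
    have : 0 ≤ Δ ^ 2 * ω ^ 2 := by positivity
    linarith)
  rw [norm_smoothCoef_sq]
  have h2 : ‖sincKernel H ω‖ ^ 2 ≤ 4 * (1 / ω ^ 2) := by
    rw [norm_sincKernel_sq hω, ← mul_div_assoc, ← mul_div_assoc]
    refine div_le_div_of_nonneg_right ?_ (sq_nonneg ω)
    linarith [Real.neg_one_le_cos (H * ω)]
  calc _ ≤ 4 * (1 / ω ^ 2) * 1 := mul_le_mul h2 h1 (Real.exp_pos _).le (by positivity)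
    _ = _ := mul_one _

/-- The derivative of `sincKernel H`. -/
noncomputable def sincKernel' (H ω : ℝ) : ℂ :=
  ∫ x in (0:ℝ)..H, Complex.exp (Complex.I * x * ω) * (Complex.I * x)

lemma hasDerivAt_sincKernel (H ω : ℝ) : HasDerivAt (sincKernel H) (sincKernel' H ω) ω := by
  refine (intervalIntegral.hasDerivAt_integral_of_dominated_loc_of_deriv_le (𝕜 := ℝ)
    (F := fun (ω x : ℝ) => Complex.exp (Complex.I * x * ω))
    (F' := fun (ω x : ℝ) => Complex.exp (Complex.I * x * ω) * (Complex.I * x))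
    (bound := fun x => |x|) (Metric.ball_mem_nhds ω one_pos) ?_ ?_ ?_ ?_ ?_ ?_).2
  · exact Eventually.of_forall fun y => Continuous.aestronglyMeasurable (by fun_prop)
  · exact Continuous.intervalIntegrable (by fun_prop) _ _
  · exact Continuous.aestronglyMeasurable (by fun_prop)
  · refine ae_of_all _ fun x _ y _ => ?_
    rw [norm_mul, norm_cexp_I_mul_mul, one_mul, norm_mul, Complex.norm_I, one_mul, Complex.norm_real,
      Real.norm_eq_abs]
  · exact continuous_abs.intervalIntegrable _ _
  · refine ae_of_all _ fun x _ y _ => ?_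
    have h : HasDerivAt (fun y : ℝ => Complex.I * x * (y : ℂ)) (Complex.I * x) y := by
      simpa using (Complex.ofRealCLM.hasDerivAt (x := y)).const_mul (Complex.I * x)
    exact h.cexp

lemma norm_sincKernel'_le {H : ℝ} (hH : 0 ≤ H) (ω : ℝ) : ‖sincKernel' H ω‖ ≤ H ^ 2 := by
  have h := intervalIntegral.norm_integral_le_of_norm_le_const (a := 0) (b := H) (C := H)
    (f := fun x : ℝ => Complex.exp (Complex.I * x * ω) * (Complex.I * x)) fun x hx => by
      rw [Set.uIoc_of_le hH] at hx
      rw [norm_mul, norm_cexp_I_mul_mul, one_mul, norm_mul, Complex.norm_I, one_mul, Complex.norm_real,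
        Real.norm_of_nonneg hx.1.le]
      exact hx.2
  rw [sub_zero, abs_of_nonneg hH] at h
  rw [sincKernel', sq]; exact h

lemma continuous_sincKernel (H : ℝ) : Continuous (sincKernel H) :=
  continuous_iff_continuousAt.2 fun ω => (hasDerivAt_sincKernel H ω).continuousAt

lemma continuous_sincKernel' (H : ℝ) : Continuous (sincKernel' H) := by
  unfold sincKernel'
  exact intervalIntegral.continuous_parametric_intervalIntegral_of_continuous' (by fun_prop) 0 H

/-- The derivative of `smoothCoef Δ H`. -/
noncomputable def smoothCoef' (Δ H ω : ℝ) : ℂ :=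
  sincKernel' H ω * (Real.exp (-(Δ ^ 2 * ω ^ 2 / 2)) : ℝ) +
    sincKernel H ω * (Real.exp (-(Δ ^ 2 * ω ^ 2 / 2)) * (-(Δ ^ 2 * ω)) : ℝ)

lemma hasDerivAt_smoothCoef (Δ H ω : ℝ) : HasDerivAt (smoothCoef Δ H) (smoothCoef' Δ H ω) ω := by
  have h : HasDerivAt (fun ω : ℝ => Real.exp (-(Δ ^ 2 * ω ^ 2 / 2)))
      (Real.exp (-(Δ ^ 2 * ω ^ 2 / 2)) * (-(Δ ^ 2 * ω))) ω := by
    have h0 : HasDerivAt (fun ω : ℝ => -(Δ ^ 2 * ω ^ 2 / 2)) (-(Δ ^ 2 * ω)) ω := by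
      exact (((hasDerivAt_pow 2 ω).const_mul (Δ ^ 2)).div_const 2).neg.congr_deriv (by norm_num; ring)
    exact h0.exp
  exact (hasDerivAt_sincKernel H ω).mul h.ofReal_comp

lemma continuous_smoothCoef (Δ H : ℝ) : Continuous (smoothCoef Δ H) :=
  continuous_iff_continuousAt.2 fun ω => (hasDerivAt_smoothCoef Δ H ω).continuousAt

lemma continuous_smoothCoef' (Δ H : ℝ) : Continuous (smoothCoef' Δ H) := by
  have h1 := continuous_sincKernel H
  have h2 := continuous_sincKernel' H
  unfold smoothCoef'
  fun_prop

lemma norm_smoothCoef'_le {Δ H : ℝ} (hΔ : 0 < Δ) (hΔ' : Δ ≤ 1) (hH : 0 ≤ H) (ω : ℝ) :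
    ‖smoothCoef' Δ H ω‖ ≤ H ^ 2 + H := by
  have h1 : Real.exp (-(Δ ^ 2 * ω ^ 2 / 2)) ≤ 1 := Real.exp_le_one_iff.2 (by
    have : 0 ≤ Δ ^ 2 * ω ^ 2 := by positivity
    linarith)
  have h2 : Real.exp (-(Δ ^ 2 * ω ^ 2 / 2)) * (Δ ^ 2 * |ω|) ≤ 1 := by
    rw [Real.exp_neg, inv_mul_le_iff₀ (Real.exp_pos _), mul_one]
    have := Real.add_one_le_exp (Δ ^ 2 * ω ^ 2 / 2)
    have e : Δ ^ 2 * ω ^ 2 = (Δ * |ω|) ^ 2 := by rw [mul_pow, sq_abs]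
    have h3 : Δ ^ 2 * |ω| ≤ Δ * |ω| := by
      have := mul_nonneg hΔ.le (abs_nonneg ω)
      nlinarith
    nlinarith [sq_nonneg (Δ * |ω| - 1)]
  refine (norm_add_le _ _).trans (add_le_add ?_ ?_)
  · rw [norm_mul, Complex.norm_real, Real.norm_of_nonneg (Real.exp_pos _).le]
    calc _ ≤ H ^ 2 * 1 := mul_le_mul (norm_sincKernel'_le hH ω) h1 (Real.exp_pos _).le (sq_nonneg H)
      _ = _ := mul_one _
  · rw [norm_mul, Complex.norm_real, norm_mul, Real.norm_of_nonneg (Real.exp_pos _).le, norm_neg,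
      norm_mul, Real.norm_of_nonneg (sq_nonneg Δ), Real.norm_eq_abs]
    calc _ ≤ H * 1 := mul_le_mul (norm_sincKernel_le hH ω) h2 (by positivity) hH
      _ = _ := mul_one _

lemma abs_norm_smoothCoef_sq_sub_le {Δ H : ℝ} (hΔ : 0 < Δ) (hΔ' : Δ ≤ 1) (hH : 0 ≤ H) (x y : ℝ) :
    |‖smoothCoef Δ H x‖ ^ 2 - ‖smoothCoef Δ H y‖ ^ 2| ≤ 2 * H * (H ^ 2 + H) * |x - y| := by
  have h1 : ‖smoothCoef Δ H x - smoothCoef Δ H y‖ ≤ (H ^ 2 + H) * ‖x - y‖ :=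
    convex_univ.norm_image_sub_le_of_norm_hasDerivWithin_le
      (fun ω _ => (hasDerivAt_smoothCoef Δ H ω).hasDerivWithinAt)
      (fun ω _ => norm_smoothCoef'_le hΔ hΔ' hH ω) (Set.mem_univ y) (Set.mem_univ x)
  have h2 := abs_norm_sub_norm_le (smoothCoef Δ H x) (smoothCoef Δ H y)
  have h3 := norm_smoothCoef_le hH Δ x
  have h4 := norm_smoothCoef_le hH Δ y
  rw [sq_sub_sq, abs_mul, abs_of_nonneg (by positivity)]
  calc _ ≤ (2 * H) * ((H ^ 2 + H) * ‖x - y‖) :=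
        mul_le_mul (by linarith) (h2.trans h1) (abs_nonneg _) (by positivity)
    _ = _ := by rw [Real.norm_eq_abs]; ring

lemma integral_cos_mul_exp {Δ : ℝ} (hΔ : 0 < Δ) (z : ℝ) :
    ∫ ω : ℝ, Real.cos (z * ω) * Real.exp (-(Δ ^ 2 * ω ^ 2)) = 2 * Real.pi * gauss (Real.sqrt 2 * Δ) z := by
  have h := fourierIntegral_gaussian (b := ((Δ ^ 2 : ℝ) : ℂ))
    (by rw [Complex.ofReal_re]; positivity) z
  have h2 : ((Real.pi : ℂ) / ((Δ ^ 2 : ℝ) : ℂ)) ^ (1 / 2 : ℂ) *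
      Complex.exp (-(z : ℂ) ^ 2 / (4 * ((Δ ^ 2 : ℝ) : ℂ))) =
      ((2 * Real.pi * gauss (Real.sqrt 2 * Δ) z : ℝ) : ℂ) := by
    rw [← Complex.ofReal_div, show (1 / 2 : ℂ) = ((1 / 2 : ℝ) : ℂ) by push_cast; rfl,
      ← Complex.ofReal_cpow (by positivity), ← Real.sqrt_eq_rpow,
      show -(z : ℂ) ^ 2 / (4 * ((Δ ^ 2 : ℝ) : ℂ)) = ((-z ^ 2 / (4 * Δ ^ 2) : ℝ) : ℂ) by push_cast; ring,
      ← Complex.ofReal_exp, ← Complex.ofReal_mul]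
    congr 1
    have hs : Real.sqrt 2 ^ 2 = 2 := Real.sq_sqrt (by norm_num)
    have hp : Real.sqrt Real.pi ^ 2 = Real.pi := Real.sq_sqrt Real.pi_pos.le
    have hs0 : 0 < Real.sqrt 2 := Real.sqrt_pos.2 (by norm_num)
    have hp0 : 0 < Real.sqrt Real.pi := Real.sqrt_pos.2 Real.pi_pos
    rw [gauss, Real.sqrt_div Real.pi_pos.le, Real.sqrt_sq hΔ.le, Real.sqrt_mul (by norm_num), mul_pow, hs,
      show -(1 / (2 * (2 * Δ ^ 2))) * z ^ 2 = -z ^ 2 / (4 * Δ ^ 2) by field_simp; ring]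
    field_simp
    rw [hs, hp, mul_comm]
  rw [h2] at h
  have h3 := congrArg Complex.re h
  rw [Complex.ofReal_re] at h3
  rw [← h3]
  have hi : Integrable fun ω : ℝ => Complex.exp (Complex.I * z * ω) *
      Complex.exp (-((Δ ^ 2 : ℝ) : ℂ) * (ω : ℂ) ^ 2) := by
    by_contra hn
    rw [integral_undef hn] at h
    have hg := gauss_pos (Δ := Real.sqrt 2 * Δ) (by positivity) z
    have : (2 * Real.pi * gauss (Real.sqrt 2 * Δ) z : ℝ) ≠ 0 := by positivity
    exact this (by exact_mod_cast h.symm)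
  have h4 : (∫ ω : ℝ, Complex.exp (Complex.I * z * ω) *
      Complex.exp (-((Δ ^ 2 : ℝ) : ℂ) * (ω : ℂ) ^ 2)).re = ∫ ω : ℝ, (Complex.exp (Complex.I * z * ω) *
      Complex.exp (-((Δ ^ 2 : ℝ) : ℂ) * (ω : ℂ) ^ 2)).re := (integral_re hi).symm
  rw [h4]
  refine integral_congr_ae (ae_of_all _ fun ω => ?_)
  have e : (-((Δ ^ 2 : ℝ) : ℂ) * (ω : ℂ) ^ 2) = ((-(Δ ^ 2 * ω ^ 2) : ℝ) : ℂ) := by push_cast; ring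
  simp only [e]
  rw [show Complex.I * z * ω = ((z * ω : ℝ) : ℂ) * Complex.I by push_cast; ring, ← Complex.ofReal_exp,
    Complex.re_mul_ofReal, Complex.exp_ofReal_mul_I_re]

lemma integral_sub_mul_cos {ω : ℝ} (hω : ω ≠ 0) (H : ℝ) :
    ∫ z in (0:ℝ)..H, (H - z) * Real.cos (z * ω) = (1 - Real.cos (H * ω)) / ω ^ 2 := by
  have h : ∀ z ∈ Set.uIcc 0 H, HasDerivAt
      (fun z => (H - z) * Real.sin (z * ω) / ω - Real.cos (z * ω) / ω ^ 2) ((H - z) * Real.cos (z * ω)) z := by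
    intro z _
    have h0 : HasDerivAt (fun z : ℝ => z * ω) ω z := by simpa using (hasDerivAt_id z).mul_const ω
    have h1 : HasDerivAt (fun z : ℝ => H - z) (-1) z := by simpa using (hasDerivAt_id z).const_sub H
    refine (((h1.mul h0.sin).div_const ω).sub (h0.cos.div_const (ω ^ 2))).congr_deriv ?_
    field_simp
    ring
  rw [intervalIntegral.integral_eq_sub_of_hasDerivAt h (Continuous.intervalIntegrable (by fun_prop) _ _)]
  simp
  ring

lemma integrable_norm_smoothCoef_sq {Δ H : ℝ} (hΔ : 0 < Δ) (hH : 0 ≤ H) :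
    Integrable fun ω => ‖smoothCoef Δ H ω‖ ^ 2 := by
  refine ((integrable_exp_neg_mul_sq (b := Δ ^ 2) (by positivity)).const_mul (H ^ 2)).mono'
    ((continuous_smoothCoef Δ H).norm.pow 2).aestronglyMeasurable (ae_of_all _ fun ω => ?_)
  rw [Real.norm_of_nonneg (by positivity), norm_smoothCoef_sq, neg_mul]
  gcongr
  exact norm_sincKernel_le hH ω

lemma integral_norm_smoothCoef_sq {Δ H : ℝ} (hΔ : 0 < Δ) (hH : 0 ≤ H) :
    ∫ ω, ‖smoothCoef Δ H ω‖ ^ 2 =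
      4 * Real.pi * ∫ z in Set.Ioc 0 H, (H - z) * gauss (Real.sqrt 2 * Δ) z := by
  have h1 : ∀ᵐ ω : ℝ, ‖smoothCoef Δ H ω‖ ^ 2 = 2 * ∫ z in Set.Ioc 0 H,
      (H - z) * (Real.cos (z * ω) * Real.exp (-(Δ ^ 2 * ω ^ 2))) := by
    filter_upwards [Measure.ae_ne volume (0:ℝ)] with ω hω
    rw [norm_smoothCoef_sq, norm_sincKernel_sq hω, ← integral_sub_mul_cos hω,
      intervalIntegral.integral_of_le hH, mul_assoc, ← integral_mul_const]
    simp only [mul_assoc]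
  rw [integral_congr_ae h1, integral_const_mul, integral_integral_swap]
  · simp only [integral_const_mul, integral_cos_mul_exp hΔ]
    rw [← integral_const_mul, ← integral_const_mul]
    refine integral_congr_ae (ae_of_all _ fun z => ?_)
    ring
  · have : IsFiniteMeasure (volume.restrict (Set.Ioc 0 H)) := ⟨by simp⟩
    have hb := (integrable_exp_neg_mul_sq (b := Δ ^ 2) (by positivity)).mul_prod
      (integrable_const (μ := volume.restrict (Set.Ioc 0 H)) H)
    refine hb.mono' (Continuous.aestronglyMeasurable (by unfold Function.uncurry; fun_prop)) ?_
    have hm : ∀ᵐ p : ℝ × ℝ ∂(volume : Measure ℝ).prod (volume.restrict (Set.Ioc 0 H)), p.2 ∈ Set.Ioc 0 H :=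
      Measure.quasiMeasurePreserving_snd.ae (ae_restrict_mem measurableSet_Ioc)
    filter_upwards [hm] with p hp
    simp only [Function.uncurry, norm_mul, Real.norm_eq_abs]
    rw [abs_of_nonneg (by linarith [hp.2] : 0 ≤ H - p.2), abs_of_pos (Real.exp_pos _), neg_mul]
    calc _ ≤ H * (1 * Real.exp (-(Δ ^ 2 * p.1 ^ 2))) := by
          gcongr
          · linarith [hp.1]
          · exact Real.abs_cos_le_one _
      _ = _ := by ring

lemma integral_Ioi_gauss {Δ : ℝ} (hΔ : 0 < Δ) : ∫ v in Set.Ioi 0, gauss Δ v = 1 / 2 := by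
  have h := integral_comp_abs (f := gauss Δ)
  have e : ∀ v, gauss Δ |v| = gauss Δ v := fun v => by simp [gauss]
  simp only [e] at h
  rw [integral_gauss hΔ] at h
  linarith

theorem exists_abs_integral_norm_smoothCoef_sq_sub_le : ∃ C : ℝ, 0 < C ∧ ∀ Δ H : ℝ, 0 < Δ → Δ ≤ 1 / 2 →
    0 ≤ H → |(∫ ω, ‖smoothCoef Δ H ω‖ ^ 2) - 2 * Real.pi * H| ≤ C := by
  obtain ⟨C, hC, h⟩ := exists_lintegral_gauss_le 1
  refine ⟨4 * Real.pi * C, by positivity, fun Δ H hΔ hΔ' hH => ?_⟩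
  set δ := Real.sqrt 2 * Δ with hδ
  have hδ0 : 0 < δ := by positivity
  have hδ1 : δ ≤ 1 := by
    have : Real.sqrt 2 ≤ 2 := by rw [Real.sqrt_le_left (by norm_num)]; norm_num
    nlinarith
  have hi1 : Integrable fun v => gauss δ v * (1 + |v|) ^ 1 := by
    simpa using integrable_gauss_mul_exp hδ0 1 0
  have hi0 : Integrable fun v => gauss δ v := by simpa using integrable_gauss_mul_exp hδ0 0 0
  have hiv : Integrable fun v => v * gauss δ v := by
    refine hi1.mono' (continuous_id.mul (continuous_gauss δ)).aestronglyMeasurable (ae_of_all _ fun v => ?_)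
    rw [norm_mul, Real.norm_of_nonneg (gauss_pos hδ0 v).le, Real.norm_eq_abs, pow_one]
    nlinarith [gauss_pos hδ0 v]
  have hb : ∫ v, gauss δ v * (1 + |v|) ^ 1 ≤ C := by
    rw [integral_eq_lintegral_of_nonneg_ae
      (ae_of_all _ fun v => mul_nonneg (gauss_pos hδ0 v).le (by positivity)) hi1.aestronglyMeasurable]
    exact ENNReal.toReal_le_of_le_ofReal hC.le (h δ hδ0 hδ1).1
  have hz : ∫ v in Set.Ioi 0, v * gauss δ v ≤ C := by
    refine le_trans ?_ ((setIntegral_le_integral (s := Set.Ioi 0) hi1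
      (ae_of_all _ fun v => mul_nonneg (gauss_pos hδ0 v).le (by positivity))).trans hb)
    refine setIntegral_mono_on hiv.integrableOn hi1.integrableOn measurableSet_Ioi fun v hv => ?_
    rw [abs_of_pos hv, pow_one]
    nlinarith [gauss_pos hδ0 v]
  have hH' : ∫ v in Set.Ioi 0, (H - v) * gauss δ v = H / 2 - ∫ v in Set.Ioi 0, v * gauss δ v := by
    simp only [sub_mul]
    rw [integral_sub (hi0.const_mul H).integrableOn hiv.integrableOn, integral_const_mul,
      integral_Ioi_gauss hδ0]
    ring
  have hiH : Integrable fun v => (H - v) * gauss δ v := by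
    simp only [sub_mul]; exact (hi0.const_mul H).sub hiv
  have hlow : H / 2 - C ≤ ∫ z in Set.Ioc 0 H, (H - z) * gauss δ z := by
    have hsplit : ∫ v in Set.Ioi 0, (H - v) * gauss δ v = (∫ v in Set.Ioc 0 H, (H - v) * gauss δ v) +
        ∫ v in Set.Ioi H, (H - v) * gauss δ v := by
      rw [← setIntegral_union (Set.Ioc_disjoint_Ioi le_rfl) measurableSet_Ioi hiH.integrableOn
        hiH.integrableOn, Set.Ioc_union_Ioi_eq_Ioi hH]
    have hneg : ∫ v in Set.Ioi H, (H - v) * gauss δ v ≤ 0 :=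
      setIntegral_nonpos measurableSet_Ioi fun v hv =>
        mul_nonpos_of_nonpos_of_nonneg (by linarith [Set.mem_Ioi.1 hv]) (gauss_pos hδ0 v).le
    linarith
  have hup : ∫ z in Set.Ioc 0 H, (H - z) * gauss δ z ≤ H / 2 := by
    calc _ ≤ ∫ z in Set.Ioc 0 H, H * gauss δ z := by
          refine setIntegral_mono_on hiH.integrableOn (hi0.const_mul H).integrableOn measurableSet_Ioc
            fun v hv => ?_
          nlinarith [gauss_pos hδ0 v, hv.1]
      _ ≤ ∫ z in Set.Ioi 0, H * gauss δ z :=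
          setIntegral_mono_set (hi0.const_mul H).integrableOn
            (ae_of_all _ fun v => mul_nonneg hH (gauss_pos hδ0 v).le)
            (Set.Ioc_subset_Ioi_self).eventuallyLE
      _ = H / 2 := by rw [integral_const_mul, integral_Ioi_gauss hδ0]; ring
  rw [integral_norm_smoothCoef_sq hΔ hH, abs_le]
  have hpi := Real.pi_pos
  constructor <;> nlinarith

lemma setIntegral_Ioi_le_of_le_inv_sq {f : ℝ → ℝ} (hf : Integrable f) {K R : ℝ} (hR : 0 < R)
    (h : ∀ ω, 0 < ω → f ω ≤ K * (1 / ω ^ 2)) : ∫ ω in Set.Ioi R, f ω ≤ K / R := by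
  have e : ∀ ω : ℝ, 0 < ω → 1 / ω ^ 2 = ω ^ (-2 : ℝ) := fun ω hω => by
    rw [Real.rpow_neg hω.le, Real.rpow_two, one_div]
  have h1 := integral_Ioi_rpow_of_lt (a := -2) (by norm_num) hR
  calc _ ≤ ∫ ω in Set.Ioi R, K * ω ^ (-2 : ℝ) := by
        refine setIntegral_mono_on hf.integrableOn
          ((integrableOn_Ioi_rpow_of_lt (by norm_num) hR).const_mul K) measurableSet_Ioi fun ω hω => ?_
        have hω0 : 0 < ω := hR.trans hω
        rw [← e ω hω0]; exact h ω hω0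
    _ = K / R := by
        rw [integral_const_mul, h1, show (-2 : ℝ) + 1 = -1 by norm_num, Real.rpow_neg hR.le, Real.rpow_one]
        ring

lemma abs_integral_smoothCoef_sub_le {Δ H A B R : ℝ} (hΔ : 0 < Δ) (hH : 0 ≤ H) (hR : 0 < R)
    (hA : A ≤ -R) (hB : R ≤ B) :
    |(∫ ω in A..B, ‖smoothCoef Δ H ω‖ ^ 2) - ∫ ω, ‖smoothCoef Δ H ω‖ ^ 2| ≤ 8 / R := by
  have hi := integrable_norm_smoothCoef_sq hΔ hH
  have h1 := intervalIntegral.integral_Iic_sub_Iic (a := A) (b := B) hi.integrableOn hi.integrableOn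
  have h2 := intervalIntegral.integral_Iic_add_Ioi (b := B) hi.integrableOn hi.integrableOn
  have h3 : ∫ ω in Set.Ioi B, ‖smoothCoef Δ H ω‖ ^ 2 ≤ 4 / B :=
    setIntegral_Ioi_le_of_le_inv_sq hi (by linarith) fun ω hω => norm_smoothCoef_sq_le_div hω.ne' Δ H
  have h4 : ∫ ω in Set.Ioi (-A), ‖smoothCoef Δ H (-ω)‖ ^ 2 ≤ 4 / (-A) :=
    setIntegral_Ioi_le_of_le_inv_sq hi.comp_neg (by linarith) fun ω hω => by
      simpa using norm_smoothCoef_sq_le_div (neg_ne_zero.2 hω.ne') Δ H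
  rw [integral_comp_neg_Ioi (-A) (fun ω => ‖smoothCoef Δ H ω‖ ^ 2), neg_neg] at h4
  have h5 : 4 / B ≤ 4 / R := by gcongr
  have h6 : 4 / (-A) ≤ 4 / R := by gcongr; linarith
  have h7 : 0 ≤ ∫ ω in Set.Ioi B, ‖smoothCoef Δ H ω‖ ^ 2 := integral_nonneg fun _ => by positivity
  have h8 : 0 ≤ ∫ ω in Set.Iic A, ‖smoothCoef Δ H ω‖ ^ 2 := integral_nonneg fun _ => by positivity
  have h9 : 8 / R = 4 / R + 4 / R := by ring
  rw [abs_le]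
  constructor <;> linarith

/-- Comparison of a logarithmic sum with an integral, for bounded Lipschitz weights. -/
lemma abs_sum_sub_integral_log_le {F : ℝ → ℝ} (hF : Continuous F) {B K : ℝ} (hB : ∀ x, |F x| ≤ B)
    (hK : ∀ x y, |F x - F y| ≤ K * |x - y|) (l : ℝ) {M N : ℕ} (hM : 1 ≤ M) (hMN : M ≤ N) :
    |(∑ n ∈ Finset.Ico M N, 1 / ((n + 1 : ℕ) : ℝ) * F (l - Real.log (n + 1 : ℕ))) -
      ∫ ω in (l - Real.log N)..(l - Real.log M), F ω| ≤ 2 * (K + B) / M := by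
  have hK0 : 0 ≤ K := by simpa using (abs_nonneg _).trans (hK 1 0)
  have hB0 : 0 ≤ B := (abs_nonneg _).trans (hB 0)
  set f : ℝ → ℝ := fun x => F (l - Real.log x) * (1 / x) with hf
  have hM0 : (0:ℝ) < M := by exact_mod_cast hM
  have hcont : ∀ a b : ℝ, 0 < a → a ≤ b → ContinuousOn f (Set.uIcc a b) := by
    intro a b ha hab x hx
    rw [Set.uIcc_of_le hab] at hx
    have hx0 : x ≠ 0 := by linarith [hx.1]
    have : ContinuousAt f x := by
      refine (hF.continuousAt.comp (continuousAt_const.sub (Real.continuousAt_log hx0))).mul ?_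
      exact continuousAt_const.div continuousAt_id hx0
    exact this.continuousWithinAt
  have hsub : ∫ x in (M:ℝ)..N, f x = ∫ ω in (l - Real.log N)..(l - Real.log M), F ω := by
    have h := intervalIntegral.integral_comp_mul_deriv (a := (M:ℝ)) (b := N)
      (f := fun x => l - Real.log x) (f' := fun x => -(1 / x)) (g := F) ?_ ?_ hF
    · rw [intervalIntegral.integral_symm (l - Real.log M), ← h, ← intervalIntegral.integral_neg]
      refine intervalIntegral.integral_congr fun x _ => ?_
      simp [hf]
    · intro x hx
      rw [Set.uIcc_of_le (by exact_mod_cast hMN)] at hx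
      have hx0 : x ≠ 0 := by linarith [hx.1]
      simpa using (Real.hasDerivAt_log hx0).const_sub l
    · intro x hx
      rw [Set.uIcc_of_le (by exact_mod_cast hMN)] at hx
      have hx0 : x ≠ 0 := by linarith [hx.1]
      exact (continuousAt_const.div continuousAt_id hx0).neg.continuousWithinAt
  have hpos : ∀ n ∈ Finset.Ico M N, (1:ℝ) ≤ n := fun n hn => by
    exact_mod_cast hM.trans (Finset.mem_Ico.1 hn).1
  have hintgr : ∀ n ∈ Finset.Ico M N, IntervalIntegrable f volume n ((n + 1 : ℕ) : ℝ) := fun n hn =>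
    (hcont _ _ (by linarith [hpos n hn]) (by push_cast; linarith)).intervalIntegrable
  rw [← hsub, ← intervalIntegral.sum_integral_adjacent_intervals_Ico (a := fun n : ℕ => (n : ℝ)) hMN
    (fun k hk => hintgr k (by simpa using hk)), ← Finset.sum_sub_distrib]
  have hterm : ∀ n ∈ Finset.Ico M N, |1 / ((n + 1 : ℕ) : ℝ) * F (l - Real.log (n + 1 : ℕ)) -
      ∫ x in (n:ℝ)..((n + 1 : ℕ) : ℝ), f x| ≤ 2 * (K + B) * (1 / n - 1 / ((n + 1 : ℕ) : ℝ)) := by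
    intro n hn
    have hn1 := hpos n hn
    have hconst : 1 / ((n + 1 : ℕ) : ℝ) * F (l - Real.log (n + 1 : ℕ)) =
        ∫ _ in (n:ℝ)..((n + 1 : ℕ) : ℝ), f (n + 1 : ℕ) := by
      rw [intervalIntegral.integral_const, hf]; push_cast; simp; ring
    rw [hconst, ← intervalIntegral.integral_sub intervalIntegrable_const (hintgr n hn)]
    have h := intervalIntegral.norm_integral_le_of_norm_le_const (a := (n:ℝ)) (b := ((n + 1 : ℕ) : ℝ))
      (C := 2 * (K + B) * (1 / n - 1 / ((n + 1 : ℕ) : ℝ)))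
      (f := fun x => f (n + 1 : ℕ) - f x) fun x hx => ?_
    · rw [show ((n + 1 : ℕ) : ℝ) - n = 1 by push_cast; ring, abs_one, mul_one] at h
      exact h
    · push_cast at hx ⊢
      rw [Set.uIoc_of_le (by linarith)] at hx
      have hx0 : 0 < x := by linarith [hx.1]
      have hlog : |Real.log x - Real.log (n + 1)| ≤ 1 / n := by
        rw [abs_sub_comm, ← Real.log_div (by positivity) hx0.ne', abs_of_nonneg
          (Real.log_nonneg (by rw [le_div_iff₀ hx0]; linarith [hx.2]))]
        refine (Real.log_le_sub_one_of_pos (by positivity)).trans ?_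
        rw [div_sub_one hx0.ne']
        exact div_le_div₀ zero_le_one (by linarith [hx.1]) (by linarith) hx.1.le
      have hinv : |1 / ((n:ℝ) + 1) - 1 / x| ≤ 1 / n * (1 / n) := by
        rw [abs_sub_comm, abs_of_nonneg (sub_nonneg.2 (one_div_le_one_div_of_le hx0 hx.2)),
          div_sub_div _ _ hx0.ne' (by positivity), div_mul_div_comm]
        refine div_le_div₀ (by norm_num) (by linarith [hx.1]) (by positivity) ?_
        exact mul_le_mul hx.1.le (by linarith) (by linarith) hx0.le
      have hsq : 1 / (n:ℝ) * (1 / n) ≤ 2 * (1 / n - 1 / (n + 1)) := by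
        rw [div_sub_div _ _ (by positivity) (by positivity), div_mul_div_comm, mul_div_assoc',
          div_le_div_iff₀ (by positivity) (by positivity)]
        nlinarith
      have hF1 : |F (l - Real.log (n + 1)) - F (l - Real.log x)| ≤ K * (1 / n) := by
        refine (hK _ _).trans (mul_le_mul_of_nonneg_left ?_ hK0)
        rw [show l - Real.log (n + 1) - (l - Real.log x) = Real.log x - Real.log (n + 1) by ring]
        exact hlog
      have e : F (l - Real.log (n + 1)) * (1 / ((n:ℝ) + 1)) - F (l - Real.log x) * (1 / x) =
          (F (l - Real.log (n + 1)) - F (l - Real.log x)) * (1 / x) +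
          F (l - Real.log (n + 1)) * (1 / ((n:ℝ) + 1) - 1 / x) := by ring
      have hx1 : 1 / x ≤ 1 / (n:ℝ) := one_div_le_one_div_of_le (by linarith) hx.1.le
      simp only [hf]
      rw [e]
      refine (norm_add_le _ _).trans ?_
      rw [norm_mul, norm_mul, Real.norm_eq_abs, Real.norm_eq_abs, Real.norm_eq_abs, Real.norm_eq_abs,
        abs_of_pos (by positivity : 0 < 1 / x)]
      calc _ ≤ K * (1 / n) * (1 / n) + B * (1 / n * (1 / n)) := by
            refine add_le_add (mul_le_mul hF1 hx1 (by positivity) (by positivity))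
              (mul_le_mul (hB _) hinv (abs_nonneg _) hB0)
        _ = (K + B) * (1 / n * (1 / n)) := by ring
        _ ≤ (K + B) * (2 * (1 / n - 1 / (n + 1))) := mul_le_mul_of_nonneg_left hsq (by positivity)
        _ = _ := by ring
  refine (Finset.abs_sum_le_sum_abs _ _).trans ((Finset.sum_le_sum hterm).trans ?_)
  rw [← Finset.mul_sum, div_eq_mul_one_div (2 * (K + B))]
  refine mul_le_mul_of_nonneg_left ?_ (by positivity)
  have htel := Finset.sum_Ico_sub (fun n : ℕ => -(1 / (n : ℝ))) hMN
  have e : ∀ n : ℕ, 1 / (n:ℝ) - 1 / ((n + 1 : ℕ) : ℝ) = -(1 / ((n + 1 : ℕ) : ℝ)) - -(1 / (n:ℝ)) := fun n => by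
    ring
  simp only [e]
  rw [htel]
  have : (0:ℝ) ≤ 1 / (N:ℝ) := by positivity
  linarith

theorem exists_abs_diagonal_sub_le : ∃ C : ℝ, 0 < C ∧ ∀ (Δ H l R : ℝ) (M N : ℕ), 0 < Δ → Δ ≤ 1 / 2 →
    0 ≤ H → 0 < R → 1 ≤ M → M ≤ N → Real.log M + R ≤ l → l + R ≤ Real.log N →
    |(∑ n ∈ Finset.Icc 1 N, 1 / (n : ℝ) * ‖smoothCoef Δ H (l - Real.log n)‖ ^ 2) - 2 * Real.pi * H| ≤
      C * (1 + (1 + Real.log M) / R ^ 2 + (1 + H) ^ 3 / M + 1 / R) := by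
  obtain ⟨C, hC, h⟩ := exists_abs_integral_norm_smoothCoef_sq_sub_le
  refine ⟨C + 12, by positivity, fun Δ H l R M N hΔ hΔ' hH hR hM hMN hl hl' => ?_⟩
  have hM0 : (0:ℝ) < M := by exact_mod_cast hM
  have hN0 : (0:ℝ) < N := by exact_mod_cast hM.trans hMN
  set F : ℝ → ℝ := fun ω => ‖smoothCoef Δ H ω‖ ^ 2 with hF
  have hFc : Continuous F := (continuous_smoothCoef Δ H).norm.pow 2
  have hFB : ∀ x, |F x| ≤ H ^ 2 := fun x => by
    rw [abs_of_nonneg (by positivity)]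
    exact pow_le_pow_left₀ (norm_nonneg _) (norm_smoothCoef_le hH Δ x) 2
  have hFK := abs_norm_smoothCoef_sq_sub_le hΔ (by linarith) hH
  have h1 := abs_sum_sub_integral_log_le hFc hFB hFK l hM hMN
  have h2 := abs_integral_smoothCoef_sub_le hΔ hH hR (A := l - Real.log N) (B := l - Real.log M)
    (by linarith) (by linarith)
  have h3 := h Δ H hΔ hΔ' hH
  have h4 : ∑ n ∈ Finset.Icc 1 M, 1 / (n : ℝ) * F (l - Real.log n) ≤ 4 * ((1 + Real.log M) / R ^ 2) := by
    calc _ ≤ ∑ n ∈ Finset.Icc 1 M, 1 / (n : ℝ) * (4 * (1 / R ^ 2)) := by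
          refine Finset.sum_le_sum fun n hn => mul_le_mul_of_nonneg_left ?_ (by positivity)
          obtain ⟨hn1, hnM⟩ := Finset.mem_Icc.1 hn
          have hlog : Real.log n ≤ Real.log M :=
            Real.log_le_log (by exact_mod_cast hn1) (by exact_mod_cast hnM)
          have hω : R ≤ l - Real.log n := by linarith
          refine (norm_smoothCoef_sq_le_div (by linarith : l - Real.log n ≠ 0) Δ H).trans ?_
          gcongr
      _ = (∑ n ∈ Finset.Icc 1 M, 1 / (n : ℝ)) * (4 * (1 / R ^ 2)) := by rw [Finset.sum_mul]
      _ ≤ (1 + Real.log M) * (4 * (1 / R ^ 2)) := by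
          gcongr; exact sum_one_div_le M
      _ = _ := by ring
  have h4' : 0 ≤ ∑ n ∈ Finset.Icc 1 M, 1 / (n : ℝ) * F (l - Real.log n) :=
    Finset.sum_nonneg fun n _ => by positivity
  have hsplit : ∑ n ∈ Finset.Icc 1 N, 1 / (n : ℝ) * F (l - Real.log n) =
      (∑ n ∈ Finset.Icc 1 M, 1 / (n : ℝ) * F (l - Real.log n)) +
      ∑ n ∈ Finset.Ico M N, 1 / ((n + 1 : ℕ) : ℝ) * F (l - Real.log (n + 1 : ℕ)) := by
    have e : ∀ n : ℕ, ∑ n ∈ Finset.Icc 1 n, 1 / (n : ℝ) * F (l - Real.log n) =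
        ∑ n ∈ Finset.range n, 1 / ((n + 1 : ℕ) : ℝ) * F (l - Real.log (n + 1 : ℕ)) := fun n => by
      rw [Finset.range_eq_Ico, Finset.sum_Ico_add' (fun n : ℕ => 1 / (n : ℝ) * F (l - Real.log n)) 0 n 1]
      rfl
    rw [e, e, Finset.sum_range_add_sum_Ico _ hMN]
  have h5 : 2 * (2 * H * (H ^ 2 + H) + H ^ 2) / M ≤ 10 * ((1 + H) ^ 3 / M) := by
    rw [← mul_div_assoc]
    refine div_le_div_of_nonneg_right ?_ hM0.le
    nlinarith [pow_nonneg hH 3, pow_nonneg hH 2]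
  have h6 : (8:ℝ) / R = 8 * (1 / R) := by ring
  have n1 : 0 ≤ (1 + Real.log M) / R ^ 2 := by
    have := Real.log_natCast_nonneg M; positivity
  have n2 : 0 ≤ (1 + H) ^ 3 / M := by positivity
  have n3 : 0 ≤ 1 / R := by positivity
  rw [abs_le] at h1 h2 h3 ⊢
  rw [hsplit]
  have n4 := mul_nonneg hC.le n1
  have n5 := mul_nonneg hC.le n2
  have n6 := mul_nonneg hC.le n3
  constructor <;> nlinarith

lemma hasDerivAt_freq {t : ℝ} (ht : 0 < t) : HasDerivAt freq (1 / (2 * t)) t := by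
  have h : HasDerivAt (fun t : ℝ => t / (2 * Real.pi)) (1 / (2 * Real.pi)) t :=
    (hasDerivAt_id t).div_const _
  have hpi := Real.pi_pos
  refine ((h.log (by positivity)).div_const 2).congr_deriv ?_
  field_simp

lemma freq_mono {s t : ℝ} (hs : 0 < s) (hst : s ≤ t) : freq s ≤ freq t := by
  unfold freq
  have hpi := Real.pi_pos
  gcongr

lemma continuousOn_freq : ContinuousOn freq (Set.Ioi 0) := fun _ ht =>
  (hasDerivAt_freq ht).continuousAt.continuousWithinAt

lemma continuousOn_smoothPoly (N : ℕ) (Δ H : ℝ) : ContinuousOn (smoothPoly N Δ H) (Set.Ioi 0) := by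
  unfold smoothPoly
  refine continuousOn_finsetSum _ fun n hn => ?_
  have hn0 : (n : ℂ) ≠ 0 := by exact_mod_cast (by have := (Finset.mem_Icc.1 hn).1; omega : n ≠ 0)
  refine ((continuous_smoothCoef Δ H).comp_continuousOn (continuousOn_freq.sub continuousOn_const)).mul ?_
  exact ((continuous_line 0).neg.const_cpow (Or.inl hn0)).continuousOn

theorem exists_abs_integral_smoothPoly_sq_sub_le : ∃ C : ℝ, 0 < C ∧
    ∀ (T T₁ Δ H R : ℝ) (M N : ℕ), 0 < T → T ≤ T₁ → 0 < Δ → Δ ≤ 1 / 2 →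
    0 ≤ H → 0 < R → 1 ≤ M → M ≤ N → Real.log M + R ≤ freq T → freq T₁ + R ≤ Real.log N →
    |(∫ t in T..T₁, ‖smoothPoly N Δ H t‖ ^ 2) - 2 * Real.pi * H * (T₁ - T)| ≤
      C * ((1 + (1 + Real.log M) / R ^ 2 + (1 + H) ^ 3 / M + 1 / R) * (T₁ - T) +
        (1 + H) ^ 3 * (1 + Real.log (T₁ / T)) * (N * (1 + Real.log N))) := by
  obtain ⟨C, hC, h⟩ := exists_abs_diagonal_sub_le
  refine ⟨C + 8, by positivity, fun T T₁ Δ H R M N hT hTT hΔ hΔ' hH hR hM hMN hl hl' => ?_⟩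
  have hpos : ∀ t ∈ Set.Icc T T₁, 0 < t := fun t ht => hT.trans_le ht.1
  have hcoefd : ∀ n : ℕ, ∀ t, 0 < t → HasDerivAt (fun t => smoothCoef Δ H (freq t - Real.log n))
      ((1 / (2 * t) : ℝ) • smoothCoef' Δ H (freq t - Real.log n)) t := fun n t ht =>
    HasDerivAt.scomp (h := fun t => freq t - Real.log n) t
      (hasDerivAt_smoothCoef Δ H (freq t - Real.log n)) ((hasDerivAt_freq ht).sub_const (Real.log n))
  have hoff := abs_integral_norm_sq_sub_diag_le N hT hTT hH (K := (H ^ 2 + H) / 2)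
    (a := fun n t => smoothCoef Δ H (freq t - Real.log n))
    (a' := fun n t => (1 / (2 * t) : ℝ) • smoothCoef' Δ H (freq t - Real.log n))
    (fun n _ t ht => hcoefd n t (hpos t ht))
    (fun n _ t ht => by
      have ht0 := hpos t ht
      have h1 : ContinuousAt (fun t : ℝ => 1 / (2 * t)) t :=
        continuousAt_const.div (by fun_prop) (by positivity)
      exact (h1.smul ((continuous_smoothCoef' Δ H).continuousAt.comp
        ((hasDerivAt_freq ht0).continuousAt.sub continuousAt_const))).continuousWithinAt)
    (fun n _ t _ => norm_smoothCoef_le hH Δ _)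
    (fun n _ t ht => by
      have ht0 := hpos t ht
      rw [norm_smul, Real.norm_of_nonneg (by positivity)]
      calc _ ≤ 1 / (2 * t) * (H ^ 2 + H) :=
            mul_le_mul_of_nonneg_left (norm_smoothCoef'_le hΔ (by linarith) hH _) (by positivity)
        _ = _ := by field_simp)
  have hci : ∀ n : ℕ, IntervalIntegrable (fun t => ‖smoothCoef Δ H (freq t - Real.log n)‖ ^ 2) volume T T₁ := by
    intro n
    refine ContinuousOn.intervalIntegrable fun t ht => ?_
    rw [Set.uIcc_of_le hTT] at ht
    exact ((hcoefd n t (hpos t ht)).continuousAt.norm.pow 2).continuousWithinAt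
  have hdiag : ∑ n ∈ Finset.Icc 1 N, 1 / (n : ℝ) * ∫ t in T..T₁, ‖smoothCoef Δ H (freq t - Real.log n)‖ ^ 2 =
      ∫ t in T..T₁, ∑ n ∈ Finset.Icc 1 N, 1 / (n : ℝ) * ‖smoothCoef Δ H (freq t - Real.log n)‖ ^ 2 := by
    rw [intervalIntegral.integral_finsetSum fun n _ => (hci n).const_mul _]
    simp only [intervalIntegral.integral_const_mul]
  set D := 1 + (1 + Real.log M) / R ^ 2 + (1 + H) ^ 3 / M + 1 / R with hD
  have hlogM := Real.log_natCast_nonneg M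
  have hlogN := Real.log_natCast_nonneg N
  have hD0 : 0 ≤ D := by positivity
  have hdiag2 : |(∫ t in T..T₁, ∑ n ∈ Finset.Icc 1 N, 1 / (n : ℝ) *
      ‖smoothCoef Δ H (freq t - Real.log n)‖ ^ 2) - 2 * Real.pi * H * (T₁ - T)| ≤ C * D * (T₁ - T) := by
    have hconst : 2 * Real.pi * H * (T₁ - T) = ∫ _ in T..T₁, 2 * Real.pi * H := by
      rw [intervalIntegral.integral_const, smul_eq_mul, mul_comm]
    have hsum : IntervalIntegrable (fun t => ∑ n ∈ Finset.Icc 1 N, 1 / (n : ℝ) *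
        ‖smoothCoef Δ H (freq t - Real.log n)‖ ^ 2) volume T T₁ := by
      have := IntervalIntegrable.sum (Finset.Icc 1 N) (fun n _ => (hci n).const_mul (1 / (n : ℝ)))
      simpa only [Finset.sum_fn] using this
    rw [hconst, ← intervalIntegral.integral_sub hsum intervalIntegrable_const]
    have := intervalIntegral.norm_integral_le_of_norm_le_const (a := T) (b := T₁) (C := C * D)
      (f := fun t => (∑ n ∈ Finset.Icc 1 N, 1 / (n : ℝ) * ‖smoothCoef Δ H (freq t - Real.log n)‖ ^ 2) -
        2 * Real.pi * H) fun t ht => by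
          rw [Set.uIoc_of_le hTT] at ht
          have h1 := freq_mono hT ht.1.le
          have h2 := freq_mono (hT.trans ht.1) ht.2
          exact h Δ H (freq t) R M N hΔ hΔ' hH hR hM hMN (by linarith) (by linarith)
    rwa [abs_of_nonneg (by linarith : 0 ≤ T₁ - T)] at this
  have hlogT : 0 ≤ Real.log (T₁ / T) := Real.log_nonneg (by rw [le_div_iff₀ hT]; linarith)
  have hQ : (2 * H ^ 2 + 2 * H * ((H ^ 2 + H) / 2) * Real.log (T₁ / T)) * (4 * N * (1 + Real.log N)) ≤
      8 * ((1 + H) ^ 3 * (1 + Real.log (T₁ / T)) * (N * (1 + Real.log N))) := by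
    have hNl : 0 ≤ N * (1 + Real.log N) := by positivity
    have h1 : 2 * H ^ 2 + 2 * H * ((H ^ 2 + H) / 2) * Real.log (T₁ / T) ≤
        2 * ((1 + H) ^ 3 * (1 + Real.log (T₁ / T))) := by
      have e1 : 2 * H ^ 2 ≤ 2 * (1 + H) ^ 3 := by nlinarith [pow_nonneg hH 3, pow_nonneg hH 2]
      have e2 : 2 * H * ((H ^ 2 + H) / 2) ≤ 2 * (1 + H) ^ 3 := by nlinarith [pow_nonneg hH 3, pow_nonneg hH 2]
      nlinarith
    nlinarith
  rw [hdiag] at hoff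
  have hE0 : 0 ≤ (1 + H) ^ 3 * (1 + Real.log (T₁ / T)) * (N * (1 + Real.log N)) := by positivity
  have hDT : 0 ≤ D * (T₁ - T) := mul_nonneg hD0 (by linarith)
  unfold smoothPoly
  refine (abs_sub_le _ _ _).trans ((add_le_add (hoff.trans hQ) hdiag2).trans ?_)
  nlinarith [mul_nonneg hC.le hE0]

lemma continuous_powWeight : Continuous powWeight := by
  unfold powWeight
  refine Continuous.div ?_ (by fun_prop) fun t => by positivity
  exact Real.continuous_rpow_const (by norm_num)

lemma continuous_XHL : Continuous XHL := by
  have : XHL = fun u => powWeight u * xiReal u := funext XHL_eq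
  rw [this]
  exact continuous_powWeight.mul continuous_xiReal

lemma continuous_integral_XHL (H : ℝ) : Continuous fun t => ∫ u in t..(t + H), XHL u := by
  have hi : ∀ a b, IntervalIntegrable XHL volume a b := fun a b => continuous_XHL.intervalIntegrable a b
  have hp : Continuous fun t => ∫ u in (0:ℝ)..t, XHL u := intervalIntegral.continuous_primitive hi 0
  have e : (fun t => ∫ u in t..(t + H), XHL u) =
      fun t => (∫ u in (0:ℝ)..(t + H), XHL u) - ∫ u in (0:ℝ)..t, XHL u := by
    funext t
    rw [intervalIntegral.integral_interval_sub_left (hi _ _) (hi _ _)]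
  rw [e]
  exact (hp.comp (by fun_prop)).sub hp

lemma measurable_smoothXi {Δ : ℝ} (hΔ : 0 < Δ) (H : ℝ) : Measurable (smoothXi Δ H) := by
  have hc : Continuous fun p : ℝ × ℝ => ∫ x in (0:ℝ)..H, xiReal (p.1 + x + p.2) := by
    refine intervalIntegral.continuous_parametric_intervalIntegral_of_continuous'
      (f := fun (p : ℝ × ℝ) x => xiReal (p.1 + x + p.2)) ?_ 0 H
    exact continuous_xiReal.comp (by fun_prop)
  have e : smoothXi Δ H = fun t => ∫ v, gauss Δ v * ∫ x in (0:ℝ)..H, xiReal (t + x + v) :=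
    funext (smoothXi_eq hΔ H)
  rw [e]
  refine (StronglyMeasurable.integral_prod_right' (f := fun p : ℝ × ℝ =>
    gauss Δ p.2 * ∫ x in (0:ℝ)..H, xiReal (p.1 + x + p.2)) ?_).measurable
  exact (((continuous_gauss Δ).comp continuous_snd).mul hc).stronglyMeasurable

/-- The main term in the approximation of the short integrals of `XHL`. -/
noncomputable def mainTerm (N : ℕ) (Δ H t : ℝ) : ℂ :=
  powWeight t * gammaWeight (line 0 t) * smoothPoly N Δ H t

lemma continuousOn_mainTerm (N : ℕ) (Δ H : ℝ) : ContinuousOn (mainTerm N Δ H) (Set.Ioi 0) := by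
  unfold mainTerm
  refine ContinuousOn.mul (Continuous.continuousOn ?_) (continuousOn_smoothPoly N Δ H)
  exact (Complex.continuous_ofReal.comp continuous_powWeight).mul (continuous_gammaWeight_line le_rfl)

lemma lintegral_enorm_sq_eq_of_continuousOn {E : Type*} [NormedAddCommGroup E] {f : ℝ → E} {A B : ℝ}
    (hf : ContinuousOn f (Set.Icc A B)) (hAB : A ≤ B) :
    ∫⁻ t in Set.Ioc A B, ‖f t‖ₑ ^ 2 = ENNReal.ofReal (∫ t in A..B, ‖f t‖ ^ 2) := by
  have hc : ContinuousOn (fun t => ‖f t‖ ^ 2) (Set.uIcc A B) := by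
    rw [Set.uIcc_of_le hAB]; exact hf.norm.pow 2
  rw [intervalIntegral.integral_of_le hAB, ofReal_integral_eq_lintegral_ofReal
    ((intervalIntegrable_iff_integrableOn_Ioc_of_le hAB).1 hc.intervalIntegrable)
    (ae_of_all _ fun t => by positivity)]
  refine lintegral_congr fun t => ?_
  rw [← ofReal_norm, ENNReal.ofReal_pow (norm_nonneg _)]

lemma abs_integral_sq_sub_le {f g : ℝ → ℂ} {A B η : ℝ} (hf : ContinuousOn f (Set.Icc A B))
    (hg : ContinuousOn g (Set.Icc A B)) (hAB : A ≤ B) (hη : 0 < η) :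
    |(∫ t in A..B, ‖f t‖ ^ 2) - ∫ t in A..B, ‖g t‖ ^ 2| ≤
      η * (∫ t in A..B, ‖g t‖ ^ 2) + (1 + 1 / η) * ∫ t in A..B, ‖f t - g t‖ ^ 2 := by
  have hi : ∀ {f : ℝ → ℂ}, ContinuousOn f (Set.Icc A B) →
      IntervalIntegrable (fun t => ‖f t‖ ^ 2) volume A B := fun hf =>
    ContinuousOn.intervalIntegrable (by rw [Set.uIcc_of_le hAB]; exact hf.norm.pow 2)
  have hfg : IntervalIntegrable (fun t => ‖f t - g t‖ ^ 2) volume A B := hi (hf.sub hg)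
  rw [← intervalIntegral.integral_sub (hi hf) (hi hg), ← intervalIntegral.integral_const_mul,
    ← intervalIntegral.integral_const_mul,
    ← intervalIntegral.integral_add ((hi hg).const_mul _) (hfg.const_mul _)]
  refine intervalIntegral.abs_integral_le_integral_abs hAB |>.trans ?_
  refine intervalIntegral.integral_mono_on hAB ((hi hf).sub (hi hg)).abs
    (((hi hg).const_mul _).add (hfg.const_mul _)) fun t _ => ?_
  set x := ‖f t‖
  set y := ‖g t‖
  set d := ‖f t - g t‖
  have h1 : |x - y| ≤ d := abs_norm_sub_norm_le _ _
  have hy : 0 ≤ y := norm_nonneg _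
  have hd : 0 ≤ d := norm_nonneg _
  have h2 : |x ^ 2 - y ^ 2| ≤ d ^ 2 + 2 * (d * y) := by
    rw [show x ^ 2 - y ^ 2 = (x - y) ^ 2 + 2 * ((x - y) * y) by ring]
    refine (abs_add_le _ _).trans ?_
    rw [abs_of_nonneg (sq_nonneg _), abs_mul, abs_mul, abs_two, abs_of_nonneg hy, ← sq_abs (x - y)]
    gcongr
  have h3 : 2 * (d * y) ≤ η * y ^ 2 + 1 / η * d ^ 2 := by
    have h4 := sq_nonneg (η * y - d)
    have h5 : η * y ^ 2 + 1 / η * d ^ 2 - 2 * (d * y) = (η * y - d) ^ 2 / η := by field_simp; ring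
    have h6 : 0 ≤ (η * y - d) ^ 2 / η := by positivity
    linarith
  linarith

/-- The error bound for approximating short integrals of `XHL` by `mainTerm`. -/
noncomputable def errBound (k N : ℕ) (c Δ H T T₁ : ℝ) : ℝ :=
  ((H ^ 2 / T) ^ 2 + Δ ^ 2) * crudeMass k N c T T₁ +
    ((H * (1 + H) ^ 6 / T) ^ 2 * polyMass N (T₁ - T) +
      (T₁ - T) * (H * (Real.exp ((2 * k) ^ 2 / (2 * Δ ^ 2)) *
        (T₁ ^ (k + 2) * (N : ℝ) ^ (3 / 2 - 2 * k : ℝ)))) ^ 2)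

theorem exists_integral_XHL_sub_mainTerm_le {k : ℕ} (hk : 1 ≤ k) : ∃ C : ℝ, 0 < C ∧
    ∀ (T T₁ c Δ H : ℝ) (N : ℕ), 4 ≤ T → T ≤ T₁ → 0 < c → c ≤ 1 / 40 → 1 ≤ N → 0 < Δ → Δ ≤ 1 →
    0 ≤ H → H ≤ T →
    ∫ t in T..T₁, ‖((∫ u in t..(t + H), XHL u : ℝ) : ℂ) - mainTerm N Δ H t‖ ^ 2 ≤
      C * errBound k N c Δ H T T₁ := by
  obtain ⟨C₁, hC₁, h1⟩ := exists_lintegral_smoothing_le hk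
  obtain ⟨C₂, hC₂, h2⟩ := exists_lintegral_smoothXi_sub_le hk
  refine ⟨2 * (C₁ + C₂), by positivity, fun T T₁ c Δ H N hT hTT hc hc' hN hΔ hΔ' hH hHT => ?_⟩
  have hT0 : 0 < T := by linarith
  have hsub : Set.Icc T T₁ ⊆ Set.Ioi 0 := fun t ht => hT0.trans_le ht.1
  have hcm := crudeMass_nonneg (k := k) (c := c) hN (by linarith : 0 ≤ T) hTT
  have hpm := polyMass_nonneg hN (by linarith : 0 ≤ T₁ - T)
  have hU : 0 ≤ T₁ - T := by linarith
  have hcont : ContinuousOn (fun t => ((∫ u in t..(t + H), XHL u : ℝ) : ℂ) - mainTerm N Δ H t)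
      (Set.Icc T T₁) :=
    (Complex.continuous_ofReal.comp (continuous_integral_XHL H)).continuousOn.sub
      ((continuousOn_mainTerm N Δ H).mono hsub)
  set E₁ := ((H ^ 2 / T) ^ 2 + Δ ^ 2) * crudeMass k N c T T₁ with hE₁
  set E₂ := (H * (1 + H) ^ 6 / T) ^ 2 * polyMass N (T₁ - T) +
      (T₁ - T) * (H * (Real.exp ((2 * k) ^ 2 / (2 * Δ ^ 2)) *
        (T₁ ^ (k + 2) * (N : ℝ) ^ (3 / 2 - 2 * k : ℝ)))) ^ 2 with hE₂
  have hE₁0 : 0 ≤ E₁ := by positivity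
  have hE₂0 : 0 ≤ E₂ := by positivity
  have key : ENNReal.ofReal (∫ t in T..T₁,
      ‖((∫ u in t..(t + H), XHL u : ℝ) : ℂ) - mainTerm N Δ H t‖ ^ 2) ≤
      ENNReal.ofReal (2 * (C₁ + C₂) * (E₁ + E₂)) := by
    rw [← lintegral_enorm_sq_eq_of_continuousOn hcont hTT]
    calc _ ≤ ∫⁻ t in Set.Ioc T T₁, 2 * (‖(∫ u in t..(t + H), XHL u) - powWeight t * smoothXi Δ H t‖ₑ ^ 2 +
          ‖((powWeight t * smoothXi Δ H t : ℝ) : ℂ) - mainTerm N Δ H t‖ₑ ^ 2) := by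
          refine lintegral_mono fun t => ?_
          refine le_trans (pow_le_pow_left' ?_ 2) (ennreal_add_sq_le _ _)
          have e : ‖(∫ u in t..(t + H), XHL u) - powWeight t * smoothXi Δ H t‖ₑ =
              ‖((∫ u in t..(t + H), XHL u : ℝ) : ℂ) - ((powWeight t * smoothXi Δ H t : ℝ) : ℂ)‖ₑ := by
            rw [← Complex.ofReal_sub, ← ofReal_norm, ← ofReal_norm, Complex.norm_real]
          rw [e, ← sub_add_sub_cancel _ ((powWeight t * smoothXi Δ H t : ℝ) : ℂ) (mainTerm N Δ H t)]
          exact enorm_add_le _ _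
      _ ≤ 2 * (ENNReal.ofReal (C₁ * ((H ^ 2 / T) ^ 2 + Δ ^ 2) * crudeMass k N c T T₁) +
          ENNReal.ofReal (C₂ * E₂)) := by
          rw [lintegral_const_mul' _ _ (by norm_num), lintegral_add_left]
          · gcongr
            · exact h1 T T₁ c Δ H N (by linarith) hTT hc hc' hN hΔ hΔ' hH hHT
            · exact h2 T T₁ Δ H N hT hTT hΔ hΔ' hN hH hHT
          · exact (((continuous_integral_XHL H).measurable.sub
              (continuous_powWeight.measurable.mul (measurable_smoothXi hΔ H))).enorm.pow_const 2)
      _ = ENNReal.ofReal (2 * (C₁ * E₁ + C₂ * E₂)) := by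
          rw [show (2 : ENNReal) = ENNReal.ofReal 2 from (ENNReal.ofReal_ofNat 2).symm, mul_assoc C₁, ← hE₁,
            ← ENNReal.ofReal_add (by positivity) (by positivity), ← ENNReal.ofReal_mul (by norm_num)]
      _ ≤ _ := ENNReal.ofReal_le_ofReal (by nlinarith [mul_nonneg hC₁.le hE₂0, mul_nonneg hC₂.le hE₁0])
  rw [ENNReal.ofReal_le_ofReal_iff (by positivity)] at key
  exact key

lemma tendsto_of_forall_abs_sub_le {x y z : ℝ → ℝ} {c z₀ : ℝ} (hy : Tendsto y atTop (𝓝 c))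
    (hz : Tendsto z atTop (𝓝 z₀)) (h : ∀ δ > 0, ∀ᶠ T in atTop, |x T - y T| ≤ δ * z T) :
    Tendsto x atTop (𝓝 c) := by
  have h0 : Tendsto (fun T => x T - y T) atTop (𝓝 0) := by
    rw [Metric.tendsto_nhds]
    intro ε hε
    have hz0 : 0 < |z₀| + 1 := by positivity
    filter_upwards [h (ε / (2 * (|z₀| + 1))) (by positivity),
      hz.eventually_le_const (lt_of_le_of_lt (le_abs_self z₀) (lt_add_one _))] with T h1 h2
    rw [Real.dist_eq, sub_zero]
    calc _ ≤ ε / (2 * (|z₀| + 1)) * z T := h1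
      _ ≤ ε / (2 * (|z₀| + 1)) * (|z₀| + 1) := mul_le_mul_of_nonneg_left h2 (by positivity)
      _ = ε / 2 := by field_simp
      _ < ε := by linarith
  simpa using h0.add hy

lemma tendsto_log_rpow_mul_rpow_neg (p : ℝ) {ε : ℝ} (hε : 0 < ε) :
    Tendsto (fun T : ℝ => Real.log T ^ p * T ^ (-ε)) atTop (𝓝 0) := by
  refine ((isLittleO_log_rpow_rpow_atTop p hε).tendsto_div_nhds_zero).congr' ?_
  filter_upwards [eventually_gt_atTop 0] with T hT
  rw [Real.rpow_neg hT.le, div_eq_mul_inv]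

lemma tendsto_log_rpow_neg {p : ℝ} (hp : 0 < p) :
    Tendsto (fun T : ℝ => Real.log T ^ (-p)) atTop (𝓝 0) :=
  (tendsto_rpow_neg_atTop hp).comp Real.tendsto_log_atTop

section Sizes

variable {a T : ℝ}

lemma add_rpow_le_two_mul (hT : 1 ≤ T) : T + T ^ a ≤ 2 * T ^ max 1 a := by
  have h1 : T ≤ T ^ max 1 a := by
    simpa using Real.rpow_le_rpow_of_exponent_le hT (le_max_left 1 a)
  have h2 : T ^ a ≤ T ^ max 1 a := Real.rpow_le_rpow_of_exponent_le hT (le_max_right 1 a)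
  linarith

lemma natCeil_rpow_le {β : ℝ} (hT : 1 ≤ T) (hβ : 0 ≤ β) : (⌈T ^ β⌉₊ : ℝ) ≤ 2 * T ^ β := by
  have h1 : 1 ≤ T ^ β := Real.one_le_rpow hT hβ
  linarith [Nat.ceil_lt_add_one (by linarith : 0 ≤ T ^ β)]

lemma one_le_natCeil_rpow {β : ℝ} (hT : 1 ≤ T) : 1 ≤ ⌈T ^ β⌉₊ :=
  Nat.one_le_ceil_iff.2 (Real.rpow_pos_of_pos (by linarith) _)

lemma log_natCeil_rpow_le {β : ℝ} (hT : 1 ≤ Real.log T) (hT1 : 1 ≤ T) (hβ : 0 ≤ β) :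
    1 + Real.log ⌈T ^ β⌉₊ ≤ (2 + β) * Real.log T := by
  have hN : (0:ℝ) < ⌈T ^ β⌉₊ := by exact_mod_cast one_le_natCeil_rpow hT1
  have hT0 : 0 < T := by linarith
  have h := Real.log_le_log hN (natCeil_rpow_le hT1 hβ)
  rw [Real.log_mul (by norm_num) (by positivity), Real.log_rpow hT0] at h
  have h2 : Real.log 2 ≤ 1 := by linarith [Real.log_two_lt_d9]
  linarith

lemma one_add_log_rpow_le {α : ℝ} (hT : 1 ≤ Real.log T) (hα : 0 ≤ α) :
    1 + Real.log T ^ α ≤ 2 * Real.log T ^ α := by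
  linarith [Real.one_le_rpow hT hα]

lemma polyMass_natCeil_le {β : ℝ} (hT : 1 ≤ Real.log T) (hT1 : 1 ≤ T) (hβ : 0 ≤ β) (hβa : β ≤ a) :
    polyMass ⌈T ^ β⌉₊ (T ^ a) ≤ 17 * (2 + β) * (T ^ a * Real.log T) := by
  have h1 := log_natCeil_rpow_le hT hT1 hβ
  have h2 := natCeil_rpow_le hT1 hβ
  have h3 : T ^ β ≤ T ^ a := Real.rpow_le_rpow_of_exponent_le hT1 hβa
  have h4 := Real.log_natCast_nonneg ⌈T ^ β⌉₊
  have h5 : 0 ≤ T ^ a := by positivity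
  unfold polyMass
  calc _ ≤ (17 * T ^ a) * ((2 + β) * Real.log T) :=
        mul_le_mul (by linarith) h1 (by linarith) (by positivity)
    _ = _ := by ring

lemma pow_mul_natCeil_rpow_le {k : ℕ} {β : ℝ} (hk : 1 ≤ k) (hT : 1 ≤ T)
    (hkβ : 2 * max 1 a + 3 / 2 * β + 1 ≤ k * (2 * β - max 1 a)) :
    (T + T ^ a) ^ (k + 2) * (⌈T ^ β⌉₊ : ℝ) ^ (3 / 2 - 2 * k : ℝ) ≤ 2 ^ (k + 2) * T ^ (-1 : ℝ) := by
  have hT0 : 0 < T := by linarith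
  have hk' : (1:ℝ) ≤ k := by exact_mod_cast hk
  have h1 : (⌈T ^ β⌉₊ : ℝ) ^ (3 / 2 - 2 * k : ℝ) ≤ (T ^ β) ^ (3 / 2 - 2 * k : ℝ) :=
    Real.rpow_le_rpow_of_nonpos (by positivity) (Nat.le_ceil _) (by linarith)
  calc _ ≤ (2 * T ^ max 1 a) ^ (k + 2) * (T ^ β) ^ (3 / 2 - 2 * k : ℝ) := by
        refine mul_le_mul (pow_le_pow_left₀ (by positivity) (add_rpow_le_two_mul hT) _) h1
          (by positivity) (by positivity)
    _ = 2 ^ (k + 2) * T ^ (max 1 a * ((k + 2 : ℕ) : ℝ) + β * (3 / 2 - 2 * k)) := by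
        rw [mul_pow, ← Real.rpow_mul_natCast hT0.le, ← Real.rpow_mul hT0.le, mul_assoc,
          ← Real.rpow_add hT0]
    _ ≤ _ := by
        refine mul_le_mul_of_nonneg_left (Real.rpow_le_rpow_of_exponent_le hT ?_) (by positivity)
        push_cast
        nlinarith

lemma log_add_rpow_le (hT1 : 1 ≤ T) :
    Real.log (T + T ^ a) ≤ Real.log 2 + max 1 a * Real.log T := by
  have hT0 : 0 < T := by linarith
  have h := Real.log_le_log (by positivity) (add_rpow_le_two_mul (a := a) hT1)
  rwa [Real.log_mul (by norm_num) (by positivity), Real.log_rpow hT0] at h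

lemma freq_add_rpow_le (hT1 : 1 ≤ T) :
    freq (T + T ^ a) ≤ max 1 a / 2 * Real.log T := by
  have hT0 : 0 < T := by linarith
  have h := log_add_rpow_le (a := a) hT1
  have h2 : Real.log 2 ≤ Real.log (2 * Real.pi) :=
    Real.log_le_log (by norm_num) (by linarith [Real.pi_gt_three])
  unfold freq
  rw [Real.log_div (by positivity) (by positivity)]
  linarith

lemma mul_log_le_log_natCeil_rpow {β : ℝ} (hT1 : 1 ≤ T) :
    β * Real.log T ≤ Real.log ⌈T ^ β⌉₊ := by
  have hT0 : 0 < T := by linarith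
  rw [← Real.log_rpow hT0]
  exact Real.log_le_log (by positivity) (Nat.le_ceil _)

lemma half_rpow_le_natFloor (hT : 16 ≤ T) : T ^ (1 / 4 : ℝ) / 2 ≤ ⌊T ^ (1 / 4 : ℝ)⌋₊ := by
  have h2 : (2:ℝ) ≤ T ^ (1 / 4 : ℝ) := by
    calc (2:ℝ) = (16:ℝ) ^ (1 / 4 : ℝ) := by
          rw [show (16:ℝ) = 2 ^ (4:ℝ) by norm_num, ← Real.rpow_mul (by norm_num)]; norm_num
      _ ≤ _ := Real.rpow_le_rpow (by norm_num) hT (by norm_num)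
  linarith [Nat.lt_floor_add_one (T ^ (1 / 4 : ℝ))]

end Sizes

theorem tendsto_integral_smoothPoly_sq_div {a α β : ℝ} (hα : 0 < α)
    (hβ : max 1 a / 2 < β) (hβa : β < a) {Δ : ℝ → ℝ} (hΔ : ∀ᶠ T in atTop, 0 < Δ T ∧ Δ T ≤ 1 / 2) :
    Tendsto (fun T : ℝ => (∫ t in T..(T + T ^ a),
      ‖smoothPoly ⌈T ^ β⌉₊ (Δ T) (Real.log T ^ α) t‖ ^ 2) / (T ^ a * Real.log T ^ α))
      atTop (𝓝 (2 * Real.pi)) := by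
  obtain ⟨C, hC, hCb⟩ := exists_abs_integral_smoothPoly_sq_sub_le
  have hb1 := le_max_left 1 a
  set b := max 1 a with hb
  obtain ⟨ρ, hρ, hρ1, hρ2⟩ : ∃ ρ > 0, ρ ≤ 1 / 8 ∧ ρ ≤ β - b / 2 :=
    ⟨min (1 / 8) (β - b / 2), lt_min (by norm_num) (by linarith), min_le_left _ _, min_le_right _ _⟩
  have hβ2 : 1 / 2 < β := by linarith
  set K := 2 + 2 / ρ ^ 2 + 1 / ρ with hK
  set K' := 16 * (2 + b) * (2 + β) with hK'
  have hlim : Tendsto (fun T : ℝ => C * (K * Real.log T ^ (-α) +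
      K' * (Real.log T ^ (2 * α + 2) * T ^ (-(a - β))))) atTop (𝓝 0) := by
    simpa using (((tendsto_log_rpow_neg hα).const_mul K).add
      ((tendsto_log_rpow_mul_rpow_neg (2 * α + 2) (sub_pos.2 hβa)).const_mul K')).const_mul C
  rw [tendsto_iff_dist_tendsto_zero]
  refine squeeze_zero' (Eventually.of_forall fun _ => dist_nonneg) ?_ hlim
  filter_upwards [hΔ, eventually_ge_atTop 16,
    Real.tendsto_log_atTop.eventually_ge_atTop (4 * Real.log (2 * Real.pi) + 1),
    (tendsto_log_rpow_mul_rpow_neg (3 * α) (by norm_num : (0:ℝ) < 1 / 4)).eventually_le_const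
      (by norm_num : (0:ℝ) < 1 / 16)] with T hΔT hT16 hL hM16
  have hT1 : 1 ≤ T := by linarith
  have hT0 : 0 < T := by linarith
  have hl2pi : 0 ≤ Real.log (2 * Real.pi) := Real.log_nonneg (by linarith [Real.pi_gt_three])
  have hL1 : 1 ≤ Real.log T := by linarith
  have hfr : freq T = (Real.log T - Real.log (2 * Real.pi)) / 2 := by
    unfold freq
    rw [Real.log_div (by positivity) (by positivity)]
  have hfr1 := freq_add_rpow_le (a := a) hT1
  have hlogN := mul_log_le_log_natCeil_rpow (β := β) hT1
  have hMlow := half_rpow_le_natFloor hT16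
  have hMup := Nat.floor_le (by positivity : 0 ≤ T ^ (1 / 4 : ℝ))
  have hNlog := log_natCeil_rpow_le hL1 hT1 (by linarith : 0 ≤ β)
  have hNup := natCeil_rpow_le hT1 (by linarith : 0 ≤ β)
  have hT1log := log_add_rpow_le (a := a) hT1
  rw [← hb] at hfr1 hT1log
  set L := Real.log T with hLdef
  have hL0 : 0 < L := by linarith
  set M := ⌊T ^ (1 / 4 : ℝ)⌋₊ with hMdef
  set N := ⌈T ^ β⌉₊ with hNdef
  set H := L ^ α with hH
  have hH0 : 0 < H := by positivity
  have hH1 : 1 + H ≤ 2 * H := one_add_log_rpow_le hL1 hα.le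
  have hM0 : (0:ℝ) < M := lt_of_lt_of_le (by positivity) hMlow
  have hlogM : Real.log M ≤ L / 4 := by
    have := Real.log_le_log hM0 hMup
    rw [Real.log_rpow hT0] at this
    linarith
  have hMN : M ≤ N := by
    have h1 : T ^ (1 / 4 : ℝ) ≤ T ^ β := Real.rpow_le_rpow_of_exponent_le hT1 (by linarith)
    exact_mod_cast hMup.trans (h1.trans (Nat.le_ceil _))
  have hR8 : ρ * L ≤ 1 / 8 * L := mul_le_mul_of_nonneg_right hρ1 hL0.le
  have hRb : ρ * L ≤ (β - b / 2) * L := mul_le_mul_of_nonneg_right hρ2 hL0.le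
  have hTa : 0 < T ^ a := by positivity
  have h := hCb T (T + T ^ a) (Δ T) H (ρ * L) M N hT0 (by linarith) hΔT.1 hΔT.2 hH0.le
    (by positivity) (by exact_mod_cast hM0) hMN (by rw [hfr]; linarith) (by linarith)
  rw [add_sub_cancel_left] at h
  have hD : 1 + (1 + Real.log M) / (ρ * L) ^ 2 + (1 + H) ^ 3 / M + 1 / (ρ * L) ≤ K := by
    have e1 : (1 + Real.log M) / (ρ * L) ^ 2 ≤ 2 / ρ ^ 2 := by
      rw [div_le_div_iff₀ (by positivity) (by positivity)]
      have hLL : L ≤ L ^ 2 := le_self_pow₀ hL1 two_ne_zero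
      calc _ ≤ 2 * L ^ 2 * ρ ^ 2 := mul_le_mul_of_nonneg_right (by linarith) (sq_nonneg ρ)
        _ = _ := by ring
    have e2 : (1 + H) ^ 3 / M ≤ 1 := by
      rw [div_le_one hM0]
      have hc : H ^ 3 = L ^ (3 * α) := by
        rw [hH, ← Real.rpow_mul_natCast hL0.le]; congr 1; push_cast; ring
      have h3 : (1 + H) ^ 3 ≤ (2 * H) ^ 3 := pow_le_pow_left₀ (by positivity) hH1 3
      have h8 : (2 * H) ^ 3 = 8 * H ^ 3 := by ring
      rw [Real.rpow_neg hT0.le, ← div_eq_mul_inv, div_le_iff₀ (by positivity), ← hc] at hM16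
      linarith
    have e3 : 1 / (ρ * L) ≤ 1 / ρ :=
      one_div_le_one_div_of_le hρ (le_mul_of_one_le_right hρ.le hL1)
    rw [hK]; linarith
  have hE : (1 + H) ^ 3 * (1 + Real.log ((T + T ^ a) / T)) * (N * (1 + Real.log N)) ≤
      K' * (H ^ 3 * L ^ 2 * T ^ β) := by
    have e1 : (1 + H) ^ 3 ≤ 8 * H ^ 3 := by
      calc _ ≤ (2 * H) ^ 3 := pow_le_pow_left₀ (by positivity) hH1 3
        _ = _ := by ring
    have e2 : 1 + Real.log ((T + T ^ a) / T) ≤ (2 + b) * L := by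
      rw [Real.log_div (by positivity) (by positivity)]
      linarith [Real.log_two_lt_d9]
    have e0 : 0 ≤ Real.log ((T + T ^ a) / T) :=
      Real.log_nonneg (by rw [one_le_div hT0]; linarith)
    have eN := Real.log_natCast_nonneg N
    calc _ ≤ (8 * H ^ 3) * ((2 + b) * L) * ((2 * T ^ β) * ((2 + β) * L)) := by
          refine mul_le_mul (mul_le_mul e1 e2 (by linarith) (by positivity))
            (mul_le_mul hNup hNlog (by linarith) (by positivity)) (by positivity) ?_
          exact mul_nonneg (by positivity) (mul_nonneg (by linarith) hL0.le)
      _ = _ := by rw [hK']; ring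
  have hid : H ^ 3 * L ^ 2 * T ^ β / (T ^ a * H) = L ^ (2 * α + 2) * T ^ (-(a - β)) := by
    have : L ^ (2 * α + 2) = H ^ 2 * L ^ 2 := by
      rw [Real.rpow_add hL0, hH, ← Real.rpow_mul_natCast hL0.le]
      norm_num [mul_comm]
    rw [this, neg_sub, Real.rpow_sub hT0]
    field_simp
  rw [Real.dist_eq]
  calc _ = |(∫ t in T..(T + T ^ a), ‖smoothPoly N (Δ T) H t‖ ^ 2) - 2 * Real.pi * H * T ^ a| /
        (T ^ a * H) := by
        rw [← abs_of_pos (by positivity : 0 < T ^ a * H), ← abs_div,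
          abs_of_pos (by positivity : 0 < T ^ a * H)]
        congr 1; field_simp
    _ ≤ C * (K * T ^ a + K' * (H ^ 3 * L ^ 2 * T ^ β)) / (T ^ a * H) := by
        refine div_le_div_of_nonneg_right (h.trans (mul_le_mul_of_nonneg_left ?_ hC.le))
          (by positivity)
        exact add_le_add (mul_le_mul_of_nonneg_right hD hTa.le) hE
    _ = C * (K * H⁻¹ + K' * (H ^ 3 * L ^ 2 * T ^ β / (T ^ a * H))) := by field_simp
    _ = _ := by rw [hid, hH, Real.rpow_neg hL0.le]

section Sizes

variable {a β T θ : ℝ}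

lemma add_rpow_rpow_one_div_log_le (hT : 1 ≤ Real.log T) (hT1 : 1 ≤ T) :
    (T + T ^ a) ^ (1 / Real.log T) ≤ Real.exp (1 + max 1 a) := by
  have hT0 : 0 < T := by linarith
  rw [Real.rpow_def_of_pos (by positivity)]
  refine Real.exp_le_exp.2 ?_
  rw [mul_one_div, div_le_iff₀ (by linarith)]
  linarith [log_add_rpow_le (a := a) hT1, Real.log_two_lt_d9]

lemma one_add_log_sq_le {x : ℝ} (hx : 1 ≤ x) (hθ : 0 < θ) :
    (1 + Real.log x) ^ 2 ≤ (1 + 4 / θ) ^ 2 * x ^ (θ / 2) := by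
  have h1 : 1 ≤ x ^ (θ / 4) := Real.one_le_rpow hx (by positivity)
  have h2 := Real.log_le_rpow_div (by linarith : 0 ≤ x) (by positivity : 0 < θ / 4)
  have h3 := Real.log_nonneg hx
  have hsq : x ^ (θ / 2) = (x ^ (θ / 4)) ^ 2 := by
    rw [← Real.rpow_mul_natCast (by linarith)]; congr 1; push_cast; ring
  rw [hsq, ← mul_pow]
  refine pow_le_pow_left₀ (by linarith) ?_ 2
  calc _ ≤ x ^ (θ / 4) + x ^ (θ / 4) / (θ / 4) := add_le_add h1 h2
    _ = _ := by field_simp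

lemma crudeMass_natCeil_le {k : ℕ} (hk : 1 ≤ k) (hT : 1 ≤ Real.log T) (hT1 : 1 ≤ T) (hβ : 0 ≤ β)
    (hβa : β ≤ a) (hkβ : 2 * max 1 a + 3 / 2 * β + 1 ≤ k * (2 * β - max 1 a)) (hθ : 0 < θ) :
    crudeMass k ⌈T ^ β⌉₊ (1 / Real.log T) T (T + T ^ a) ≤
      (Real.exp (1 + max 1 a) * (1 + 4 / θ) ^ 2 * (17 * (2 + β)) + (2 ^ (k + 2)) ^ 2) *
        (T ^ a * Real.log T ^ (1 + θ / 2)) := by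
  have hT0 : 0 < T := by linarith
  have hL0 : 0 < Real.log T := by linarith
  have hTa : 0 < T ^ a := by positivity
  have hE := pow_mul_natCeil_rpow_le hk hT1 hkβ
  have hE' : (T + T ^ a) ^ (k + 2) * (⌈T ^ β⌉₊ : ℝ) ^ (3 / 2 - 2 * k : ℝ) ≤ 2 ^ (k + 2) :=
    hE.trans (mul_le_of_le_one_right (by positivity)
      (Real.rpow_le_one_of_one_le_of_nonpos hT1 (by norm_num)))
  have hL1 : 1 ≤ Real.log T ^ (1 + θ / 2) := Real.one_le_rpow hT (by positivity)
  have hp := polyMass_natCeil_le hT hT1 hβ hβa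
  have hp0 : 0 ≤ polyMass ⌈T ^ β⌉₊ (T ^ a) := polyMass_nonneg (one_le_natCeil_rpow hT1) hTa.le
  unfold crudeMass
  rw [add_sub_cancel_left, one_div_one_div]
  calc _ ≤ Real.exp (1 + max 1 a) * ((1 + 4 / θ) ^ 2 * Real.log T ^ (θ / 2)) *
          (17 * (2 + β) * (T ^ a * Real.log T)) +
        T ^ a * (2 ^ (k + 2)) ^ 2 := by
        refine add_le_add (mul_le_mul (mul_le_mul (add_rpow_rpow_one_div_log_le hT hT1)
          (one_add_log_sq_le hT hθ) (by positivity) (by positivity)) hp hp0 (by positivity)) ?_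
        exact mul_le_mul_of_nonneg_left (pow_le_pow_left₀ (by positivity) hE' 2) hTa.le
    _ ≤ Real.exp (1 + max 1 a) * ((1 + 4 / θ) ^ 2 * Real.log T ^ (θ / 2)) *
          (17 * (2 + β) * (T ^ a * Real.log T)) +
        T ^ a * (2 ^ (k + 2)) ^ 2 * Real.log T ^ (1 + θ / 2) :=
        add_le_add le_rfl (le_mul_of_one_le_right (by positivity) hL1)
    _ = _ := by rw [Real.rpow_add hL0, Real.rpow_one]; ring

end Sizes

theorem tendsto_errBound_div {a α β θ : ℝ} {k : ℕ} (hk : 1 ≤ k) (hα : 0 < α) (hβ : 0 ≤ β)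
    (hβa : β ≤ a) (hkβ : 2 * max 1 a + 3 / 2 * β + 1 ≤ k * (2 * β - max 1 a))
    (hθ : 0 < θ) (hθα : 3 / 2 * θ < α) :
    Tendsto (fun T : ℝ => errBound k ⌈T ^ β⌉₊ (1 / Real.log T) (Real.log T ^ (-((1 - θ) / 2)))
      (Real.log T ^ α) T (T + T ^ a) / (T ^ a * Real.log T ^ α)) atTop (𝓝 0) := by
  set K := Real.exp (1 + max 1 a) * (1 + 4 / θ) ^ 2 * (17 * (2 + β)) + (2 ^ (k + 2)) ^ 2 with hK
  have hlim : Tendsto (fun T : ℝ => K * (Real.log T ^ (3 * α + 1 + θ / 2) * T ^ (-2 : ℝ)) +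
      K * Real.log T ^ (-(α - 3 / 2 * θ)) +
      (2 ^ 12 * (17 * (2 + β))) * (Real.log T ^ (13 * α + 1) * T ^ (-2 : ℝ)) +
      (2 ^ (k + 2)) ^ 2 * (Real.log T ^ α * T ^ (-1 : ℝ))) atTop (𝓝 0) := by
    simpa using
      ((((tendsto_log_rpow_mul_rpow_neg (3 * α + 1 + θ / 2) two_pos).const_mul K).add
        ((tendsto_log_rpow_neg (sub_pos.2 hθα)).const_mul K)).add
        ((tendsto_log_rpow_mul_rpow_neg (13 * α + 1) two_pos).const_mul
          (2 ^ 12 * (17 * (2 + β))))).add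
        ((tendsto_log_rpow_mul_rpow_neg α one_pos).const_mul ((2 ^ (k + 2)) ^ 2))
  have hK0 : 0 ≤ K := by positivity
  refine squeeze_zero' ?_ ?_ hlim
  · filter_upwards [Real.tendsto_log_atTop.eventually_ge_atTop 1, eventually_ge_atTop 1]
      with T hL1 hT1
    have hT0 : 0 < T := by linarith
    have hTa : 0 < T ^ a := by positivity
    have hN := one_le_natCeil_rpow (β := β) hT1
    have h1 := crudeMass_nonneg (k := k) (c := 1 / Real.log T) hN hT0.le
      (by linarith : T ≤ T + T ^ a)
    have h2 := polyMass_nonneg hN hTa.le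
    unfold errBound
    rw [add_sub_cancel_left]
    positivity
  filter_upwards [Real.tendsto_log_atTop.eventually_ge_atTop 1, eventually_ge_atTop 1,
    ((tendsto_rpow_atTop hθ).comp Real.tendsto_log_atTop).eventually_ge_atTop (4 * (k:ℝ) ^ 2)]
    with T hL1 hT1 hLθ
  have hT0 : 0 < T := by linarith
  have hTa : 0 < T ^ a := by positivity
  have hcr := crudeMass_natCeil_le hk hL1 hT1 hβ hβa hkβ hθ
  rw [← hK] at hcr
  have hE := pow_mul_natCeil_rpow_le hk hT1 hkβ
  have hp := polyMass_natCeil_le hL1 hT1 hβ hβa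
  have hTexp : T = Real.exp (Real.log T) := (Real.exp_log hT0).symm
  unfold errBound
  rw [add_sub_cancel_left]
  simp only [Function.comp_apply] at hLθ
  set L := Real.log T with hLdef
  have hL0 : 0 < L := by linarith
  set N := ⌈T ^ β⌉₊ with hNdef
  set H := L ^ α with hH
  have hH0 : 0 < H := by positivity
  have hH1 : 1 + H ≤ 2 * H := one_add_log_rpow_le hL1 hα.le
  have hΔ : (L ^ (-((1 - θ) / 2))) ^ 2 = L ^ (-(1 - θ)) := by
    rw [← Real.rpow_mul_natCast hL0.le]; congr 1; push_cast; ring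
  rw [hΔ]
  have hexp : Real.exp ((2 * k) ^ 2 / (2 * L ^ (-(1 - θ)))) ^ 2 ≤ T := by
    rw [← Real.exp_nat_mul]
    conv_rhs => rw [hTexp]
    refine Real.exp_le_exp.2 ?_
    rw [neg_sub, Real.rpow_sub hL0, Real.rpow_one]
    have : 0 < L ^ θ := by positivity
    calc _ = 4 * (k:ℝ) ^ 2 * L / L ^ θ := by push_cast; field_simp; ring
      _ ≤ L := by
        rw [div_le_iff₀ this, mul_comm L]
        exact mul_le_mul_of_nonneg_right hLθ hL0.le
  have hT2 : T ^ (-2 : ℝ) = (T ^ 2)⁻¹ := by rw [Real.rpow_neg hT0.le, Real.rpow_two]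
  have hT1' : T ^ (-1 : ℝ) = T⁻¹ := Real.rpow_neg_one T
  have e1 : L ^ (3 * α + 1 + θ / 2) = H ^ 3 * L ^ (1 + θ / 2) := by
    rw [hH, ← Real.rpow_mul_natCast hL0.le, ← Real.rpow_add hL0]; congr 1; push_cast; ring
  have e2 : L ^ (-(α - 3 / 2 * θ)) = L ^ (-(1 - θ)) * L ^ (1 + θ / 2) / H := by
    rw [hH, ← Real.rpow_add hL0, ← Real.rpow_sub hL0]; congr 1; ring
  have e3 : L ^ (13 * α + 1) = H ^ 13 * L := by
    rw [hH, ← Real.rpow_mul_natCast hL0.le, Real.rpow_add_one hL0.ne']; congr 2; push_cast; ring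
  rw [hT2, hT1', e1, e2, e3]
  rw [hT1'] at hE
  set D := L ^ (-(1 - θ)) with hD
  set Q := L ^ (1 + θ / 2) with hQ
  have hD0 : 0 < D := by positivity
  have hQ0 : 0 < Q := by positivity
  have b1 : ((H ^ 2 / T) ^ 2 + D) * crudeMass k N (1 / L) T (T + T ^ a) ≤
      ((H ^ 2 / T) ^ 2 + D) * (K * (T ^ a * Q)) :=
    mul_le_mul_of_nonneg_left hcr (by positivity)
  have b2 : (H * (1 + H) ^ 6 / T) ^ 2 * polyMass N (T ^ a) ≤
      (H * (2 * H) ^ 6 / T) ^ 2 * (17 * (2 + β) * (T ^ a * L)) := by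
    have h6 : (1 + H) ^ 6 ≤ (2 * H) ^ 6 := pow_le_pow_left₀ (by positivity) hH1 6
    refine mul_le_mul (pow_le_pow_left₀ (by positivity) ?_ 2) hp
      (polyMass_nonneg (one_le_natCeil_rpow hT1) hTa.le) (by positivity)
    exact div_le_div_of_nonneg_right (mul_le_mul_of_nonneg_left h6 hH0.le) hT0.le
  have b3 : T ^ a * (H * (Real.exp ((2 * k) ^ 2 / (2 * D)) *
      ((T + T ^ a) ^ (k + 2) * (N:ℝ) ^ (3 / 2 - 2 * k : ℝ)))) ^ 2 ≤
      T ^ a * (H ^ 2 * (T * (2 ^ (k + 2) * T⁻¹) ^ 2)) := by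
    rw [mul_pow, mul_pow]
    refine mul_le_mul_of_nonneg_left (mul_le_mul_of_nonneg_left ?_ (by positivity)) hTa.le
    exact mul_le_mul hexp (pow_le_pow_left₀ (by positivity) hE 2) (by positivity) hT0.le
  calc _ ≤ (((H ^ 2 / T) ^ 2 + D) * (K * (T ^ a * Q)) +
        ((H * (2 * H) ^ 6 / T) ^ 2 * (17 * (2 + β) * (T ^ a * L)) +
          T ^ a * (H ^ 2 * (T * (2 ^ (k + 2) * T⁻¹) ^ 2)))) / (T ^ a * H) :=
        div_le_div_of_nonneg_right (add_le_add b1 (add_le_add b2 b3)) (by positivity)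
    _ = _ := by
        clear_value K D Q
        field_simp
        ring

lemma norm_mainTerm_sq (N : ℕ) (Δ H : ℝ) {t : ℝ} (ht : 0 < t) :
    ‖mainTerm N Δ H t‖ ^ 2 =
      (powWeight t * ‖gammaWeight (line 0 t)‖) ^ 2 * ‖smoothPoly N Δ H t‖ ^ 2 := by
  unfold mainTerm
  rw [norm_mul, norm_mul, Complex.norm_real, Real.norm_of_nonneg (powWeight_pos ht).le, mul_pow]

lemma abs_integral_mainTerm_sq_sub_le {N : ℕ} {Δ H A B δ κ : ℝ} (hA : 0 < A) (hAB : A ≤ B)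
    (h : ∀ t, A ≤ t → |(powWeight t * ‖gammaWeight (line 0 t)‖) ^ 2 - κ| ≤ δ) :
    |(∫ t in A..B, ‖mainTerm N Δ H t‖ ^ 2) - κ * ∫ t in A..B, ‖smoothPoly N Δ H t‖ ^ 2| ≤
      δ * ∫ t in A..B, ‖smoothPoly N Δ H t‖ ^ 2 := by
  have hsub : Set.uIcc A B ⊆ Set.Ioi 0 := by
    rw [Set.uIcc_of_le hAB]
    exact fun t ht => lt_of_lt_of_le hA ht.1
  have hm : IntervalIntegrable (fun t => ‖mainTerm N Δ H t‖ ^ 2) volume A B :=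
    (((continuousOn_mainTerm N Δ H).mono hsub).norm.pow 2).intervalIntegrable
  have hs : IntervalIntegrable (fun t => ‖smoothPoly N Δ H t‖ ^ 2) volume A B :=
    (((continuousOn_smoothPoly N Δ H).mono hsub).norm.pow 2).intervalIntegrable
  rw [← intervalIntegral.integral_const_mul, ← intervalIntegral.integral_const_mul,
    ← intervalIntegral.integral_sub hm (hs.const_mul κ)]
  refine (intervalIntegral.abs_integral_le_integral_abs hAB).trans ?_
  refine intervalIntegral.integral_mono_on hAB (hm.sub (hs.const_mul κ)).abs (hs.const_mul δ)
    fun t ht => ?_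
  rw [norm_mainTerm_sq N Δ H (lt_of_lt_of_le hA ht.1), ← sub_mul, abs_mul,
    abs_of_nonneg (sq_nonneg ‖smoothPoly N Δ H t‖)]
  exact mul_le_mul_of_nonneg_right (h t ht.1) (sq_nonneg _)

theorem tendsto_integral_mainTerm_sq_div {a α β : ℝ} (hα : 0 < α)
    (hβ : max 1 a / 2 < β) (hβa : β < a) {Δ : ℝ → ℝ} (hΔ : ∀ᶠ T in atTop, 0 < Δ T ∧ Δ T ≤ 1 / 2) :
    Tendsto (fun T : ℝ => (∫ t in T..(T + T ^ a),
      ‖mainTerm ⌈T ^ β⌉₊ (Δ T) (Real.log T ^ α) t‖ ^ 2) / (T ^ a * Real.log T ^ α))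
      atTop (𝓝 (Real.sqrt (Real.pi / 2) * (2 * Real.pi))) := by
  have hS := tendsto_integral_smoothPoly_sq_div hα hβ hβa hΔ
  refine tendsto_of_forall_abs_sub_le (hS.const_mul (Real.sqrt (Real.pi / 2))) hS fun δ hδ => ?_
  have hw := (Metric.tendsto_nhds.1 powWeight_mul_norm_gammaWeight_tendsto δ hδ)
  obtain ⟨T₀, hT₀⟩ := eventually_atTop.1 hw
  filter_upwards [eventually_ge_atTop T₀, eventually_gt_atTop 1] with T hT hT1
  have hT0 : 0 < T := by linarith
  have hL0 : 0 < Real.log T := Real.log_pos hT1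
  have hTa : 0 < T ^ a := by positivity
  have h := abs_integral_mainTerm_sq_sub_le (N := ⌈T ^ β⌉₊) (Δ := Δ T) (H := Real.log T ^ α) hT0
    (by linarith : T ≤ T + T ^ a) (fun t ht => (hT₀ t (hT.trans ht)).le)
  rw [← mul_div_assoc, ← mul_div_assoc, ← sub_div, abs_div,
    abs_of_pos (by positivity : 0 < T ^ a * Real.log T ^ α)]
  exact div_le_div_of_nonneg_right h (by positivity)

theorem tendsto_integral_sq_integral_XHL_div {a α : ℝ} (ha : 1 / 2 < a) (hα : 0 < α) :
    Tendsto (fun T : ℝ => (∫ t in T..(T + T ^ a),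
      (∫ u in t..(t + Real.log T ^ α), XHL u) ^ 2) / (T ^ a * Real.log T ^ α))
      atTop (𝓝 (Real.sqrt (Real.pi / 2) * (2 * Real.pi))) := by
  have hba : max 1 a / 2 < a := by
    rcases max_cases 1 a with h | h <;> linarith
  have hb1 := le_max_left 1 a
  obtain ⟨β, hβ, hβa⟩ := exists_between hba
  obtain ⟨θ, hθ, hθα⟩ := exists_between (lt_min one_pos (by positivity : 0 < 2 / 3 * α))
  obtain ⟨hθ1, hθα⟩ := lt_min_iff.1 hθα
  obtain ⟨k, hk⟩ := exists_nat_ge ((2 * max 1 a + 3 / 2 * β + 1) / (2 * β - max 1 a))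
  rw [div_le_iff₀ (by linarith)] at hk
  have hk1 : 1 ≤ k := by
    rcases Nat.eq_zero_or_pos k with rfl | h
    · norm_num at hk; linarith
    · exact h
  set Δ : ℝ → ℝ := fun T => Real.log T ^ (-((1 - θ) / 2)) with hΔdef
  have hΔ : ∀ᶠ T in atTop, 0 < Δ T ∧ Δ T ≤ 1 / 2 := by
    filter_upwards [eventually_gt_atTop 1, (tendsto_log_rpow_neg (by linarith :
      0 < (1 - θ) / 2)).eventually_le_const (by norm_num : (0:ℝ) < 1 / 2)] with T hT1 h
    exact ⟨Real.rpow_pos_of_pos (Real.log_pos hT1) _, h⟩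
  obtain ⟨C, hC, hCb⟩ := exists_integral_XHL_sub_mainTerm_le hk1
  have hm := tendsto_integral_mainTerm_sq_div hα hβ hβa hΔ
  have he := (tendsto_errBound_div hk1 hα (by linarith) hβa.le hk hθ (by linarith)).const_mul C
  rw [mul_zero] at he
  refine tendsto_of_forall_abs_sub_le hm (hm.add_const 1) fun η hη => ?_
  filter_upwards [hΔ, he.eventually_le_const (by positivity : 0 < η / (1 + 1 / η)),
    eventually_ge_atTop 4, Real.tendsto_log_atTop.eventually_ge_atTop 40,
    (tendsto_log_rpow_mul_rpow_neg α one_pos).eventually_le_const one_pos]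
    with T hΔT heT hT4 hL hHT
  have hT0 : 0 < T := by linarith
  have hL0 : 0 < Real.log T := by linarith
  have hTa : 0 < T ^ a := by positivity
  have hH : Real.log T ^ α ≤ T := by
    rwa [Real.rpow_neg_one, ← div_eq_mul_inv, div_le_one hT0] at hHT
  have hTT : T ≤ T + T ^ a := by linarith
  have hsub : Set.Icc T (T + T ^ a) ⊆ Set.Ioi 0 := fun t ht => lt_of_lt_of_le hT0 ht.1
  have h1 := hCb T (T + T ^ a) (1 / Real.log T) (Δ T) (Real.log T ^ α) ⌈T ^ β⌉₊ hT4 hTT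
    (by positivity) (one_div_le_one_div_of_le (by norm_num) hL) (one_le_natCeil_rpow (by linarith))
    hΔT.1 (by linarith [hΔT.2]) (by positivity) hH
  have h2 := abs_integral_sq_sub_le
    (f := fun t => ((∫ u in t..(t + Real.log T ^ α), XHL u : ℝ) : ℂ))
    (g := mainTerm ⌈T ^ β⌉₊ (Δ T) (Real.log T ^ α))
    (Complex.continuous_ofReal.comp (continuous_integral_XHL _)).continuousOn
    ((continuousOn_mainTerm _ _ _).mono hsub) hTT hη
  simp only [Complex.norm_real, Real.norm_eq_abs, sq_abs] at h2
  set V := T ^ a * Real.log T ^ α with hV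
  have hV0 : 0 < V := by positivity
  set m := ∫ t in T..(T + T ^ a), ‖mainTerm ⌈T ^ β⌉₊ (Δ T) (Real.log T ^ α) t‖ ^ 2
  rw [le_div_iff₀ (by positivity), ← mul_div_assoc, div_mul_eq_mul_div, div_le_iff₀ hV0] at heT
  rw [← sub_div, abs_div, abs_of_pos hV0, div_le_iff₀ hV0]
  calc _ ≤ _ := h2
    _ ≤ η * m + η * V := by
        refine add_le_add le_rfl (le_trans ?_ heT)
        rw [mul_comm]
        exact mul_le_mul_of_nonneg_right h1 (by positivity)
    _ = η * (m / V + 1) * V := by field_simp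

lemma sqrt_pi_div_two_mul : Real.sqrt (Real.pi / 2) * (2 * Real.pi) = Real.sqrt (2 * Real.pi ^ 3) := by
  have hpi := Real.pi_pos
  rw [← Real.sqrt_sq (by positivity : 0 ≤ 2 * Real.pi), ← Real.sqrt_mul (by positivity)]
  congr 1
  ring

end HardyLittlewood

/-- For fixed `a > 1/2`, `α > 0`:
`∫_T^{T+T^a} (∫_t^{t+(ln T)^α} X(u) du)² dt = (1+o(1))·√(2π³)·T^a·(ln T)^α`. -/
theorem hardy_littlewood_special (a α : ℝ) (ha : 1/2 < a) (hα : 0 < α) :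
    Filter.Tendsto
      (fun T : ℝ =>
        (∫ t in T..(T + T ^ a), (∫ u in t..(t + (Real.log T) ^ α), XHL u) ^ 2) /
          (Real.sqrt (2 * Real.pi ^ 3) * T ^ a * (Real.log T) ^ α))
      Filter.atTop (𝓝 1) := by
  have hpos : 0 < Real.sqrt (2 * Real.pi ^ 3) := Real.sqrt_pos.2 (by positivity)
  have h := (HardyLittlewood.tendsto_integral_sq_integral_XHL_div ha hα).div_const
    (Real.sqrt (2 * Real.pi ^ 3))
  rw [HardyLittlewood.sqrt_pi_div_two_mul, div_self hpos.ne'] at h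
  refine h.congr fun T => ?_
  rw [div_div]
  congr 1
  ring
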